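/- For every integral polytope P in ℝ^d there exists a positive integer c such that for every integer c' ≥ c, the dilated polytope c'·P admits a unimodular triangulation. -/

import Mathlib

open Pointwise

/-- A point of `ℝ^d` with integer coordinates. -/
def IsLatticePt {d : ℕ} (x : Fin d → ℝ) : Prop := ∀ i, ∃ z : ℤ, x i = (z : ℝ)

/-- The subgroup `ℤ^d` of integral points of `ℝ^d`. -/
def intLattice (d : ℕ) : AddSubgroup (Fin d → ℝ) where
  carrier := {x | IsLatticePt x}
  zero_mem' := fun i => ⟨0, by simp⟩
  add_mem' := by
    rintro a b ha hb i
    obtain ⟨z, hz⟩ := ha i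
    obtain ⟨w, hw⟩ := hb i
    exact ⟨z + w, by simp [hz, hw]⟩
  neg_mem' := by
    rintro a ha i
    obtain ⟨z, hz⟩ := ha i
    exact ⟨-z, by simp [hz]⟩

/-- A polytope: the convex hull of a nonempty finite set of points. -/
def IsPolytope {d : ℕ} (P : Set (Fin d → ℝ)) : Prop :=
  ∃ V : Finset (Fin d → ℝ), V.Nonempty ∧ P = convexHull ℝ (V : Set (Fin d → ℝ))

/-- An integral polytope: the convex hull of a nonempty finite set of integral points. -/
def IsIntegralPolytope {d : ℕ} (P : Set (Fin d → ℝ)) : Prop :=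
  ∃ V : Finset (Fin d → ℝ), V.Nonempty ∧ (∀ v ∈ V, IsLatticePt v) ∧
    P = convexHull ℝ (V : Set (Fin d → ℝ))

/-- A simplex: the convex hull of a nonempty affinely independent finite set. -/
def IsSimplex {d : ℕ} (P : Set (Fin d → ℝ)) : Prop :=
  ∃ V : Finset (Fin d → ℝ), V.Nonempty ∧
    AffineIndependent ℝ (Subtype.val : ↥(V : Set (Fin d → ℝ)) → (Fin d → ℝ)) ∧
    P = convexHull ℝ (V : Set (Fin d → ℝ))

/-- An integral simplex. -/
def IsIntegralSimplex {d : ℕ} (P : Set (Fin d → ℝ)) : Prop :=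
  ∃ V : Finset (Fin d → ℝ), V.Nonempty ∧ (∀ v ∈ V, IsLatticePt v) ∧
    AffineIndependent ℝ (Subtype.val : ↥(V : Set (Fin d → ℝ)) → (Fin d → ℝ)) ∧
    P = convexHull ℝ (V : Set (Fin d → ℝ))

/-- The set of differences of vertices (= extreme points) of a polytope. -/
def vertexDiffs {d : ℕ} (P : Set (Fin d → ℝ)) : Set (Fin d → ℝ) :=
  {w | ∃ u ∈ P.extremePoints ℝ, ∃ v ∈ P.extremePoints ℝ, w = u - v}

/-- `L(P)`: the subgroup of `ℤ^d` generated by differences of vertices of `P`. -/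
def latL {d : ℕ} (P : Set (Fin d → ℝ)) : AddSubgroup (Fin d → ℝ) :=
  AddSubgroup.closure (vertexDiffs P)

/-- `N(P)`: the intersection of the real span of `L(P)` with `ℤ^d`. -/
def latN {d : ℕ} (P : Set (Fin d → ℝ)) : AddSubgroup (Fin d → ℝ) :=
  (Submodule.span ℝ (vertexDiffs P)).toAddSubgroup ⊓ intLattice d

/-- The (normalized) index of an integral polytope: the group index `[N(P) : L(P)]`. -/
noncomputable def polyIndex {d : ℕ} (P : Set (Fin d → ℝ)) : ℕ :=
  ((latL P).addSubgroupOf (latN P)).index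

/-- A unimodular simplex: an integral simplex of index 1. -/
def IsUnimodularSimplex {d : ℕ} (P : Set (Fin d → ℝ)) : Prop :=
  IsIntegralSimplex P ∧ polyIndex P = 1

/-- `F` is a face of `P`: the (nonempty) set of maximizers on `P` of a linear functional. -/
def IsFaceOf {d : ℕ} (F P : Set (Fin d → ℝ)) : Prop :=
  F.Nonempty ∧ ∃ φ : (Fin d → ℝ) →ₗ[ℝ] ℝ, F = {x ∈ P | ∀ y ∈ P, φ y ≤ φ x}

/-- A triangulation of `Q`: a finite, face-closed collection of simplices with union `Q`,
any two of which meet in a (possibly empty) common face. -/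
def IsTriangulation {d : ℕ} (T : Set (Set (Fin d → ℝ))) (Q : Set (Fin d → ℝ)) : Prop :=
  T.Finite ∧ (∀ S ∈ T, IsSimplex S) ∧ ⋃₀ T = Q ∧
    (∀ S ∈ T, ∀ F, IsFaceOf F S → F ∈ T) ∧
    ∀ S₁ ∈ T, ∀ S₂ ∈ T, S₁ ∩ S₂ = ∅ ∨ (IsFaceOf (S₁ ∩ S₂) S₁ ∧ IsFaceOf (S₁ ∩ S₂) S₂)

/-- A unimodular triangulation: all of its simplices are unimodular. -/
def IsUnimodularTriangulation {d : ℕ} (T : Set (Set (Fin d → ℝ))) (Q : Set (Fin d → ℝ)) : Prop :=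
  IsTriangulation T Q ∧ ∀ S ∈ T, IsUnimodularSimplex S

namespace ConeTri

/-- The subring of integers inside the real numbers. -/
abbrev ZZ : Subring ℝ := (Int.castRingHom ℝ).range

theorem mem_ZZ {x : ℝ} : x ∈ ZZ ↔ ∃ n : ℤ, (n : ℝ) = x := Iff.rfl

theorem intCast_mem_ZZ (n : ℤ) : (n : ℝ) ∈ ZZ := ⟨n, rfl⟩

theorem natCast_mem_ZZ (n : ℕ) : (n : ℝ) ∈ ZZ := ⟨n, by simp⟩

theorem ZZ_eq_zero_or_one {x : ℝ} (hx : x ∈ ZZ) (h0 : -1 < x) (h1 : x < 2) : x = 0 ∨ x = 1 := by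
  obtain ⟨n, rfl⟩ := hx
  simp only [eq_intCast] at *
  have h0' : -1 < n := by exact_mod_cast h0
  have h1' : n < 2 := by exact_mod_cast h1
  have : n = 0 ∨ n = 1 := by omega
  rcases this with rfl | rfl <;> simp

theorem ZZ_eq_zero {x : ℝ} (hx : x ∈ ZZ) (h0 : -1 < x) (h1 : x < 1) : x = 0 := by
  rcases ZZ_eq_zero_or_one hx h0 (by linarith) with h | h
  · exact h
  · linarith

section Mass
variable {ι : Type*}

open Classical in
/-- The total coefficient of the letters satisfying `p`. -/
noncomputable def ms (p : ι → Prop) : (ι →₀ ℝ) →ₗ[ℝ] ℝ :=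
  Finsupp.linearCombination ℝ (fun v => if p v then (1 : ℝ) else 0)

/-- The total coefficient. -/
noncomputable abbrev tot : (ι →₀ ℝ) →ₗ[ℝ] ℝ := ms (fun _ => True)

theorem ms_eq_sum (p : ι → Prop) [DecidablePred p] (a : ι →₀ ℝ) {T : Finset ι}
    (h : a.support ⊆ T) : ms p a = ∑ v ∈ T with p v, a v := by
  rw [ms, Finsupp.linearCombination_apply, Finsupp.sum_of_support_subset a h _ (by simp),
    Finset.sum_filter]
  exact Finset.sum_congr rfl (fun v _ => by simp)

theorem tot_eq_sum (a : ι →₀ ℝ) {T : Finset ι} (h : a.support ⊆ T) :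
    tot a = ∑ v ∈ T, a v := by
  classical
  rw [ms_eq_sum _ a h]; simp

theorem ms_single (p : ι → Prop) (v : ι) (c : ℝ) (hv : p v) : ms p (Finsupp.single v c) = c := by
  simp [ms, hv]

theorem ms_single_not (p : ι → Prop) (v : ι) (c : ℝ) (hv : ¬ p v) :
    ms p (Finsupp.single v c) = 0 := by
  simp [ms, hv]

theorem ms_congr {p q : ι → Prop} {a : ι →₀ ℝ} (h : ∀ v ∈ a.support, (p v ↔ q v)) :
    ms p a = ms q a := by
  classical
  rw [ms_eq_sum p a subset_rfl, ms_eq_sum q a subset_rfl]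
  congr 1
  exact Finset.filter_congr h

theorem ms_zero_of {p : ι → Prop} {a : ι →₀ ℝ} (h : ∀ v ∈ a.support, ¬ p v) : ms p a = 0 := by
  classical
  rw [ms_eq_sum p a subset_rfl, Finset.filter_false_of_mem h, Finset.sum_empty]

theorem ms_eq_tot {p : ι → Prop} {a : ι →₀ ℝ} (h : ∀ v ∈ a.support, p v) : ms p a = tot a :=
  ms_congr (fun v hv => by simp [h v hv])

theorem ms_nonneg (p : ι → Prop) {a : ι →₀ ℝ} (h : 0 ≤ a) : 0 ≤ ms p a := by
  classical
  rw [ms_eq_sum p a subset_rfl]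
  exact Finset.sum_nonneg (fun v _ => h v)

theorem ms_mono {p q : ι → Prop} {a : ι →₀ ℝ} (h : 0 ≤ a) (hpq : ∀ v, p v → q v) :
    ms p a ≤ ms q a := by
  classical
  rw [ms_eq_sum p a subset_rfl, ms_eq_sum q a subset_rfl]
  apply Finset.sum_le_sum_of_subset_of_nonneg
  · intro v; simp only [Finset.mem_filter]; exact fun hv => ⟨hv.1, hpq v hv.2⟩
  · exact fun v _ _ => h v

theorem ms_split {p q r : ι → Prop} {a : ι →₀ ℝ} (h1 : ∀ v ∈ a.support, (r v ↔ p v ∨ q v))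
    (h2 : ∀ v ∈ a.support, p v → ¬ q v) : ms r a = ms p a + ms q a := by
  classical
  rw [ms_eq_sum p a subset_rfl, ms_eq_sum q a subset_rfl, ms_eq_sum r a subset_rfl,
    ← Finset.sum_union]
  · rw [← Finset.filter_or]
    congr 1
    exact Finset.filter_congr h1
  · exact Finset.disjoint_filter.2 h2

theorem apply_le_ms {p : ι → Prop} {a : ι →₀ ℝ} (h : 0 ≤ a) {v : ι} (hv : p v) :
    a v ≤ ms p a := by
  classical
  by_cases hs : v ∈ a.support
  · rw [ms_eq_sum p a subset_rfl]
    exact Finset.single_le_sum (fun u _ => h u) (Finset.mem_filter.2 ⟨hs, hv⟩)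
  · rw [Finsupp.notMem_support_iff.1 hs]; exact ms_nonneg p h

theorem ms_ZZ {p : ι → Prop} {a : ι →₀ ℝ} (h : ∀ v, p v → a v ∈ ZZ) : ms p a ∈ ZZ := by
  classical
  rw [ms_eq_sum p a subset_rfl]
  exact sum_mem (fun v hv => h v (Finset.mem_filter.1 hv).2)

theorem eq_zero_of_tot_eq_zero {a : ι →₀ ℝ} (h : 0 ≤ a) (ht : tot a = 0) : a = 0 := by
  ext v
  have h1 := apply_le_ms (p := fun _ => True) h (v := v) trivial
  have h2 := h v
  simp only [Finsupp.coe_zero, Pi.zero_apply] at *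
  linarith

/-- Evaluation of a formal combination of vectors. -/
noncomputable abbrev ev {W : Type*} [AddCommGroup W] [Module ℝ W] : (W →₀ ℝ) →ₗ[ℝ] W :=
  Finsupp.linearCombination ℝ id

theorem map_ev {W : Type*} [AddCommGroup W] [Module ℝ W] (f : W →ₗ[ℝ] ℝ) (w : W →₀ ℝ)
    {T : Finset W} (h : w.support ⊆ T) : f (ev w) = ∑ u ∈ T, w u * f u := by
  rw [ev, Finsupp.linearCombination_apply, Finsupp.sum_of_support_subset w h _ (by simp), map_sum]
  simp

theorem ev_single {W : Type*} [AddCommGroup W] [Module ℝ W] (u : W) (c : ℝ) :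
    ev (Finsupp.single u c) = c • u := by simp

theorem ms_ev (p : ι → Prop) (w : (ι →₀ ℝ) →₀ ℝ) {T : Finset (ι →₀ ℝ)} (h : w.support ⊆ T) :
    ms p (ev w) = ∑ u ∈ T, w u * ms p u := map_ev _ _ h

end Mass

section Ordered
variable {ι : Type*} [LinearOrder ι]

/-- The mass of the letters up to `x`. -/
noncomputable abbrev pre (x : ι) : (ι →₀ ℝ) →ₗ[ℝ] ℝ := ms (fun v => v ≤ x)

theorem pre_eq_lt_add (x : ι) (a : ι →₀ ℝ) : pre x a = ms (fun v => v < x) a + a x := by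
  classical
  have h1 : pre x a = ms (fun v => v < x) a + ms (fun v => v = x) a :=
    ms_split (fun v _ => le_iff_lt_or_eq) (fun v _ h => h.ne)
  rw [h1]
  congr 1
  rw [ms_eq_sum _ a (T := insert x a.support) (Finset.subset_insert _ _)]
  have : (insert x a.support).filter (fun v => v = x) = {x} := by
    ext v; simp only [Finset.mem_filter, Finset.mem_insert, Finset.mem_singleton]
    exact ⟨fun h => h.2, fun h => ⟨Or.inl h, h⟩⟩
  rw [this, Finset.sum_singleton]

theorem pre_ext {a b : ι →₀ ℝ} (h : ∀ x, pre x a = pre x b) : a = b := by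
  classical
  rw [← sub_eq_zero]
  by_contra hne
  set c := a - b with hc
  have hs : c.support.Nonempty := Finsupp.support_nonempty_iff.2 hne
  set v := c.support.min' hs
  have h1 : pre v c = 0 := by rw [hc, map_sub, h, sub_self]
  have h2 : ms (fun u => u < v) c = 0 :=
    ms_zero_of (fun u hu => not_lt.2 (Finset.min'_le _ u hu))
  have h3 := pre_eq_lt_add v c
  rw [h1, h2, zero_add] at h3
  exact (Finsupp.mem_support_iff.1 (Finset.min'_mem _ hs)) h3.symm

/-- Lower sets of letters. -/
def Low (p : ι → Prop) : Prop := ∀ v v', v ≤ v' → p v' → p v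

theorem low_le (x : ι) : Low (fun v => v ≤ x) := fun _ _ h h' => h.trans h'
theorem low_lt (x : ι) : Low (fun v => v < x) := fun _ _ h h' => h.trans_lt h'
theorem low_true : Low (fun _ : ι => True) := fun _ _ _ _ => trivial

theorem Low.cases {p : ι → Prop} (hp : Low p) (T : Finset ι) :
    (∀ a : ι →₀ ℝ, a.support ⊆ T → ms p a = 0) ∨
    ∃ v ∈ T, p v ∧ ∀ a : ι →₀ ℝ, a.support ⊆ T → ms p a = pre v a := by
  classical
  by_cases hne : (T.filter p).Nonempty
  · right
    have hm := Finset.mem_filter.1 (Finset.max'_mem _ hne)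
    refine ⟨_, hm.1, hm.2, fun a ha => ms_congr fun v hv => ⟨fun h => ?_, fun h => hp _ _ h hm.2⟩⟩
    exact Finset.le_max' _ _ (Finset.mem_filter.2 ⟨ha hv, h⟩)
  · left
    intro a ha
    apply ms_zero_of
    intro v hv hpv
    exact hne ⟨v, Finset.mem_filter.2 ⟨ha hv, hpv⟩⟩

/-- Apply `G` to the partial sums of a vector. -/
noncomputable def tr (G : ℝ → ℝ) (a : ι →₀ ℝ) : ι →₀ ℝ :=
  Finsupp.onFinset a.support (fun v => G (pre v a) - G (ms (fun u => u < v) a)) (by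
    intro v hv
    by_contra h
    apply hv
    rw [pre_eq_lt_add, Finsupp.notMem_support_iff.1 h, add_zero, sub_self])

theorem tr_apply (G : ℝ → ℝ) (a : ι →₀ ℝ) (v : ι) :
    tr G a v = G (pre v a) - G (ms (fun u => u < v) a) := rfl

theorem tr_support (G : ℝ → ℝ) (a : ι →₀ ℝ) : (tr G a).support ⊆ a.support :=
  Finsupp.support_onFinset_subset

theorem sum_telescope (G : ℝ → ℝ) (a : ι → ℝ) (T : Finset ι) :
    ∑ v ∈ T, (G (∑ u ∈ T with u ≤ v, a u) - G (∑ u ∈ T with u < v, a u)) =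
      G (∑ v ∈ T, a v) - G 0 := by
  induction T using Finset.induction_on_max with
  | empty => simp
  | insert M T hM ih =>
    have hnot : M ∉ T := fun h => lt_irrefl _ (hM M h)
    rw [Finset.sum_insert hnot]
    have e1 : (insert M T).filter (fun u => u ≤ M) = insert M T := by
      apply Finset.filter_true_of_mem
      intro u hu
      rcases Finset.mem_insert.1 hu with rfl | h
      · exact le_rfl
      · exact (hM u h).le
    have e2 : (insert M T).filter (fun u => u < M) = T := by
      rw [Finset.filter_insert, if_neg (lt_irrefl _), Finset.filter_true_of_mem hM]
    have e3 : ∀ v ∈ T, (G (∑ u ∈ insert M T with u ≤ v, a u) -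
        G (∑ u ∈ insert M T with u < v, a u)) =
        (G (∑ u ∈ T with u ≤ v, a u) - G (∑ u ∈ T with u < v, a u)) := by
      intro v hv
      rw [Finset.filter_insert, if_neg (not_le.2 (hM v hv)), Finset.filter_insert,
        if_neg (not_lt.2 (hM v hv).le)]
    rw [e1, e2, Finset.sum_congr rfl e3, ih]
    ring

theorem ms_tr {p : ι → Prop} (hp : Low p) (G : ℝ → ℝ) (a : ι →₀ ℝ) :
    ms p (tr G a) = G (ms p a) - G 0 := by
  classical
  rw [ms_eq_sum p _ (tr_support G a), ms_eq_sum p a subset_rfl, ← sum_telescope]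
  apply Finset.sum_congr rfl
  intro v hv
  have hv' := (Finset.mem_filter.1 hv).2
  rw [tr_apply, ms_eq_sum _ a subset_rfl, ms_eq_sum _ a subset_rfl, Finset.filter_filter,
    Finset.filter_filter]
  congr 3
  · exact Finset.filter_congr (fun u _ => ⟨fun h => ⟨hp _ _ h hv', h⟩, fun h => h.2⟩)
  · exact Finset.filter_congr (fun u _ => ⟨fun h => ⟨hp _ _ h.le hv', h⟩, fun h => h.2⟩)

theorem lt_le_pre {a : ι →₀ ℝ} (ha : 0 ≤ a) (v : ι) : ms (fun u => u < v) a ≤ pre v a :=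
  ms_mono ha (fun _ h => h.le)

theorem tr_nonneg {G : ℝ → ℝ} (hG : Monotone G) {a : ι →₀ ℝ} (ha : 0 ≤ a) : 0 ≤ tr G a := by
  intro v
  simp only [Finsupp.coe_zero, Pi.zero_apply, tr_apply, sub_nonneg]
  exact hG (lt_le_pre ha v)

theorem tr_ZZ {G : ℝ → ℝ} (hG : ∀ x, G x ∈ ZZ) (a : ι →₀ ℝ) (v : ι) : tr G a v ∈ ZZ :=
  sub_mem (hG _) (hG _)

/-- Splitting off a prescribed mass from the beginning. -/
theorem exists_split {a : ι →₀ ℝ} (ha : 0 ≤ a) {m : ℝ} (h0 : 0 ≤ m) (hm : m ≤ tot a) :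
    ∃ p r : ι →₀ ℝ, p + r = a ∧ 0 ≤ p ∧ 0 ≤ r ∧ tot p = m ∧
      ∀ v v', p v ≠ 0 → r v' ≠ 0 → v ≤ v' := by
  have key : ∀ v, a v = pre v a - ms (fun u => u < v) a := fun v => by rw [pre_eq_lt_add]; ring
  refine ⟨tr (fun x => min x m) a, a - tr (fun x => min x m) a, by abel,
    tr_nonneg (fun x y h => min_le_min_right m h) ha, ?_, ?_, ?_⟩
  · intro v
    have h1 := lt_le_pre ha v
    simp only [Finsupp.coe_zero, Pi.zero_apply, Finsupp.coe_sub, Pi.sub_apply, tr_apply, key v]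
    rcases min_cases (pre v a) m with h | h <;>
    rcases min_cases (ms (fun u => u < v) a) m with h' | h' <;> linarith
  · rw [tot, ms_tr low_true]
    simp only [min_eq_right hm, min_eq_left h0, sub_zero]
  · intro v v' hp hr
    by_contra hlt
    push Not at hlt
    have h2 : pre v' a ≤ ms (fun u => u < v) a := ms_mono ha (fun u h => h.trans_lt hlt)
    have h3 := lt_le_pre ha v'
    have h4 := lt_le_pre ha v
    apply hr
    simp only [Finsupp.coe_sub, Pi.sub_apply, tr_apply, key v'] at hp ⊢
    rcases min_cases (pre v' a) m with h | h <;>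
    rcases min_cases (ms (fun u => u < v') a) m with h' | h' <;>
    rcases min_cases (pre v a) m with h5 | h5 <;>
    rcases min_cases (ms (fun u => u < v) a) m with h6 | h6 <;>
    first
      | linarith
      | (exfalso; apply hp; linarith)

theorem pre_of_ordered {p r : ι →₀ ℝ} (hp : 0 ≤ p) (hr : 0 ≤ r)
    (h : ∀ v v', p v ≠ 0 → r v' ≠ 0 → v ≤ v') (x : ι) :
    pre x p = min (pre x (p + r)) (tot p) := by
  rw [map_add]
  have h1 : pre x p ≤ tot p := ms_mono hp (fun _ _ => trivial)
  have h2 : 0 ≤ pre x r := ms_nonneg _ hr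
  by_cases hex : ∃ v', r v' ≠ 0 ∧ v' ≤ x
  · obtain ⟨v', hv', hx⟩ := hex
    have h3 : pre x p = tot p :=
      ms_eq_tot (fun v hv => (h v v' (Finsupp.mem_support_iff.1 hv) hv').trans hx)
    rw [min_eq_right (by linarith), h3]
  · push Not at hex
    have h3 : pre x r = 0 :=
      ms_zero_of (fun v hv => not_le.2 (hex v (Finsupp.mem_support_iff.1 hv)))
    rw [min_eq_left (by linarith), h3, add_zero]

theorem split_unique {p r p' r' : ι →₀ ℝ} (hp : 0 ≤ p) (hr : 0 ≤ r) (hp' : 0 ≤ p') (hr' : 0 ≤ r')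
    (h : ∀ v v', p v ≠ 0 → r v' ≠ 0 → v ≤ v') (h' : ∀ v v', p' v ≠ 0 → r' v' ≠ 0 → v ≤ v')
    (he : p + r = p' + r') (ht : tot p = tot p') : p = p' ∧ r = r' := by
  have h1 : p = p' := pre_ext (fun x => by
    rw [pre_of_ordered hp hr h, pre_of_ordered hp' hr' h', he, ht])
  subst h1
  exact ⟨rfl, add_left_cancel he⟩

theorem split_ZZ {P R : Set ι} (h : ∀ v ∈ P, ∀ v' ∈ R, v ≤ v') {p r : ι →₀ ℝ}
    (hp : ∀ v, p v ≠ 0 → v ∈ P) (hr : ∀ v, r v ≠ 0 → v ∈ R) (ht : tot p ∈ ZZ)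
    (hi : ∀ v, p v + r v ∈ ZZ) : (∀ v, p v ∈ ZZ) ∧ ∀ v, r v ∈ ZZ := by
  classical
  have h1 : ∀ v, v ∉ R → p v ∈ ZZ := by
    intro v hv
    have : r v = 0 := by by_contra h; exact hv (hr v h)
    simpa [this] using hi v
  have h2 : ∀ v, p v ∈ ZZ := by
    intro v
    by_cases hv : v ∈ R
    · by_cases hp0 : p v = 0
      · rw [hp0]; exact zero_mem _
      have hvP := hp v hp0
      have h3 : tot p = p v + ∑ u ∈ p.support.erase v, p u := by
        rw [tot_eq_sum p subset_rfl, Finset.add_sum_erase _ _ (Finsupp.mem_support_iff.2 hp0)]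
      have h4 : ∑ u ∈ p.support.erase v, p u ∈ ZZ := by
        apply sum_mem
        intro u hu
        rw [Finset.mem_erase, Finsupp.mem_support_iff] at hu
        apply h1
        intro huR
        exact hu.1 (le_antisymm (h u (hp u hu.2) v hv) (h v hvP u huR))
      have : p v = tot p - ∑ u ∈ p.support.erase v, p u := by rw [h3]; ring
      rw [this]; exact sub_mem ht h4
    · exact h1 v hv
  exact ⟨h2, fun v => by simpa using sub_mem (hi v) (h2 v)⟩

/-- Prefix sums of `u` exceed those of `u'` by zero or one. -/
def Rel (u u' : ι →₀ ℝ) : Prop := ∀ x, pre x u - pre x u' = 0 ∨ pre x u - pre x u' = 1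

/-- Pairwise related vectors. -/
def Chain (S : Set (ι →₀ ℝ)) : Prop := ∀ u ∈ S, ∀ u' ∈ S, Rel u u' ∨ Rel u' u

theorem Chain.mono {S S' : Set (ι →₀ ℝ)} (h : Chain S) (hs : S' ⊆ S) : Chain S' :=
  fun u hu u' hu' => h u (hs hu) u' (hs hu')

theorem Rel.le {u u' : ι →₀ ℝ} (h : Rel u u') (x : ι) : pre x u' ≤ pre x u := by
  rcases h x with h | h <;> linarith

theorem Rel.refl (u : ι →₀ ℝ) : Rel u u := fun x => by simp

theorem Chain.rel_of_le {S : Set (ι →₀ ℝ)} (h : Chain S) {u u' : ι →₀ ℝ} (hu : u ∈ S)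
    (hu' : u' ∈ S) (hle : ∀ x, pre x u' ≤ pre x u) : Rel u u' := by
  rcases h u hu u' hu' with h | h
  · exact h
  · have : u = u' := pre_ext (fun x => le_antisymm (h.le x) (hle x))
    rw [this]; exact Rel.refl _

theorem Chain.exists_first {S : Finset (ι →₀ ℝ)} (h : Chain (S : Set (ι →₀ ℝ)))
    (hne : S.Nonempty) : ∃ u ∈ S, ∀ u' ∈ S, Rel u u' := by
  classical
  suffices H : ∃ u ∈ S, ∀ u' ∈ S, ∀ x, pre x u' ≤ pre x u by
    obtain ⟨u, hu, H⟩ := H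
    exact ⟨u, hu, fun u' hu' => h.rel_of_le hu hu' (H u' hu')⟩
  induction hne using Finset.Nonempty.cons_induction with
  | singleton a => exact ⟨a, by simp, by simp⟩
  | cons a s ha hs ih =>
    obtain ⟨u, hu, H⟩ := ih (h.mono (by simp))
    rcases h a (by simp) u (by simp [hu]) with h1 | h1
    · refine ⟨a, by simp, fun u' hu' x => ?_⟩
      rcases Finset.mem_cons.1 hu' with rfl | h2
      · exact le_rfl
      · exact (H u' h2 x).trans (h1.le x)
    · refine ⟨u, by simp [hu], fun u' hu' x => ?_⟩
      rcases Finset.mem_cons.1 hu' with rfl | h2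
      · exact h1.le x
      · exact H u' h2 x

theorem Chain.exists_last {S : Finset (ι →₀ ℝ)} (h : Chain (S : Set (ι →₀ ℝ)))
    (hne : S.Nonempty) : ∃ u ∈ S, ∀ u' ∈ S, Rel u' u := by
  classical
  suffices H : ∃ u ∈ S, ∀ u' ∈ S, ∀ x, pre x u ≤ pre x u' by
    obtain ⟨u, hu, H⟩ := H
    exact ⟨u, hu, fun u' hu' => h.rel_of_le hu' hu (H u' hu')⟩
  induction hne using Finset.Nonempty.cons_induction with
  | singleton a => exact ⟨a, by simp, by simp⟩
  | cons a s ha hs ih =>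
    obtain ⟨u, hu, H⟩ := ih (h.mono (by simp))
    rcases h a (by simp) u (by simp [hu]) with h1 | h1
    · refine ⟨u, by simp [hu], fun u' hu' x => ?_⟩
      rcases Finset.mem_cons.1 hu' with rfl | h2
      · exact h1.le x
      · exact H u' h2 x
    · refine ⟨a, by simp, fun u' hu' x => ?_⟩
      rcases Finset.mem_cons.1 hu' with rfl | h2
      · exact le_rfl
      · exact (h1.le x).trans (H u' h2 x)

/-- An initial part of a chain is separated from the rest by a single prefix. -/
theorem Chain.cut {S T : Finset (ι →₀ ℝ)} (hS : Chain (S : Set (ι →₀ ℝ)))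
    (hT : Chain (T : Set (ι →₀ ℝ))) (hSn : S.Nonempty) (hTn : T.Nonempty)
    (h : ∀ u ∈ S, ∀ u' ∈ T, Rel u u' ∧ u ≠ u') :
    ∃ x, ∀ u ∈ S, ∀ u' ∈ T, pre x u - pre x u' = 1 := by
  obtain ⟨a, ha, hla⟩ := hS.exists_last hSn
  obtain ⟨b, hb, hfb⟩ := hT.exists_first hTn
  obtain ⟨hr, hne⟩ := h a ha b hb
  have : ∃ x, pre x a - pre x b = 1 := by
    by_contra hcon
    push Not at hcon
    apply hne
    apply pre_ext
    intro x
    rcases hr x with h | h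
    · linarith
    · exact absurd h (hcon x)
  obtain ⟨x, hx⟩ := this
  refine ⟨x, fun u hu u' hu' => ?_⟩
  have h1 := (hla u hu).le x
  have h2 := (hfb u' hu').le x
  rcases (h u hu u' hu').1 x with h3 | h3
  · linarith
  · exact h3

theorem chain_ZZ (o : ι → ℝ) (n : ℕ) : ∀ S : Finset (ι →₀ ℝ), S.card = n →
    Chain (S : Set (ι →₀ ℝ)) → (∀ u ∈ S, ∀ x, pre x u - o x ∈ ZZ) →
    ∀ β : (ι →₀ ℝ) →₀ ℝ, β.support ⊆ S → tot β ∈ ZZ →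
    (∀ x, pre x (ev β) - tot β * o x ∈ ZZ) → ∀ u, β u ∈ ZZ := by
  classical
  induction n with
  | zero =>
    intro S hS _ _ β hβ _ _ u
    rw [Finset.card_eq_zero] at hS
    subst hS
    rw [Finset.subset_empty, Finsupp.support_eq_empty] at hβ
    rw [hβ]; exact zero_mem _
  | succ n ih =>
    intro S hS hch ho β hβ ht hp
    have hne : S.Nonempty := Finset.card_pos.1 (by omega)
    obtain ⟨u0, hu0, hf⟩ := hch.exists_first hne
    have hsum : tot β = β u0 + ∑ u ∈ S.erase u0, β u := by
      rw [tot_eq_sum β hβ, Finset.add_sum_erase _ _ hu0]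
    have h0 : β u0 ∈ ZZ := by
      by_cases hrest : (S.erase u0).Nonempty
      · obtain ⟨x, hx⟩ := Chain.cut (S := {u0}) (T := S.erase u0) (hch.mono (by simpa using hu0))
          (hch.mono (by simp)) (by simp) hrest (by
            intro u hu u' hu'
            rw [Finset.mem_singleton] at hu
            subst hu
            rw [Finset.mem_erase] at hu'
            exact ⟨hf u' hu'.2, hu'.1.symm⟩)
        have h1 : pre x (ev β) = tot β * pre x u0 - (tot β - β u0) := by
          rw [ms_ev _ β hβ, ← Finset.add_sum_erase _ _ hu0]
          have : ∀ u ∈ S.erase u0, β u * pre x u = β u * (pre x u0 - 1) := by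
            intro u hu
            have := hx u0 (by simp) u hu
            rw [← this]; ring
          rw [Finset.sum_congr rfl this, ← Finset.sum_mul, hsum]
          ring
        have h2 : β u0 = (pre x (ev β) - tot β * o x) - tot β * (pre x u0 - o x) + tot β := by
          rw [h1]; ring
        rw [h2]
        exact add_mem (sub_mem (hp x) (mul_mem ht (ho u0 hu0 x))) ht
      · rw [Finset.not_nonempty_iff_eq_empty] at hrest
        rw [hrest, Finset.sum_empty, add_zero] at hsum
        rw [← hsum]; exact ht
    have hIH := ih (S.erase u0) (by rw [Finset.card_erase_of_mem hu0]; omega)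
      (hch.mono (by simp)) (fun u hu => ho u (Finset.mem_of_mem_erase hu))
      (β - Finsupp.single u0 (β u0)) (by
        intro u hu
        rw [Finsupp.mem_support_iff] at hu
        rw [Finset.mem_erase]
        have hne' : u ≠ u0 := by
          rintro rfl; simp at hu
        refine ⟨hne', hβ ?_⟩
        rw [Finsupp.mem_support_iff]
        simpa [Finsupp.single_apply, hne'.symm] using hu) (by
        rw [map_sub, ms_single _ _ _ trivial]; exact sub_mem ht h0) (by
        intro x
        rw [map_sub, map_sub, map_sub, ms_single _ _ _ trivial, ev_single, map_smul, smul_eq_mul]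
        have : pre x (ev β) - β u0 * pre x u0 - (tot β - β u0) * o x =
          (pre x (ev β) - tot β * o x) - β u0 * (pre x u0 - o x) := by ring
        rw [this]
        exact sub_mem (hp x) (mul_mem h0 (ho u0 hu0 x)))
    intro u
    by_cases hu : u = u0
    · rw [hu]; exact h0
    · have := hIH u
      simpa [Finsupp.single_apply, Ne.symm hu] using this

theorem chain_unique (o : ι → ℝ) (n : ℕ) : ∀ w w' : (ι →₀ ℝ) →₀ ℝ,
    w.support.card + w'.support.card = n → 0 ≤ w → 0 ≤ w' →
    Chain (w.support : Set (ι →₀ ℝ)) → Chain (w'.support : Set (ι →₀ ℝ)) →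
    (∀ u ∈ w.support, ∀ x, pre x u - o x ∈ ZZ) → (∀ u ∈ w'.support, ∀ x, pre x u - o x ∈ ZZ) →
    tot w = tot w' → ev w = ev w' → w = w' := by
  classical
  induction n using Nat.strong_induction_on with
  | _ n ih =>
  intro w w' hn hw hw' hc hc' ho ho' ht he
  by_cases h0 : w = 0
  · subst h0
    rw [map_zero] at ht
    exact (eq_zero_of_tot_eq_zero hw' ht.symm).symm
  by_cases h0' : w' = 0
  · subst h0'
    rw [map_zero] at ht
    exact eq_zero_of_tot_eq_zero hw ht
  obtain ⟨u, hu, hf⟩ := hc.exists_first (Finsupp.support_nonempty_iff.2 h0)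
  obtain ⟨u', hu', hf'⟩ := hc'.exists_first (Finsupp.support_nonempty_iff.2 h0')
  have bd : ∀ (w : (ι →₀ ℝ) →₀ ℝ) (u : ι →₀ ℝ), 0 ≤ w → u ∈ w.support →
      (∀ u' ∈ w.support, Rel u u') → ∀ x, pre x (ev w) ≤ tot w * pre x u ∧
      tot w * (pre x u - 1) < pre x (ev w) := by
    intro w u hw hu hf x
    rw [ms_ev _ w subset_rfl, tot_eq_sum w subset_rfl, Finset.sum_mul, Finset.sum_mul]
    constructor
    · apply Finset.sum_le_sum
      intro v hv
      exact mul_le_mul_of_nonneg_left ((hf v hv).le x) (hw v)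
    · apply Finset.sum_lt_sum
      · intro v hv
        apply mul_le_mul_of_nonneg_left _ (hw v)
        rcases hf v hv x with h | h <;> linarith
      · refine ⟨u, hu, ?_⟩
        have : 0 < w u := lt_of_le_of_ne (hw u) (Ne.symm (Finsupp.mem_support_iff.1 hu))
        nlinarith
  have htpos : 0 < tot w := lt_of_le_of_ne (ms_nonneg _ hw)
    (fun h => h0 (eq_zero_of_tot_eq_zero hw h.symm))
  have huu : u = u' := by
    apply pre_ext
    intro x
    obtain ⟨a1, a2⟩ := bd w u hw hu hf x
    obtain ⟨b1, b2⟩ := bd w' u' hw' hu' hf' x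
    rw [← he, ← ht] at b1 b2
    have c1 : pre x u - 1 < pre x u' := lt_of_mul_lt_mul_left (a2.trans_le b1) htpos.le
    have c2 : pre x u' - 1 < pre x u := lt_of_mul_lt_mul_left (b2.trans_le a1) htpos.le
    have : pre x u - pre x u' ∈ ZZ := by
      have := sub_mem (ho u hu x) (ho' u' hu' x)
      simpa using this
    have := ZZ_eq_zero this (by linarith) (by linarith)
    linarith
  subst huu
  have hsub : ∀ (w : (ι →₀ ℝ) →₀ ℝ) (m : ℝ), u ∈ w.support →
      (w - Finsupp.single u m).support ⊆ w.support := by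
    intro w m hu v hv
    by_cases h : v = u
    · rw [h]; exact hu
    · rw [Finsupp.mem_support_iff] at hv ⊢
      simpa [Finsupp.single_apply, Ne.symm h] using hv
  have hnn : ∀ (w : (ι →₀ ℝ) →₀ ℝ) (m : ℝ), 0 ≤ w → m ≤ w u → 0 ≤ w - Finsupp.single u m := by
    intro w m hw hm v
    by_cases h : u = v
    · subst h; simpa using hm
    · simpa [Finsupp.single_apply, h] using hw v
  set m := min (w u) (w' u) with hm
  have hlt : (w - Finsupp.single u m).support.card + (w' - Finsupp.single u m).support.card < n := by
    have l1 := Finset.card_le_card (hsub w m hu)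
    have l2 := Finset.card_le_card (hsub w' m hu')
    rcases min_choice (w u) (w' u) with h | h
    · have : (w - Finsupp.single u m).support ⊂ w.support := by
        refine Finset.ssubset_iff_subset_ne.2 ⟨hsub w m hu, fun h' => ?_⟩
        rw [← h', Finsupp.mem_support_iff] at hu
        apply hu; rw [hm, h]; simp
      have := Finset.card_lt_card this
      omega
    · have : (w' - Finsupp.single u m).support ⊂ w'.support := by
        refine Finset.ssubset_iff_subset_ne.2 ⟨hsub w' m hu', fun h' => ?_⟩
        rw [← h', Finsupp.mem_support_iff] at hu'
        apply hu'; rw [hm, h]; simp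
      have := Finset.card_lt_card this
      omega
  have := ih _ hlt (w - Finsupp.single u m) (w' - Finsupp.single u m) rfl
    (hnn w m hw (min_le_left _ _)) (hnn w' m hw' (min_le_right _ _))
    (hc.mono (by exact_mod_cast hsub w m hu)) (hc'.mono (by exact_mod_cast hsub w' m hu'))
    (fun v hv => ho v (hsub w m hu hv)) (fun v hv => ho' v (hsub w' m hu' hv))
    (by rw [map_sub, map_sub, ht]) (by rw [map_sub, map_sub, he])
  exact sub_left_injective this

open Classical in
theorem chain_exists_aux (n : ℕ) : ∀ (r : ι →₀ ℝ) (t : ℝ) (N : ℤ), 0 ≤ r → 0 < t →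
    tot r = N * t → (r.support.filter (fun v => pre v r / t ∉ ZZ)).card = n →
    ∃ w : (ι →₀ ℝ) →₀ ℝ, 0 ≤ w ∧ tot w = t ∧ ev w = r ∧ Chain (w.support : Set (ι →₀ ℝ)) ∧
    ∀ u ∈ w.support, 0 ≤ u ∧ (∀ v, u v ∈ ZZ) ∧ u.support ⊆ r.support ∧
      ∀ p, Low p → ∀ n : ℤ, (n * t ≤ ms p r → n ≤ ms p u) ∧ (ms p r ≤ n * t → ms p u ≤ n) := by
  classical
  induction n using Nat.strong_induction_on with
  | _ n ih =>
  intro r t N hr ht hN hn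
  set u₁ := tr (fun x => (⌈x / t⌉ : ℝ)) r with hu₁
  have hms : ∀ p, Low p → ms p u₁ = (⌈ms p r / t⌉ : ℝ) := by
    intro p hp
    rw [hu₁, ms_tr hp]; simp
  have hu0 : 0 ≤ u₁ := tr_nonneg (fun x y h => by
    simp only [Int.cast_le]; exact Int.ceil_le_ceil (div_le_div_of_nonneg_right h ht.le)) hr
  have huZ : ∀ v, u₁ v ∈ ZZ := tr_ZZ (fun x => intCast_mem_ZZ _) r
  have hus : u₁.support ⊆ r.support := tr_support _ _
  -- upper and lower bounds from the ceiling
  have hup : ∀ p, ms p r ≤ (⌈ms p r / t⌉ : ℝ) * t := fun p => by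
    have := Int.le_ceil (ms p r / t)
    rwa [div_le_iff₀ ht] at this
  have hlo : ∀ p, ((⌈ms p r / t⌉ : ℝ) - 1) * t < ms p r := fun p => by
    have := Int.ceil_lt_add_one (ms p r / t)
    rw [← lt_div_iff₀ ht]; linarith
  have hone : ∀ p, Low p → ∀ n : ℤ,
      (n * t ≤ ms p r → n ≤ ms p u₁) ∧ (ms p r ≤ n * t → ms p u₁ ≤ n) := by
    intro p hp n
    rw [hms p hp]
    constructor
    · intro h
      have := h.trans (hup p)
      exact le_of_mul_le_mul_right this ht
    · intro h
      have := (hlo p).trans_le h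
      have := lt_of_mul_lt_mul_right this ht.le
      have h2 : (⌈ms p r / t⌉ : ℤ) - 1 < n := by exact_mod_cast this
      have : (⌈ms p r / t⌉ : ℤ) ≤ n := by omega
      exact_mod_cast this
  obtain ⟨ε, hε0, hεt, hεle, hεor⟩ : ∃ ε, 0 < ε ∧ ε ≤ t ∧
      (∀ v ∈ r.support, ε ≤ pre v r - ((⌈pre v r / t⌉ : ℝ) - 1) * t) ∧
      (ε = t ∨ ∃ v ∈ r.support, ε = pre v r - ((⌈pre v r / t⌉ : ℝ) - 1) * t) := by
    by_cases hne : r.support.Nonempty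
    · obtain ⟨v, hv, hmin⟩ := Finset.exists_min_image r.support
        (fun v => pre v r - ((⌈pre v r / t⌉ : ℝ) - 1) * t) hne
      refine ⟨_, ?_, ?_, hmin, Or.inr ⟨v, hv, rfl⟩⟩
      · have := hlo (fun u => u ≤ v); linarith
      · have := hup (fun u => u ≤ v); linarith
    · exact ⟨t, ht, le_rfl, fun v hv => absurd ⟨v, hv⟩ hne, Or.inl rfl⟩
  have hεp : ∀ p, Low p → ε ≤ ms p r - ((⌈ms p r / t⌉ : ℝ) - 1) * t := by
    intro p hp
    rcases hp.cases r.support with h | ⟨v, hv, -, h⟩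
    · rw [h r subset_rfl]; simpa using hεt
    · rw [h r subset_rfl]; exact hεle v hv
  set r' := r - ε • u₁ with hr'
  have hmr' : ∀ p, Low p → ms p r' = ms p r - ε * (⌈ms p r / t⌉ : ℝ) := by
    intro p hp
    rw [hr', map_sub, map_smul, hms p hp, smul_eq_mul]
  have hs' : r'.support ⊆ r.support := by
    intro v hv
    by_contra h
    have h1 : r v = 0 := Finsupp.notMem_support_iff.1 h
    have h2 : u₁ v = 0 := Finsupp.notMem_support_iff.1 (fun h' => h (hus h'))
    rw [Finsupp.mem_support_iff] at hv
    apply hv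
    simp [hr', h1, h2]
  have hr'0 : 0 ≤ r' := by
    intro v
    simp only [Finsupp.coe_zero, Pi.zero_apply]
    have e1 := pre_eq_lt_add v r'
    rw [hmr' _ (low_le v), hmr' _ (low_lt v)] at e1
    have mono := lt_le_pre hr v
    have k1 := hεp _ (low_le v)
    have k2 := hup (fun u => u < v)
    by_cases hc : ⌈pre v r / t⌉ = ⌈ms (fun u => u < v) r / t⌉
    · rw [hc] at e1; linarith
    · have : ⌈ms (fun u => u < v) r / t⌉ ≤ ⌈pre v r / t⌉ :=
        Int.ceil_le_ceil (div_le_div_of_nonneg_right mono ht.le)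
      have h3 : ⌈ms (fun u => u < v) r / t⌉ ≤ ⌈pre v r / t⌉ - 1 := by omega
      have h4 : (⌈ms (fun u => u < v) r / t⌉ : ℝ) ≤ (⌈pre v r / t⌉ : ℝ) - 1 := by exact_mod_cast h3
      nlinarith
  have htot' : tot r' = N * (t - ε) := by
    rw [tot, hmr' _ low_true, hN]
    rw [mul_div_assoc, div_self ht.ne', mul_one, Int.ceil_intCast]; ring
  rcases hεt.eq_or_lt with heq | hlt
  · have hr'z : r' = 0 := eq_zero_of_tot_eq_zero hr'0 (by rw [htot', heq]; ring)
    refine ⟨Finsupp.single u₁ t, ?_, ms_single _ _ _ trivial, ?_, ?_, ?_⟩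
    · exact Finsupp.single_nonneg.2 ht.le
    · rw [ev_single, ← heq]
      exact (sub_eq_zero.1 hr'z).symm
    · intro u hu u' hu'
      have h1 := Finsupp.support_single_subset hu
      have h2 := Finsupp.support_single_subset hu'
      rw [Finset.mem_singleton] at h1 h2
      rw [h1, h2]; exact Or.inl (Rel.refl _)
    · intro u hu
      have h1 := Finsupp.support_single_subset hu
      rw [Finset.mem_singleton] at h1
      rw [h1]
      exact ⟨hu0, huZ, hus, hone⟩
  · have ht' : 0 < t - ε := by linarith
    have hcard : (r'.support.filter (fun v => pre v r' / (t - ε) ∉ ZZ)).card < n := by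
      rw [← hn]
      apply Finset.card_lt_card
      rw [Finset.ssubset_iff_of_subset]
      · rcases hεor with h | ⟨v, hv, hve⟩
        · linarith
        · refine ⟨v, ?_, ?_⟩
          · rw [Finset.mem_filter]
            refine ⟨hv, fun hZ => ?_⟩
            obtain ⟨k, hk⟩ := hZ
            simp only [eq_intCast] at hk
            rw [← hk, Int.ceil_intCast] at hve
            have : pre v r = k * t := by rw [hk]; field_simp
            rw [this] at hve
            linarith
          · rw [Finset.mem_filter]
            rintro ⟨-, h⟩
            apply h
            rw [hmr' _ (low_le v)]
            refine ⟨⌈pre v r / t⌉ - 1, ?_⟩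
            simp only [eq_intCast, Int.cast_sub, Int.cast_one]
            rw [eq_div_iff ht'.ne']
            linarith
      · intro v hv
        rw [Finset.mem_filter] at hv ⊢
        refine ⟨hs' hv.1, fun hZ => hv.2 ?_⟩
        obtain ⟨k, hk⟩ := hZ
        simp only [eq_intCast] at hk
        rw [hmr' _ (low_le v), ← hk, Int.ceil_intCast]
        have : pre v r = k * t := by rw [hk]; field_simp
        refine ⟨k, ?_⟩
        simp only [eq_intCast]
        rw [eq_div_iff ht'.ne', this]; ring
    obtain ⟨w, hw0, hwt, hwe, hwc, hwp⟩ := ih _ hcard r' (t - ε) N hr'0 ht' htot' rfl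
    have hbetween : ∀ p, Low p → ((⌈ms p r / t⌉ : ℝ) - 1) * (t - ε) ≤ ms p r' ∧
        ms p r' ≤ (⌈ms p r / t⌉ : ℝ) * (t - ε) := by
      intro p hp
      have h1 := hεp p hp
      have h2 := hup p
      rw [hmr' p hp]
      constructor <;> linarith
    have hrel : ∀ u ∈ w.support, Rel u₁ u := by
      intro u hu x
      obtain ⟨-, hZ, -, hb⟩ := hwp u hu
      obtain ⟨b1, b2⟩ := hbetween _ (low_le x)
      have c1 := (hb _ (low_le x) (⌈pre x r / t⌉ - 1)).1 (by push_cast; exact b1)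
      have c2 := (hb _ (low_le x) (⌈pre x r / t⌉)).2 b2
      push_cast at c1
      rw [hms _ (low_le x)]
      apply ZZ_eq_zero_or_one
      · exact sub_mem (intCast_mem_ZZ _) (ms_ZZ (fun v _ => hZ v))
      · linarith
      · linarith
    have hsupp : (w + Finsupp.single u₁ ε).support ⊆ insert u₁ w.support := by
      refine Finsupp.support_add.trans ?_
      intro v hv
      rcases Finset.mem_union.1 hv with h | h
      · exact Finset.mem_insert_of_mem h
      · rw [Finset.mem_singleton.1 (Finsupp.support_single_subset h)]
        exact Finset.mem_insert_self _ _
    refine ⟨w + Finsupp.single u₁ ε, ?_, ?_, ?_, ?_, ?_⟩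
    · exact add_nonneg hw0 (Finsupp.single_nonneg.2 hε0.le)
    · rw [map_add, hwt, ms_single _ _ _ trivial]; ring
    · rw [map_add, hwe, ev_single, hr']; abel
    · intro u hu u' hu'
      have h1 := Finset.mem_insert.1 (hsupp hu)
      have h2 := Finset.mem_insert.1 (hsupp hu')
      rcases h1 with rfl | h1 <;> rcases h2 with rfl | h2
      · exact Or.inl (Rel.refl _)
      · exact Or.inl (hrel _ h2)
      · exact Or.inr (hrel _ h1)
      · exact hwc u h1 u' h2
    · intro u hu
      rcases Finset.mem_insert.1 (hsupp hu) with rfl | h1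
      · exact ⟨hu0, huZ, hus, hone⟩
      · obtain ⟨h2, hZ, h3, hb⟩ := hwp u h1
        refine ⟨h2, hZ, h3.trans hs', fun p hp n => ?_⟩
        obtain ⟨b1, b2⟩ := hbetween p hp
        obtain ⟨d1, d2⟩ := hone p hp n
        rw [hms p hp] at d1 d2
        constructor
        · intro h
          apply (hb p hp n).1
          have e1 := d1 h
          rcases e1.eq_or_lt with e | e
          · rw [hmr' p hp, ← e]; linarith
          · have e' : (n : ℤ) < ⌈ms p r / t⌉ := by exact_mod_cast e
            have e2 : (n : ℤ) ≤ ⌈ms p r / t⌉ - 1 := by omega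
            have e3 : (n : ℝ) ≤ (⌈ms p r / t⌉ : ℝ) - 1 := by exact_mod_cast e2
            exact (mul_le_mul_of_nonneg_right e3 ht'.le).trans b1
        · intro h
          apply (hb p hp n).2
          exact b2.trans (mul_le_mul_of_nonneg_right (d2 h) ht'.le)

theorem chain_exists (r : ι →₀ ℝ) (t : ℝ) (N : ℤ) (hr : 0 ≤ r) (ht : 0 ≤ t)
    (hN : tot r = N * t) :
    ∃ w : (ι →₀ ℝ) →₀ ℝ, 0 ≤ w ∧ tot w = t ∧ ev w = r ∧ Chain (w.support : Set (ι →₀ ℝ)) ∧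
    ∀ u ∈ w.support, 0 ≤ u ∧ (∀ v, u v ∈ ZZ) ∧ u.support ⊆ r.support ∧
      ∀ p, Low p → ∀ n : ℤ, (n * t ≤ ms p r → n ≤ ms p u) ∧ (ms p r ≤ n * t → ms p u ≤ n) := by
  rcases ht.eq_or_lt with rfl | ht
  · rw [mul_zero] at hN
    refine ⟨0, le_rfl, by simp, ?_, ?_, by simp⟩
    · rw [map_zero, eq_zero_of_tot_eq_zero hr hN]
    · intro u hu; simp at hu
  · exact chain_exists_aux _ r t N hr ht hN rfl

end Ordered

section Triangulations
variable {W : Type*} [AddCommGroup W] [Module ℝ W]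

/-- `K` is (the set of vertex sets of) a simplicial fan with chosen ray generators and
support `C`. -/
structure Tri (C : Set W) (K : Set (Finset W)) : Prop where
  down : ∀ S ∈ K, ∀ S' ⊆ S, S' ∈ K
  cover : ∀ y ∈ C, ∃ w : W →₀ ℝ, 0 ≤ w ∧ w.support ∈ K ∧ ev w = y
  mem : ∀ w : W →₀ ℝ, 0 ≤ w → w.support ∈ K → ev w ∈ C
  uniq : ∀ w w' : W →₀ ℝ, 0 ≤ w → 0 ≤ w' → w.support ∈ K → w'.support ∈ K → ev w = ev w' → w = w'

/-- Convex cones, as a predicate on sets. -/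
structure IsCone (C : Set W) : Prop where
  zero : (0 : W) ∈ C
  add : ∀ x ∈ C, ∀ y ∈ C, x + y ∈ C
  smul : ∀ x ∈ C, ∀ t : ℝ, 0 ≤ t → t • x ∈ C

/-- The span of `S` contains `U`. -/
def Full (U : Submodule ℝ W) (S : Finset W) : Prop := U ≤ Submodule.span ℝ (S : Set W)

theorem exists_pos_neg {ι : Type*} (β : ι →₀ ℝ) : ∃ p n : ι →₀ ℝ, 0 ≤ p ∧ 0 ≤ n ∧ β = p - n ∧
    p.support ⊆ β.support ∧ n.support ⊆ β.support := by
  refine ⟨β.mapRange (fun x => max x 0) (by simp), β.mapRange (fun x => max (-x) 0) (by simp),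
    fun v => by simp, fun v => by simp, ?_, Finsupp.support_mapRange, Finsupp.support_mapRange⟩
  ext v
  simp only [Finsupp.coe_sub, Pi.sub_apply, Finsupp.mapRange_apply]
  rcases le_total 0 (β v) with h | h
  · rw [max_eq_left h, max_eq_right (by linarith)]; ring
  · rw [max_eq_right h, max_eq_left (by linarith)]; ring

theorem mem_span_iff_ev {S : Finset W} {y : W} :
    y ∈ Submodule.span ℝ (S : Set W) ↔ ∃ β : W →₀ ℝ, β.support ⊆ S ∧ ev β = y := by
  have h := Finsupp.mem_span_image_iff_linearCombination ℝ (v := (id : W → W)) (s := (S : Set W))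
    (x := y)
  rw [Set.image_id] at h
  rw [h]
  constructor
  · rintro ⟨l, hl, rfl⟩
    exact ⟨l, by exact_mod_cast (Finsupp.mem_supported _ _).1 hl, rfl⟩
  · rintro ⟨l, hl, rfl⟩
    exact ⟨l, (Finsupp.mem_supported _ _).2 (by exact_mod_cast hl), rfl⟩

theorem support_sub_subset {ι : Type*} {a b : ι →₀ ℝ} {S : Finset ι} (ha : a.support ⊆ S)
    (hb : b.support ⊆ S) : (a - b).support ⊆ S := by
  classical
  exact Finsupp.support_sub.trans (Finset.union_subset ha hb)

theorem support_add_subset {ι : Type*} {a b : ι →₀ ℝ} {S : Finset ι} (ha : a.support ⊆ S)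
    (hb : b.support ⊆ S) : (a + b).support ⊆ S := by
  classical
  exact Finsupp.support_add.trans (Finset.union_subset ha hb)

theorem support_smul_subset {ι : Type*} {a : ι →₀ ℝ} {S : Finset ι} (c : ℝ)
    (ha : a.support ⊆ S) : (c • a).support ⊆ S :=
  Finsupp.support_smul.trans ha

variable {C : Set W} {K : Set (Finset W)}

theorem Tri.indep (h : Tri C K) {S : Finset W} (hS : S ∈ K) {β : W →₀ ℝ} (hβ : β.support ⊆ S)
    (h0 : ev β = 0) : β = 0 := by
  obtain ⟨p, n, hp, hn, rfl, hps, hns⟩ := exists_pos_neg β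
  have := h.uniq p n hp hn (h.down S hS _ (hps.trans hβ)) (h.down S hS _ (hns.trans hβ))
    (by rw [map_sub, sub_eq_zero] at h0; exact h0)
  rw [this, sub_self]

theorem Tri.inj (h : Tri C K) {S : Finset W} (hS : S ∈ K) {β β' : W →₀ ℝ} (hβ : β.support ⊆ S)
    (hβ' : β'.support ⊆ S) (he : ev β = ev β') : β = β' :=
  sub_eq_zero.1 (h.indep hS (support_sub_subset hβ hβ') (by rw [map_sub, he, sub_self]))

open Filter Topology in
theorem Tri.limit (h : Tri C K) (hK : K.Finite) (a p : W)
    (hf : ∃ᶠ t in 𝓝[>] (0 : ℝ), a + t • p ∈ C) :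
    ∃ S ∈ K, (∃ β : W →₀ ℝ, 0 ≤ β ∧ β.support ⊆ S ∧ ev β = a) ∧
      ∃ δ : W →₀ ℝ, δ.support ⊆ S ∧ ev δ = p := by
  have h1 : ∃ S ∈ K, ∃ᶠ t in 𝓝[>] (0 : ℝ), ∃ w : W →₀ ℝ, 0 ≤ w ∧ w.support ⊆ S ∧
      ev w = a + t • p := by
    by_contra hcon
    push Not at hcon
    have h2 := (Filter.eventually_all_finite hK).2
      (fun S hS => hcon S hS)
    obtain ⟨t, ht, ht'⟩ := (hf.and_eventually h2).exists
    obtain ⟨w, hw, hwK, hwe⟩ := h.cover _ ht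
    exact ht' _ hwK w hw subset_rfl hwe
  obtain ⟨S, hS, hfS⟩ := h1
  refine ⟨S, hS, ?_⟩
  have hpos : ∀ᶠ t in 𝓝[>] (0 : ℝ), 0 < t := eventually_mem_nhdsWithin
  obtain ⟨t1, ⟨w1, hw1, hs1, he1⟩, ht1⟩ := (hfS.and_eventually hpos).exists
  obtain ⟨t2, ⟨w2, hw2, hs2, he2⟩, ht2⟩ :=
    (hfS.and_eventually (Ioo_mem_nhdsGT ht1)).exists
  have hne : t1 - t2 ≠ 0 := by have := ht2.2; linarith
  obtain ⟨δ, hδ⟩ : ∃ δ : W →₀ ℝ, δ = (t1 - t2)⁻¹ • (w1 - w2) := ⟨_, rfl⟩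
  have hδs : δ.support ⊆ S := by
    rw [hδ]; exact support_smul_subset _ (support_sub_subset hs1 hs2)
  have hδe : ev δ = p := by
    rw [hδ, map_smul, map_sub, he1, he2, add_sub_add_left_eq_sub, ← sub_smul, smul_smul,
      inv_mul_cancel₀ hne, one_smul]
  refine ⟨⟨w1 - t1 • δ, ?_, support_sub_subset hs1 (support_smul_subset _ hδs), ?_⟩,
    δ, hδs, hδe⟩
  · intro v
    by_contra hneg
    simp only [Finsupp.coe_zero, Pi.zero_apply, Finsupp.coe_sub, Finsupp.coe_smul, Pi.sub_apply,
      Pi.smul_apply, smul_eq_mul, not_le] at hneg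
    have hev : ∀ᶠ t in 𝓝[>] (0 : ℝ), (w1 v - t1 * δ v) + t * δ v < 0 := by
      apply Filter.Eventually.filter_mono nhdsWithin_le_nhds
      have hc : Continuous (fun t : ℝ => (w1 v - t1 * δ v) + t * δ v) := by fun_prop
      apply hc.continuousAt.eventually_lt continuousAt_const
      simpa using hneg
    obtain ⟨t, ⟨w, hw, hs, he⟩, ht⟩ := (hfS.and_eventually hev).exists
    have : w = w1 - t1 • δ + t • δ := by
      apply h.inj hS hs (support_add_subset (support_sub_subset hs1 (support_smul_subset _ hδs))
        (support_smul_subset _ hδs))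
      rw [map_add, map_sub, map_smul, map_smul, hδe, he, he1]; abel
    have h3 := hw v
    rw [this] at h3
    simp at h3
    linarith
  · rw [map_sub, map_smul, hδe, he1]; abel

theorem Tri.mem_of_subset (h : Tri C K) {S : Finset W} (hS : S ∈ K) {β : W →₀ ℝ} (h0 : 0 ≤ β)
    (hβ : β.support ⊆ S) : ev β ∈ C := h.mem β h0 (h.down S hS _ hβ)

theorem IsCone.exists_avoid (hC : IsCone C) {F : Set (Submodule ℝ W)} (hF : F.Finite)
    (h : ∀ V ∈ F, ¬ C ⊆ V) : ∃ p ∈ C, ∀ V ∈ F, p ∉ V := by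
  induction F, hF using Set.Finite.induction_on with
  | empty => exact ⟨0, hC.zero, by simp⟩
  | @insert V F hV hF ih =>
    obtain ⟨p, hp, hpF⟩ := ih (fun V' hV' => h V' (Set.mem_insert_of_mem _ hV'))
    by_cases hpV : p ∈ V
    · obtain ⟨r, hr, hrV⟩ := Set.not_subset.1 (h V (Set.mem_insert _ _))
      have hfin : (⋃ V' ∈ F, {ε : ℝ | p + ε • r ∈ V'}).Finite := by
        apply hF.biUnion
        intro V' hV'
        apply Set.Subsingleton.finite
        intro e he e' he'
        by_contra hne
        have h1 : (e - e') • r ∈ V' := by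
          have := V'.sub_mem he he'
          rwa [add_sub_add_left_eq_sub, ← sub_smul] at this
        have h2 : r ∈ V' := (V'.smul_mem_iff (sub_ne_zero.2 hne)).1 h1
        exact hpF V' hV' ((V'.add_mem_iff_left (V'.smul_mem e h2)).1 he)
      obtain ⟨ε, hε, hε'⟩ := (Set.Ioi_infinite (0 : ℝ)).exists_notMem_finite hfin
      refine ⟨p + ε • r, hC.add _ hp _ (hC.smul _ hr _ (le_of_lt hε)), ?_⟩
      intro V' hV'
      rcases Set.mem_insert_iff.1 hV' with rfl | hV'
      · intro hcon
        exact hrV ((V'.smul_mem_iff (ne_of_gt hε)).1 ((V'.add_mem_iff_right hpV).1 hcon))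
      · intro hcon
        exact hε' (Set.mem_biUnion hV' hcon)
    · refine ⟨p, hp, fun V' hV' => ?_⟩
      rcases Set.mem_insert_iff.1 hV' with rfl | hV'
      · exact hpV
      · exact hpF V' hV'

theorem Tri.pure (h : Tri C K) (hK : K.Finite) (hC : IsCone C) {U : Submodule ℝ W}
    (hU : U ≤ Submodule.span ℝ C) {a : W} (ha : a ∈ C) :
    ∃ S ∈ K, Full U S ∧ ∃ β : W →₀ ℝ, 0 ≤ β ∧ β.support ⊆ S ∧ ev β = a := by
  have hF : ((fun S : Finset W => Submodule.span ℝ (S : Set W)) '' {S ∈ K | ¬ Full U S}).Finite :=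
    (hK.subset (Set.sep_subset _ _)).image _
  obtain ⟨p, hp, hpF⟩ := hC.exists_avoid hF (by
    rintro _ ⟨S, hS, rfl⟩ hcon
    exact hS.2 (hU.trans (Submodule.span_le.2 hcon)))
  obtain ⟨S, hS, hβ, δ, hδ, hδe⟩ := h.limit hK a p (by
    apply Filter.Eventually.frequently
    filter_upwards [self_mem_nhdsWithin] with t ht
    exact hC.add _ ha _ (hC.smul _ hp _ (le_of_lt ht)))
  refine ⟨S, hS, ?_, hβ⟩
  by_contra hnf
  exact hpF _ ⟨S, ⟨hS, hnf⟩, rfl⟩ (mem_span_iff_ev.2 ⟨δ, hδ, hδe⟩)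

/-- The faces of `C` visible from `-v` at infinity. -/
def Vis (C : Set W) (v : W) (S : Finset W) : Prop :=
  ∀ w : W →₀ ℝ, 0 ≤ w → w.support ⊆ S → ∀ ε : ℝ, 0 < ε → ev w - ε • v ∉ C

theorem Tri.vis_of (h : Tri C K) (hC : IsCone C) (v : W) {w : W →₀ ℝ} (hw : 0 ≤ w)
    (hS : w.support ∈ K) (hv : ∀ ε : ℝ, 0 < ε → ev w - ε • v ∉ C) : Vis C v w.support := by
  intro w' hw' hs ε hε hcon
  obtain ⟨c, hc, hcw⟩ : ∃ c : ℝ, 0 < c ∧ c • w' ≤ w := by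
    by_cases hne : w'.support.Nonempty
    · obtain ⟨u, hu, hmin⟩ := Finset.exists_min_image w'.support (fun u => w u / w' u) hne
      have pos : ∀ u ∈ w'.support, 0 < w' u := fun u hu =>
        lt_of_le_of_ne (hw' u) (Ne.symm (Finsupp.mem_support_iff.1 hu))
      have pos' : 0 < w u := lt_of_le_of_ne (hw u) (Ne.symm (Finsupp.mem_support_iff.1 (hs hu)))
      refine ⟨w u / w' u, div_pos pos' (pos u hu), fun x => ?_⟩
      by_cases hx : x ∈ w'.support
      · have := hmin x hx
        rw [le_div_iff₀ (pos x hx)] at this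
        simpa using this
      · rw [Finsupp.notMem_support_iff] at hx
        simpa [hx] using hw x
    · rw [Finset.not_nonempty_iff_eq_empty, Finsupp.support_eq_empty] at hne
      exact ⟨1, one_pos, by rw [hne, smul_zero]; exact hw⟩
  have hd : 0 ≤ w - c • w' := sub_nonneg.2 hcw
  have h1 : ev (w - c • w') ∈ C :=
    h.mem_of_subset hS hd (support_sub_subset subset_rfl (support_smul_subset _ hs))
  apply hv (c * ε) (mul_pos hc hε)
  have := hC.add _ h1 _ (hC.smul _ hcon c hc.le)
  rw [map_sub, map_smul] at this
  have e : ev w - c • ev w' + c • (ev w' - ε • v) = ev w - (c * ε) • v := by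
    rw [smul_sub, smul_smul]; abel
  rwa [e] at this

/-- Adding one more ray to a triangulated cone. -/
def addK (C : Set W) (K : Set (Finset W)) (v : W) : Set (Finset W) :=
  {S | ∃ S0 ∈ K, Vis C v S0 ∧ (S : Set W) ⊆ insert v (S0 : Set W)}

/-- The cone generated by `C` and `v`. -/
def addC (C : Set W) (v : W) : Set W := {y | ∃ t : ℝ, 0 ≤ t ∧ y - t • v ∈ C}

theorem addC_cone (hC : IsCone C) (v : W) : IsCone (addC C v) where
  zero := ⟨0, le_rfl, by simpa using hC.zero⟩
  add := by
    rintro x ⟨t, ht, hx⟩ y ⟨t', ht', hy⟩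
    refine ⟨t + t', add_nonneg ht ht', ?_⟩
    have := hC.add _ hx _ hy
    have e : x - t • v + (y - t' • v) = x + y - (t + t') • v := by rw [add_smul]; abel
    rwa [e] at this
  smul := by
    rintro x ⟨t, ht, hx⟩ c hc
    refine ⟨c * t, mul_nonneg hc ht, ?_⟩
    have := hC.smul _ hx c hc
    rwa [smul_sub, smul_smul] at this

theorem addK_finite (hK : K.Finite) (v : W) : (addK C K v).Finite := by
  classical
  apply (hK.biUnion (fun S0 _ => (insert v S0).powerset.finite_toSet)).subset
  rintro S ⟨S0, hS0, -, hS⟩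
  refine Set.mem_biUnion hS0 ?_
  simp only [Finset.coe_powerset, Set.mem_preimage, Set.mem_powerset_iff, Finset.coe_insert]
  exact hS

open Filter Topology in
theorem Tri.add_vertex (h : Tri C K) (hK : K.Finite) (hC : IsCone C) (α : W →ₗ[ℝ] ℝ)
    (hα : ∀ y ∈ C, 0 ≤ α y) {v : W} (hv : 0 < α v) : Tri (addC C v) (addK C K v) := by
  classical
  have herase : ∀ w : W →₀ ℝ, ev w = ev (w.erase v) + w v • v := by
    intro w
    conv_lhs => rw [← Finsupp.erase_add_single v w]
    rw [map_add, ev_single]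
  have hes : ∀ (w : W →₀ ℝ) (S0 : Finset W), (w.support : Set W) ⊆ insert v (S0 : Set W) →
      (w.erase v).support ⊆ S0 := by
    intro w S0 hS u hu
    rw [Finsupp.support_erase, Finset.mem_erase] at hu
    exact (hS hu.2).resolve_left hu.1
  have he0 : ∀ w : W →₀ ℝ, 0 ≤ w → 0 ≤ w.erase v := by
    intro w hw u
    by_cases hu : u = v
    · subst hu; simp
    · simpa [Finsupp.erase_ne hu] using hw u
  refine ⟨?_, ?_, ?_, ?_⟩
  · rintro S ⟨S0, hS0, hvis, hS⟩ S' hS'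
    exact ⟨S0, hS0, hvis, fun x hx => hS (hS' hx)⟩
  · rintro y ⟨t0, ht0, hy⟩
    set T : Set ℝ := {t | 0 ≤ t ∧ y - t • v ∈ C} with hT
    have hTne : T.Nonempty := ⟨t0, ht0, hy⟩
    have hTb : BddAbove T := by
      refine ⟨α y / α v, fun t ht => ?_⟩
      have := hα _ ht.2
      rw [map_sub, map_smul, smul_eq_mul] at this
      rw [le_div_iff₀ hv]; linarith
    have hsup : sSup T ∈ T := by
      by_contra hcon
      have h0 : 0 ≤ sSup T := ht0.trans (le_csSup hTb ⟨ht0, hy⟩)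
      have hf : ∃ᶠ t in 𝓝[>] (0 : ℝ), (y - sSup T • v) + t • v ∈ C := by
        rw [Filter.frequently_iff]
        intro U hU
        obtain ⟨ε, hε, hεU⟩ := (mem_nhdsGT_iff_exists_Ioo_subset).1 hU
        obtain ⟨t, ht, hlt⟩ := exists_lt_of_lt_csSup hTne (show sSup T - ε < sSup T by
          have : (0 : ℝ) < ε := hε
          linarith)
        have hne : t ≠ sSup T := fun e => hcon (e ▸ ht)
        have hlt' : t < sSup T := lt_of_le_of_ne (le_csSup hTb ht) hne
        refine ⟨sSup T - t, hεU ⟨by linarith, by linarith⟩, ?_⟩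
        have : y - sSup T • v + (sSup T - t) • v = y - t • v := by rw [sub_smul]; abel
        rw [this]; exact ht.2
      obtain ⟨S, hS, ⟨β, hβ0, hβs, hβe⟩, -⟩ := h.limit hK _ _ hf
      exact hcon ⟨h0, hβe ▸ h.mem_of_subset hS hβ0 hβs⟩
    obtain ⟨w, hw, hwK, hwe⟩ := h.cover _ hsup.2
    have hvis : Vis C v w.support := by
      apply h.vis_of hC v hw hwK
      intro ε hε hcon
      have : sSup T + ε ∈ T := by
        refine ⟨by linarith [hsup.1], ?_⟩
        rw [hwe] at hcon
        rwa [add_smul, ← sub_sub]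
      linarith [le_csSup hTb this]
    refine ⟨w + Finsupp.single v (sSup T), add_nonneg hw (Finsupp.single_nonneg.2 hsup.1),
      ⟨w.support, hwK, hvis, ?_⟩, ?_⟩
    · intro u hu
      rw [Finset.mem_coe, Finsupp.mem_support_iff] at hu
      by_cases huv : u = v
      · exact Or.inl huv
      · right
        rw [Finset.mem_coe, Finsupp.mem_support_iff]
        simpa [Finsupp.single_apply, Ne.symm huv] using hu
    · rw [map_add, hwe, ev_single]; abel
  · rintro w hw ⟨S0, hS0, -, hS⟩
    refine ⟨w v, hw v, ?_⟩
    have := h.mem_of_subset hS0 (he0 w hw) (hes w S0 hS)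
    rwa [herase w, add_sub_cancel_right]
  · have key : ∀ w w' : W →₀ ℝ, 0 ≤ w → 0 ≤ w' → w.support ∈ addK C K v →
        w'.support ∈ addK C K v → ev w = ev w' → ¬ w v < w' v := by
      rintro w w' hw hw' ⟨S0, hS0, hvis, hS⟩ ⟨S0', hS0', -, hS'⟩ he hlt
      apply hvis (w.erase v) (he0 w hw) (hes w S0 hS) (w' v - w v) (by linarith)
      have h1 := h.mem_of_subset hS0' (he0 w' hw') (hes w' S0' hS')
      rw [herase w, herase w'] at he
      have : ev (w.erase v) - (w' v - w v) • v = ev (w'.erase v) := by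
        rw [sub_smul, ← sub_eq_zero]
        rw [← sub_eq_zero] at he
        rw [← he]; abel
      rwa [this]
    intro w w' hw hw' hS hS' he
    have hvv : w v = w' v := le_antisymm (not_lt.1 (key w' w hw' hw hS' hS he.symm))
      (not_lt.1 (key w w' hw hw' hS hS' he))
    obtain ⟨S0, hS0, hvis, hS⟩ := hS
    obtain ⟨S0', hS0', -, hS'⟩ := hS'
    have h1 : w.erase v = w'.erase v := by
      apply h.uniq _ _ (he0 w hw) (he0 w' hw') (h.down _ hS0 _ (hes w S0 hS))
        (h.down _ hS0' _ (hes w' S0' hS'))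
      rw [herase w, herase w', hvv] at he
      exact add_right_cancel he
    rw [← Finsupp.erase_add_single v w, ← Finsupp.erase_add_single v w', h1, hvv]

theorem Tri.add_vertices (h : Tri C K) (hK : K.Finite) (hC : IsCone C) (α : W →ₗ[ℝ] ℝ)
    (hα : ∀ y ∈ C, 0 ≤ α y) (V : Finset W) (hV : ∀ v ∈ V, 0 < α v) :
    ∃ K' : Set (Finset W), K'.Finite ∧
      Tri {y | ∃ g : W →₀ ℝ, 0 ≤ g ∧ g.support ⊆ V ∧ y - ev g ∈ C} K' ∧
      (∀ S ∈ K', ∀ u ∈ S, u ∈ V ∨ ∃ S1 ∈ K, u ∈ S1) ∧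
      ∀ S ∈ K', (∀ u ∈ S, u ∉ V) → S ∈ K := by
  classical
  induction V using Finset.induction_on generalizing C K with
  | empty =>
    refine ⟨K, hK, ?_, fun S hS u hu => Or.inr ⟨S, hS, hu⟩, fun S hS _ => hS⟩
    convert h using 1
    ext y
    constructor
    · rintro ⟨g, -, hg, hy⟩
      rw [Finset.subset_empty, Finsupp.support_eq_empty] at hg
      simpa [hg] using hy
    · exact fun hy => ⟨0, le_rfl, by simp, by simpa using hy⟩
  | insert v V hvV ih =>
    have hvα := hV v (Finset.mem_insert_self _ _)
    obtain ⟨K', hK', hT, h1, h2⟩ := ih (h.add_vertex hK hC α hα hvα) (addK_finite hK v)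
      (addC_cone hC v) (by
        rintro y ⟨t, ht, hy⟩
        have := hα _ hy
        rw [map_sub, map_smul, smul_eq_mul] at this
        nlinarith) (fun u hu => hV u (Finset.mem_insert_of_mem hu))
    refine ⟨K', hK', ?_, ?_, ?_⟩
    · convert hT using 1
      ext y
      constructor
      · rintro ⟨g, hg, hgs, hy⟩
        refine ⟨g.erase v, ?_, ?_, g v, hg v, ?_⟩
        · intro u
          by_cases hu : u = v
          · subst hu; simp
          · simpa [Finsupp.erase_ne hu] using hg u
        · intro u hu
          rw [Finsupp.support_erase, Finset.mem_erase] at hu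
          exact (Finset.mem_insert.1 (hgs hu.2)).resolve_left hu.1
        · have : ev g = ev (g.erase v) + g v • v := by
            conv_lhs => rw [← Finsupp.erase_add_single v g]
            rw [map_add, ev_single]
          rwa [this, ← sub_sub] at hy
      · rintro ⟨g, hg, hgs, t, ht, hy⟩
        refine ⟨g + Finsupp.single v t, add_nonneg hg (Finsupp.single_nonneg.2 ht), ?_, ?_⟩
        · apply support_add_subset (hgs.trans (Finset.subset_insert _ _))
          exact Finsupp.support_single_subset.trans (by simp)
        · rwa [map_add, ev_single, ← sub_sub]
    · intro S hS u hu
      rcases h1 S hS u hu with h3 | ⟨S1, ⟨S0, hS0, -, hS1⟩, hu1⟩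
      · exact Or.inl (Finset.mem_insert_of_mem h3)
      · rcases hS1 hu1 with rfl | h4
        · exact Or.inl (Finset.mem_insert_self _ _)
        · exact Or.inr ⟨S0, hS0, h4⟩
    · intro S hS hu
      obtain ⟨S0, hS0, -, hS1⟩ := h2 S hS (fun u h' h'' => hu u h' (Finset.mem_insert_of_mem h''))
      refine h.down _ hS0 _ (fun u hus => ?_)
      rcases hS1 hus with rfl | h4
      · exact absurd (Finset.mem_insert_self _ _) (hu _ hus)
      · exact h4

end Triangulations

section MapDomain

theorem mapDomain_nonneg {ι κ : Type*} (f : ι → κ) {w : ι →₀ ℝ} (hw : 0 ≤ w) :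
    0 ≤ w.mapDomain f := by
  rw [Finsupp.mapDomain, Finsupp.sum]
  exact Finset.sum_nonneg (fun v _ => Finsupp.single_nonneg.2 (hw v))

theorem exists_of_mem_support_mapDomain {ι κ : Type*} (f : ι → κ) (w : ι →₀ ℝ) {x : κ}
    (hx : x ∈ (w.mapDomain f).support) : ∃ v ∈ w.support, f v = x := by
  classical
  exact Finset.mem_image.1 (Finsupp.mapDomain_support hx)

theorem ev_mapDomain_add {ι : Type*} (γ : ι →₀ ℝ) (w : (ι →₀ ℝ) →₀ ℝ) :
    ev (w.mapDomain (fun n => γ + n)) = tot w • γ + ev w := by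
  induction w using Finsupp.induction_linear with
  | zero => simp
  | add a b ha hb => rw [Finsupp.mapDomain_add, map_add, map_add, map_add, ha, hb, add_smul]; abel
  | single v c =>
    rw [Finsupp.mapDomain_single, ms_single _ _ _ trivial, ev_single, ev_single, smul_add]

theorem ev_nonneg {ι : Type*} {w : (ι →₀ ℝ) →₀ ℝ} (hw : 0 ≤ w) (h : ∀ u ∈ w.support, 0 ≤ u) :
    0 ≤ ev w := by
  rw [ev, Finsupp.linearCombination_apply, Finsupp.sum]
  exact Finset.sum_nonneg (fun u hu => smul_nonneg (hw u) (h u hu))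

theorem ev_apply {ι : Type*} (w : (ι →₀ ℝ) →₀ ℝ) (v : ι) {T : Finset (ι →₀ ℝ)}
    (h : w.support ⊆ T) : ev w v = ∑ u ∈ T, w u * u v :=
  map_ev (Finsupp.lapply v) w h

theorem ev_apply_ne {ι : Type*} {w : (ι →₀ ℝ) →₀ ℝ} {v : ι} (h : ev w v ≠ 0) :
    ∃ u ∈ w.support, u v ≠ 0 := by
  by_contra hcon
  push Not at hcon
  apply h
  rw [ev_apply w v subset_rfl]
  exact Finset.sum_eq_zero (fun u hu => by rw [hcon u hu, mul_zero])

theorem ev_apply_ne_of {ι : Type*} {w : (ι →₀ ℝ) →₀ ℝ} (hw : 0 ≤ w)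
    (h : ∀ u ∈ w.support, 0 ≤ u) {u : ι →₀ ℝ} (hu : u ∈ w.support) {v : ι} (hv : u v ≠ 0) :
    0 < ev w v := by
  rw [ev_apply w v subset_rfl]
  apply Finset.sum_pos'
  · exact fun u hu => mul_nonneg (hw u) (h u hu v)
  · exact ⟨u, hu, mul_pos (lt_of_le_of_ne (hw u) (Ne.symm (Finsupp.mem_support_iff.1 hu)))
      (lt_of_le_of_ne (h u hu v) (Ne.symm hv))⟩

end MapDomain

section Cells
variable {ι : Type*}

open Classical in
theorem tot_filter (b : ι → Prop) (a : ι →₀ ℝ) : tot (a.filter b) = ms b a := by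
  rw [tot_eq_sum (a.filter b) (Finsupp.support_filter b a).le, ms_eq_sum b a subset_rfl]
  exact Finset.sum_congr rfl (fun v hv => Finsupp.filter_apply_pos _ _ (Finset.mem_filter.1 hv).2)

open Classical in
theorem filter_nonneg (b : ι → Prop) {a : ι →₀ ℝ} (ha : 0 ≤ a) : 0 ≤ a.filter b := by
  intro v
  by_cases h : b v
  · simpa [h] using ha v
  · simp [h]

variable [LinearOrder ι]

theorem exists_split_on (b : ι → Prop) {a : ι →₀ ℝ} (ha : 0 ≤ a) {m : ℝ} (h0 : 0 ≤ m)
    (hm : m ≤ ms b a) :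
    ∃ p r : ι →₀ ℝ, (∀ v, b v → p v + r v = a v) ∧ (∀ v, p v ≠ 0 → b v) ∧ (∀ v, r v ≠ 0 → b v) ∧
      0 ≤ p ∧ 0 ≤ r ∧ tot p = m ∧ tot r = ms b a - m ∧ ∀ v v', p v ≠ 0 → r v' ≠ 0 → v ≤ v' := by
  classical
  obtain ⟨p, r, hpr, hp, hr, ht, ho⟩ := exists_split (filter_nonneg b ha) h0
    (by rwa [tot_filter])
  have hz : ∀ v, ¬ b v → p v = 0 ∧ r v = 0 := by
    intro v hv
    have h1 : p v + r v = 0 := by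
      rw [← Finsupp.add_apply, hpr, Finsupp.filter_apply_neg _ _ hv]
    have h2 := hp v
    have h3 := hr v
    simp only [Finsupp.coe_zero, Pi.zero_apply] at h2 h3
    constructor <;> linarith
  refine ⟨p, r, fun v hv => ?_, fun v h => ?_, fun v h => ?_, hp, hr, ht, ?_, ho⟩
  · rw [← Finsupp.add_apply, hpr, Finsupp.filter_apply_pos _ _ hv]
  · by_contra hb; exact h (hz v hb).1
  · by_contra hb; exact h (hz v hb).2
  · rw [← tot_filter b a, ← hpr, map_add, ht]; ring

theorem split_unique_on (b : ι → Prop) {p r p' r' : ι →₀ ℝ} (hp : 0 ≤ p) (hr : 0 ≤ r)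
    (hp' : 0 ≤ p') (hr' : 0 ≤ r')
    (h : ∀ v v', b v → b v' → p v ≠ 0 → r v' ≠ 0 → v ≤ v')
    (h' : ∀ v v', b v → b v' → p' v ≠ 0 → r' v' ≠ 0 → v ≤ v')
    (he : ∀ v, b v → p v + r v = p' v + r' v) (ht : ms b p = ms b p') :
    ∀ v, b v → p v = p' v ∧ r v = r' v := by
  classical
  have aux : ∀ (x : ι →₀ ℝ) (v : ι), x.filter b v ≠ 0 → b v ∧ x v ≠ 0 := by
    intro x v hx
    by_cases hb : b v
    · rw [Finsupp.filter_apply_pos _ _ hb] at hx; exact ⟨hb, hx⟩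
    · rw [Finsupp.filter_apply_neg _ _ hb] at hx; exact absurd rfl hx
  obtain ⟨h1, h2⟩ := split_unique (filter_nonneg b hp) (filter_nonneg b hr) (filter_nonneg b hp')
    (filter_nonneg b hr')
    (fun v v' hv hv' => h v v' (aux _ _ hv).1 (aux _ _ hv').1 (aux _ _ hv).2 (aux _ _ hv').2)
    (fun v v' hv hv' => h' v v' (aux _ _ hv).1 (aux _ _ hv').1 (aux _ _ hv).2 (aux _ _ hv').2)
    (by
      ext v
      by_cases hb : b v
      · simpa [hb] using he v hb
      · simp [hb]) (by rw [tot_filter, tot_filter, ht])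
  intro v hv
  have e1 := DFunLike.congr_fun h1 v
  have e2 := DFunLike.congr_fun h2 v
  rw [Finsupp.filter_apply_pos _ _ hv, Finsupp.filter_apply_pos _ _ hv] at e1 e2
  exact ⟨e1, e2⟩

theorem split_ZZ_on (b : ι → Prop) {P R : Set ι}
    (h : ∀ v ∈ P, ∀ v' ∈ R, b v → b v' → v ≤ v') {p r : ι →₀ ℝ}
    (hp : ∀ v, p v ≠ 0 → v ∈ P) (hr : ∀ v, r v ≠ 0 → v ∈ R) (ht : ms b p ∈ ZZ)
    (hi : ∀ v, b v → p v + r v ∈ ZZ) : ∀ v, b v → p v ∈ ZZ ∧ r v ∈ ZZ := by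
  classical
  have aux : ∀ (x : ι →₀ ℝ) (v : ι), x.filter b v ≠ 0 → b v ∧ x v ≠ 0 := by
    intro x v hx
    by_cases hb : b v
    · rw [Finsupp.filter_apply_pos _ _ hb] at hx; exact ⟨hb, hx⟩
    · rw [Finsupp.filter_apply_neg _ _ hb] at hx; exact absurd rfl hx
  obtain ⟨h1, h2⟩ := split_ZZ (P := {v | v ∈ P ∧ b v}) (R := {v | v ∈ R ∧ b v})
    (p := p.filter b) (r := r.filter b)
    (fun v hv v' hv' => h v hv.1 v' hv'.1 hv.2 hv'.2)
    (fun v hv => ⟨hp v (aux _ _ hv).2, (aux _ _ hv).1⟩)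
    (fun v hv => ⟨hr v (aux _ _ hv).2, (aux _ _ hv).1⟩)
    (by rwa [tot_filter]) (by
      intro v
      by_cases hb : b v
      · simpa only [Finsupp.filter_apply_pos _ _ hb] using hi v hb
      · simp only [Finsupp.filter_apply_neg _ _ hb, add_zero]; exact zero_mem _)
  intro v hv
  have e1 := h1 v
  have e2 := h2 v
  rw [Finsupp.filter_apply_pos _ _ hv] at e1 e2
  exact ⟨e1, e2⟩

/-- Conditions on the letters `E` and the vectors `I`, `A` which do not involve a cell. -/
structure Common (b₁ : ι → Prop) (s q : ℕ) (E : Set ι) (I A : Set (ι →₀ ℝ)) : Prop where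
  eb : ∀ v ∈ E, b₁ v
  nnI : ∀ u ∈ I, 0 ≤ u ∧ ms b₁ u = s ∧ tot u = s + q
  nnA : ∀ u ∈ A, 0 ≤ u ∧ ms b₁ u = s ∧ tot u = s + q
  intA : ∀ u ∈ A, ∀ v, u v ∈ ZZ
  chI : Chain I
  chA : Chain A
  ea : ∀ v ∈ E, ∀ u ∈ A, ∀ v', b₁ v' → u v' ≠ 0 → v ≤ v'

theorem Common.mono {b₁ : ι → Prop} {s q : ℕ} {E E' : Set ι} {I I' A A' : Set (ι →₀ ℝ)}
    (h : Common b₁ s q E I A) (hE : E' ⊆ E) (hI : I' ⊆ I) (hA : A' ⊆ A) :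
    Common b₁ s q E' I' A' where
  eb v hv := h.eb v (hE hv)
  nnI u hu := h.nnI u (hI hu)
  nnA u hu := h.nnA u (hA hu)
  intA u hu := h.intA u (hA hu)
  chI := h.chI.mono hI
  chA := h.chA.mono hA
  ea v hv u hu := h.ea v (hE hv) u (hA hu)

/-- Conditions on the letters `E` and the vectors `I`, `A` in a cell with special vector `γ`. -/
structure Cell (b₁ : ι → Prop) (γ : ι →₀ ℝ) (v₀ : ι) (J : ℕ) (E : Set ι) (I A : Set (ι →₀ ℝ)) :
    Prop where
  intI : ∀ u ∈ I, ∀ v, u v - γ v ∈ ZZ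
  ei : ∀ v ∈ E, ∀ u ∈ I, ∀ v', b₁ v' → u v' ≠ γ v' → v ≤ v'
  ia : ∀ u ∈ I, ∀ u' ∈ A, ∀ v v', (b₁ v ↔ b₁ v') → (v₀ ≤ v ↔ v₀ ≤ v') → u v ≠ γ v → u' v' ≠ 0 →
    v ≤ v'
  tight : ∃ j : ℕ, j ≤ J ∧ (∀ u ∈ I, ms (fun v => v₀ ≤ v) u = j + γ v₀) ∧
    (∀ u ∈ A, (j : ℝ) ≤ ms (fun v => v₀ ≤ v) u) ∧
    (j < J → ∀ u ∈ A, ms (fun v => v₀ ≤ v) u ≤ j + 1) ∧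
    ((∃ v, γ v ≠ 0 ∧ v ∉ E ∧ (∀ u ∈ A, u v = 0) ∧ ∀ u ∈ I, u v = γ v) ∨
      (∀ u ∈ A, ms (fun v => v₀ ≤ v) u = j) ∨
      (j < J ∧ ∀ u ∈ A, ms (fun v => v₀ ≤ v) u = j + 1))

theorem Cell.mono {b₁ : ι → Prop} {γ : ι →₀ ℝ} {v₀ : ι} {J : ℕ} {E E' : Set ι}
    {I I' A A' : Set (ι →₀ ℝ)} (h : Cell b₁ γ v₀ J E I A) (hE : E' ⊆ E) (hI : I' ⊆ I)
    (hA : A' ⊆ A) : Cell b₁ γ v₀ J E' I' A' where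
  intI u hu := h.intI u (hI hu)
  ei v hv u hu := h.ei v (hE hv) u (hI hu)
  ia u hu u' hu' := h.ia u (hI hu) u' (hA hu')
  tight := by
    obtain ⟨j, hj, h1, h2, h3, h4⟩ := h.tight
    refine ⟨j, hj, fun u hu => h1 u (hI hu), fun u hu => h2 u (hA hu),
      fun hjJ u hu => h3 hjJ u (hA hu), ?_⟩
    rcases h4 with ⟨v, hv, hvE, hvA, hvI⟩ | h4 | ⟨h4, h5⟩
    · exact Or.inl ⟨v, hv, fun hv' => hvE (hE hv'), fun u hu => hvA u (hA hu),
        fun u hu => hvI u (hI hu)⟩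
    · exact Or.inr (Or.inl fun u hu => h4 u (hA hu))
    · exact Or.inr (Or.inr ⟨h4, fun u hu => h5 u (hA hu)⟩)

/-- Numerical data of a cell. -/
structure CellData (b₁ : ι → Prop) (γ : ι →₀ ℝ) (v₀ : ι) (s q k₁ k₂ J : ℕ) : Prop where
  low : Low b₁
  v₀b : ¬ b₁ v₀
  nonneg : 0 ≤ γ
  lt_one : ∀ v, γ v < 1
  pos : 0 < γ v₀
  le_v₀ : ∀ v, γ v ≠ 0 → v ≤ v₀
  ms₁ : ms b₁ γ = k₁
  ms₂ : tot γ = k₁ + k₂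
  k₁s : k₁ ≤ s
  k₂J : k₂ + J = q
  k₂pos : 1 ≤ k₂

variable {b₁ : ι → Prop} {γ : ι →₀ ℝ} {v₀ : ι} {s q k₁ k₂ J : ℕ}

theorem CellData.not_b (h : CellData b₁ γ v₀ s q k₁ k₂ J) {v : ι} (hv : v₀ ≤ v) : ¬ b₁ v :=
  fun hb => h.v₀b (h.low _ _ hv hb)

theorem tot_eq_lt_add_ge (v₀ : ι) (x : ι →₀ ℝ) :
    tot x = ms (fun v => v < v₀) x + ms (fun v => v₀ ≤ v) x :=
  ms_split (fun v _ => by simp [lt_or_ge]) (fun v _ h => not_le.2 h)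

theorem CellData.tot_eq (h : CellData b₁ γ v₀ s q k₁ k₂ J) (x : ι →₀ ℝ) :
    tot x = ms b₁ x + ms (fun v => ¬ b₁ v ∧ v < v₀) x + ms (fun v => v₀ ≤ v) x := by
  rw [tot_eq_lt_add_ge v₀ x]
  congr 1
  apply ms_split
  · intro v _
    constructor
    · intro hv
      by_cases hb : b₁ v
      · exact Or.inl hb
      · exact Or.inr ⟨hb, hv⟩
    · rintro (hb | hb)
      · by_contra hcon
        exact h.not_b (not_lt.1 hcon) hb
      · exact hb.2
  · exact fun v _ hb hb' => hb'.1 hb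

theorem CellData.ms_ge (h : CellData b₁ γ v₀ s q k₁ k₂ J) : ms (fun v => v₀ ≤ v) γ = γ v₀ := by
  have h1 := tot_eq_lt_add_ge v₀ γ
  have h2 := pre_eq_lt_add v₀ γ
  have h3 : pre v₀ γ = tot γ :=
    ms_eq_tot (fun v hv => h.le_v₀ v (Finsupp.mem_support_iff.1 hv))
  linarith

theorem exists_lambda (hγ : 0 ≤ γ) (hγ1 : γ v₀ < 1) (hpos : 0 < γ v₀) {a : ι →₀ ℝ} (ha : 0 ≤ a)
    {f t : ℝ} (hf : 0 ≤ f) (ht : 0 < t) (J : ℕ) :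
    ∃ (l : ℝ) (j : ℕ), 0 ≤ l ∧ j ≤ J ∧ l • γ ≤ a ∧ j * t + l * γ v₀ ≤ f ∧
      (j < J → f + l * (1 - γ v₀) ≤ (j + 1) * t) ∧
      ((∃ v, γ v ≠ 0 ∧ a v = l * γ v) ∨ f = j * t + l * γ v₀ ∨
        (j < J ∧ f + l * (1 - γ v₀) = (j + 1) * t)) := by
  obtain ⟨j, hj, hjf, hjJ⟩ : ∃ j : ℕ, j ≤ J ∧ j * t ≤ f ∧ (j < J → f < (j + 1) * t) := by
    by_cases h : J * t ≤ f
    · exact ⟨J, le_rfl, h, fun h => absurd h (lt_irrefl _)⟩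
    · push Not at h
      refine ⟨⌊f / t⌋₊, ?_, ?_, fun _ => ?_⟩
      · have h1 := Nat.floor_le (div_nonneg hf ht.le)
        have h2 : f / t < J := by rwa [div_lt_iff₀ ht]
        have h3 : ((⌊f / t⌋₊ : ℕ) : ℝ) < J := lt_of_le_of_lt h1 h2
        exact_mod_cast h3.le
      · have h1 := Nat.floor_le (div_nonneg hf ht.le)
        rwa [le_div_iff₀ ht] at h1
      · have := Nat.lt_floor_add_one (f / t)
        rwa [div_lt_iff₀ ht] at this
  have pos : ∀ u ∈ γ.support, 0 < γ u := fun u hu =>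
    lt_of_le_of_ne (hγ u) (Ne.symm (Finsupp.mem_support_iff.1 hu))
  obtain ⟨v, hv, hmin⟩ := Finset.exists_min_image γ.support (fun u => a u / γ u)
    ⟨v₀, Finsupp.mem_support_iff.2 hpos.ne'⟩
  have hle : ∀ l, 0 ≤ l → l ≤ a v / γ v → l • γ ≤ a := by
    intro l hl0 hl u
    by_cases hu : u ∈ γ.support
    · have := hl.trans (hmin u hu)
      rw [le_div_iff₀ (pos u hu)] at this
      simpa using this
    · rw [Finsupp.notMem_support_iff] at hu
      simpa [hu] using ha u
  have d1 : 0 < 1 - γ v₀ := by linarith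
  have l1pos : 0 ≤ a v / γ v := div_nonneg (ha v) (pos v hv).le
  have hv' := (pos v hv)
  obtain ⟨m, hm0, hm1, hm2, hm3⟩ : ∃ m : ℝ, 0 ≤ m ∧ m ≤ a v / γ v ∧ j * t + m * γ v₀ ≤ f ∧
      (a v = m * γ v ∨ f = j * t + m * γ v₀) := by
    rcases le_total (a v / γ v) ((f - j * t) / γ v₀) with h | h
    · refine ⟨_, l1pos, le_rfl, ?_, Or.inl ?_⟩
      · rw [le_div_iff₀ hpos] at h; linarith
      · field_simp
    · refine ⟨_, div_nonneg (by linarith) hpos.le, h, ?_, Or.inr ?_⟩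
      · rw [div_mul_cancel₀ _ hpos.ne']; linarith
      · rw [div_mul_cancel₀ _ hpos.ne']; ring
  by_cases hc : j < J ∧ (j + 1) * t < f + m * (1 - γ v₀)
  · obtain ⟨hc1, hc2⟩ := hc
    have h0 : 0 ≤ ((j + 1) * t - f) / (1 - γ v₀) := div_nonneg (by linarith [hjJ hc1]) d1.le
    have hlm : ((j + 1) * t - f) / (1 - γ v₀) ≤ m := by
      rw [div_le_iff₀ d1]; linarith
    refine ⟨((j + 1) * t - f) / (1 - γ v₀), j, h0, hj, hle _ h0 (hlm.trans hm1), ?_, fun _ => ?_,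
      Or.inr (Or.inr ⟨hc1, ?_⟩)⟩
    · have := mul_le_mul_of_nonneg_right hlm hpos.le
      linarith
    · rw [div_mul_cancel₀ _ d1.ne']; linarith
    · rw [div_mul_cancel₀ _ d1.ne']; ring
  · push Not at hc
    refine ⟨m, j, hm0, hj, hle m hm0 hm1, hm2, hc, ?_⟩
    rcases hm3 with h | h
    · exact Or.inl ⟨v, hv'.ne', h⟩
    · exact Or.inr (Or.inl h)

theorem plain_exists (hb : Low b₁) {a : ι →₀ ℝ} (ha : 0 ≤ a) {t₁ t₂ : ℝ} (ht₁ : 0 ≤ t₁)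
    (ht₂ : 0 ≤ t₂) (h1 : ms b₁ a = t₁ + s * t₂) (htot : tot a = t₁ + (s + q) * t₂) :
    ∃ (e : ι →₀ ℝ) (bA : (ι →₀ ℝ) →₀ ℝ), 0 ≤ e ∧ 0 ≤ bA ∧ e + ev bA = a ∧
      Common b₁ s q (e.support : Set ι) ∅ (bA.support : Set (ι →₀ ℝ)) := by
  have hst : 0 ≤ s * t₂ := mul_nonneg (Nat.cast_nonneg _) ht₂
  obtain ⟨e, x, hex, heb, -, he, hx, het, -, ho⟩ := exists_split_on b₁ ha ht₁
    (show t₁ ≤ ms b₁ a by rw [h1]; linarith)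
  have heb' : ms b₁ e = t₁ := by
    rw [← het]; exact ms_eq_tot (fun v hv => heb v (Finsupp.mem_support_iff.1 hv))
  have hα0 : 0 ≤ a - e := by
    intro v
    by_cases hv : b₁ v
    · have h2 := hx v
      have h3 := hex v hv
      simp only [Finsupp.coe_zero, Pi.zero_apply, Finsupp.coe_sub, Pi.sub_apply] at *
      linarith
    · have : e v = 0 := by by_contra h; exact hv (heb v h)
      simpa [this] using ha v
  have htα : tot (a - e) = ((s + q : ℕ) : ℤ) * t₂ := by
    rw [map_sub, htot, het]; push_cast; ring
  obtain ⟨w, hw0, hwt, hwe, hwc, hwp⟩ := chain_exists (a - e) t₂ _ hα0 ht₂ htα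
  refine ⟨e, w, he, hw0, by rw [hwe]; abel, ?_, by simp, ?_, ?_, by intro u hu; simp at hu, hwc, ?_⟩
  · exact fun v hv => heb v (Finsupp.mem_support_iff.1 hv)
  · intro u hu
    obtain ⟨u0, -, -, hb'⟩ := hwp u hu
    have hm : ms b₁ (a - e) = s * t₂ := by rw [map_sub, h1, heb']; ring
    have e1 := hb' b₁ hb s
    have e2 := hb' _ low_true ((s + q : ℕ) : ℤ)
    rw [hm] at e1
    rw [htα] at e2
    push_cast at e1 e2
    exact ⟨u0, le_antisymm (e1.2 le_rfl) (e1.1 le_rfl), le_antisymm (e2.2 le_rfl) (e2.1 le_rfl)⟩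
  · exact fun u hu => (hwp u hu).2.1
  · intro v hv u hu v' hv' huv'
    apply ho v v' (Finsupp.mem_support_iff.1 hv)
    have h3 := (hwp u hu).2.2.1 (Finsupp.mem_support_iff.2 huv')
    rw [Finsupp.mem_support_iff] at h3
    intro hx0
    apply h3
    have := hex v' hv'
    rw [hx0, add_zero] at this
    simp [this]

theorem cell_exists (h : CellData b₁ γ v₀ s q k₁ k₂ J) {a : ι →₀ ℝ} (ha : 0 ≤ a) {t₁ t₂ : ℝ}
    (ht₁ : 0 ≤ t₁) (ht₂ : 0 < t₂) (h1 : ms b₁ a = t₁ + s * t₂)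
    (htot : tot a = t₁ + (s + q) * t₂) :
    ∃ (e : ι →₀ ℝ) (bI bA : (ι →₀ ℝ) →₀ ℝ), 0 ≤ e ∧ 0 ≤ bI ∧ 0 ≤ bA ∧ e + ev bI + ev bA = a ∧
      Common b₁ s q (e.support : Set ι) (bI.support : Set (ι →₀ ℝ)) (bA.support : Set (ι →₀ ℝ)) ∧
      Cell b₁ γ v₀ J (e.support : Set ι) (bI.support : Set (ι →₀ ℝ))
        (bA.support : Set (ι →₀ ℝ)) := by
  set f := ms (fun v => v₀ ≤ v) a with hf
  obtain ⟨l, j, hl0, hj, hlγ, hjf, hjJ, htight⟩ := exists_lambda h.nonneg (h.lt_one v₀) h.pos ha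
    (f := f) (ms_nonneg _ ha) ht₂ J
  obtain ⟨ρ, hρ⟩ : ∃ ρ, ρ = a - l • γ := ⟨_, rfl⟩
  have hρ0 : 0 ≤ ρ := by rw [hρ]; exact sub_nonneg.2 hlγ
  have hγt := h.tot_eq γ
  have hat := h.tot_eq a
  have hρt := h.tot_eq ρ
  have hρ1 : ms b₁ ρ = t₁ + s * t₂ - l * k₁ := by
    rw [hρ, map_sub, map_smul, h1, h.ms₁, smul_eq_mul]
  have hρ3 : ms (fun v => v₀ ≤ v) ρ = f - l * γ v₀ := by
    rw [hρ, map_sub, map_smul, h.ms_ge, smul_eq_mul]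
  have hρT : tot ρ = t₁ + (s + q) * t₂ - l * (k₁ + k₂) := by
    rw [hρ, map_sub, map_smul, htot, h.ms₂, smul_eq_mul]
  have hρn : 0 ≤ ms (fun v => ¬ b₁ v ∧ v < v₀) ρ := ms_nonneg _ hρ0
  have hq : (q : ℝ) = k₂ + J := by rw [← h.k₂J]; push_cast; ring
  have hk2 : (1 : ℝ) ≤ k₂ := by exact_mod_cast h.k₂pos
  have hk1 : (k₁ : ℝ) ≤ s := by exact_mod_cast h.k₁s
  have hjJ' : (j : ℝ) ≤ J := by exact_mod_cast hj
  have hγ0 := h.pos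
  have hγ1 := h.lt_one v₀
  rw [hρT, hρ1, hρ3] at hρt
  have hlt : l ≤ t₂ := by
    rcases hj.eq_or_lt with heq | hlt
    · have : (j : ℝ) = J := by exact_mod_cast heq
      rw [this] at hjf
      have h2 : k₂ * l ≤ k₂ * t₂ := by rw [hq] at hρt; linarith
      exact le_of_mul_le_mul_left h2 (by linarith)
    · have := hjJ hlt
      linarith
  have hA0 : 0 ≤ t₂ - l := by linarith
  -- mass of the top block of `A`
  have hA3 : f - l * γ v₀ - j * l ≤ q * (t₂ - l) := by
    rcases hj.eq_or_lt with heq | hlt'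
    · have : (j : ℝ) = J := by exact_mod_cast heq
      rw [this]; rw [hq] at hρt ⊢; linarith
    · have h2 := hjJ hlt'
      have h3 : (j : ℝ) + 1 ≤ J := by exact_mod_cast hlt'
      have h4 : (j + 1) * (t₂ - l) ≤ q * (t₂ - l) :=
        mul_le_mul_of_nonneg_right (by rw [hq]; linarith) hA0
      linarith
  have p1 : 0 ≤ (s - k₁) * l := mul_nonneg (by linarith) hl0
  have p2 : 0 ≤ (J - j) * l := mul_nonneg (by linarith) hl0
  have p3 : 0 ≤ j * l := mul_nonneg (Nat.cast_nonneg _) hl0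
  have p4 : 0 ≤ s * (t₂ - l) := mul_nonneg (Nat.cast_nonneg _) hA0
  have p5 : 0 ≤ j * (t₂ - l) := mul_nonneg (Nat.cast_nonneg _) hA0
  obtain ⟨e, x, hex, heb, hxb, he0, hx0, het, hxt, hoe⟩ := exists_split_on b₁ hρ0 ht₁
    (show t₁ ≤ ms b₁ ρ by rw [hρ1]; linarith)
  obtain ⟨i1, a1, hia1, hi1, ha1, hti1, ho1⟩ := exists_split hx0 p1
    (by rw [hxt, hρ1]; linarith)
  obtain ⟨i2, a2, hia2, hi2b, ha2b, hi2, ha2, hti2, hta2, ho2⟩ :=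
    exists_split_on (fun v => ¬ b₁ v ∧ v < v₀) hρ0 p2 (by rw [hq] at hρt hA3; linarith)
  obtain ⟨i3, a3, hia3, hi3b, ha3b, hi3, ha3, hti3, hta3, ho3⟩ :=
    exists_split_on (fun v => v₀ ≤ v) hρ0 p3 (by rw [hρ3]; linarith)
  have hx1 : ∀ v, i1 v + a1 v = x v := fun v => by rw [← hia1]; rfl
  have hi1x : ∀ v, i1 v ≠ 0 → x v ≠ 0 := fun v hv hx => by
    have e1 := hi1 v; have e2 := ha1 v; have e3 := hx1 v
    simp only [Finsupp.coe_zero, Pi.zero_apply] at e1 e2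
    exact hv (by linarith)
  have ha1x : ∀ v, a1 v ≠ 0 → x v ≠ 0 := fun v hv hx => by
    have e1 := hi1 v; have e2 := ha1 v; have e3 := hx1 v
    simp only [Finsupp.coe_zero, Pi.zero_apply] at e1 e2
    exact hv (by linarith)
  have hi1b : ∀ v, i1 v ≠ 0 → b₁ v := fun v hv => hxb v (hi1x v hv)
  have ha1b : ∀ v, a1 v ≠ 0 → b₁ v := fun v hv => hxb v (ha1x v hv)
  have blk : ∀ v, (b₁ v ∧ ¬ v₀ ≤ v) ∨ ((¬ b₁ v ∧ v < v₀) ∧ ¬ b₁ v ∧ ¬ v₀ ≤ v) ∨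
      (v₀ ≤ v ∧ ¬ b₁ v) := by
    intro v
    by_cases hb : b₁ v
    · exact Or.inl ⟨hb, fun hv => h.not_b hv hb⟩
    · rcases lt_or_ge v v₀ with hv | hv
      · exact Or.inr (Or.inl ⟨⟨hb, hv⟩, hb, not_le.2 hv⟩)
      · exact Or.inr (Or.inr ⟨hv, hb⟩)
  have z1 : ∀ (y : ι →₀ ℝ), (∀ v, y v ≠ 0 → b₁ v) → ∀ v, ¬ b₁ v → y v = 0 := fun y hy v hv => by
    by_contra hne; exact hv (hy v hne)
  have z2 : ∀ (y : ι →₀ ℝ), (∀ v, y v ≠ 0 → ¬ b₁ v ∧ v < v₀) → ∀ v, (b₁ v ∨ v₀ ≤ v) → y v = 0 :=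
    fun y hy v hv => by
      by_contra hne
      have := hy v hne
      rcases hv with hv | hv
      · exact this.1 hv
      · exact absurd this.2 (not_lt.2 hv)
  have z3 : ∀ (y : ι →₀ ℝ), (∀ v, y v ≠ 0 → v₀ ≤ v) → ∀ v, ¬ v₀ ≤ v → y v = 0 := fun y hy v hv => by
    by_contra hne; exact hv (hy v hne)
  obtain ⟨i, hi⟩ : ∃ i, i = i1 + i2 + i3 := ⟨_, rfl⟩
  obtain ⟨α, hα⟩ : ∃ α, α = a1 + a2 + a3 := ⟨_, rfl⟩
  have iv : ∀ v, i v = i1 v + i2 v + i3 v := fun v => by rw [hi]; rfl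
  have av : ∀ v, α v = a1 v + a2 v + a3 v := fun v => by rw [hα]; rfl
  have hi0 : 0 ≤ i := by rw [hi]; exact add_nonneg (add_nonneg hi1 hi2) hi3
  have hα0 : 0 ≤ α := by rw [hα]; exact add_nonneg (add_nonneg ha1 ha2) ha3
  have hsum : ∀ v, e v + i v + α v = ρ v := by
    intro v
    rw [iv, av]
    rcases blk v with hv | ⟨hv, hv'⟩ | hv
    · have := hex v hv.1; have := hx1 v
      rw [z2 i2 hi2b v (Or.inl hv.1), z2 a2 ha2b v (Or.inl hv.1), z3 i3 hi3b v hv.2,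
        z3 a3 ha3b v hv.2]
      linarith
    · have := hia2 v hv
      rw [z1 i1 hi1b v hv'.1, z1 a1 ha1b v hv'.1, z1 e heb v hv'.1, z3 i3 hi3b v hv'.2,
        z3 a3 ha3b v hv'.2]
      linarith
    · have := hia3 v hv.1
      rw [z1 i1 hi1b v hv.2, z1 a1 ha1b v hv.2, z1 e heb v hv.2, z2 i2 hi2b v (Or.inr hv.1),
        z2 a2 ha2b v (Or.inr hv.1)]
      linarith
  have mass : ∀ (y1 y2 y3 : ι →₀ ℝ), (∀ v, y1 v ≠ 0 → b₁ v) → (∀ v, y2 v ≠ 0 → ¬ b₁ v ∧ v < v₀) →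
      (∀ v, y3 v ≠ 0 → v₀ ≤ v) → ms b₁ (y1 + y2 + y3) = tot y1 ∧
      ms (fun v => v < v₀) (y1 + y2 + y3) = tot y1 + tot y2 := by
    intro y1 y2 y3 hy1 hy2 hy3
    simp only [map_add]
    constructor
    · rw [ms_eq_tot (a := y1) (fun v hv => hy1 v (Finsupp.mem_support_iff.1 hv)),
        ms_zero_of (a := y2) (fun v hv => (hy2 v (Finsupp.mem_support_iff.1 hv)).1),
        ms_zero_of (a := y3) (fun v hv => h.not_b (hy3 v (Finsupp.mem_support_iff.1 hv)))]
      ring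
    · rw [ms_eq_tot (a := y1) (fun v hv => by
          by_contra hcon
          exact h.not_b (not_lt.1 hcon) (hy1 v (Finsupp.mem_support_iff.1 hv))),
        ms_eq_tot (a := y2) (fun v hv => (hy2 v (Finsupp.mem_support_iff.1 hv)).2),
        ms_zero_of (a := y3) (fun v hv => not_lt.2 (hy3 v (Finsupp.mem_support_iff.1 hv)))]
      ring
  obtain ⟨mi1, mi2⟩ := mass i1 i2 i3 hi1b hi2b hi3b
  obtain ⟨ma1, ma2⟩ := mass a1 a2 a3 ha1b ha2b ha3b
  rw [← hi] at mi1 mi2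
  rw [← hα] at ma1 ma2
  have hta1 : tot a1 = s * (t₂ - l) := by
    have : tot x = tot i1 + tot a1 := by rw [← hia1, map_add]
    rw [hxt, hρ1, hti1] at this; linarith
  have hti : tot i = (((s - k₁ + J : ℕ)) : ℤ) * l := by
    rw [hi, map_add, map_add, hti1, hti2, hti3]
    rw [Int.cast_natCast, Nat.cast_add, Nat.cast_sub h.k₁s]; ring
  have htα : tot α = ((s + q : ℕ) : ℤ) * (t₂ - l) := by
    rw [hα, map_add, map_add, hta1, hta2, hta3, hρ3]
    push_cast
    rw [hq] at hρt ⊢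
    linarith
  obtain ⟨wI, hI0, hIt, hIe, hIc, hIp⟩ := chain_exists i l _ hi0 hl0 hti
  obtain ⟨wA, hA0', hAt, hAe, hAc, hAp⟩ := chain_exists α (t₂ - l) _ hα0 hA0 htα
  have Ibd : ∀ n ∈ wI.support, ms b₁ n = s - k₁ ∧ tot n = s - k₁ + J ∧
      ms (fun v => v₀ ≤ v) n = j := by
    intro n hn
    have hb' := (hIp n hn).2.2.2
    have e1 := hb' b₁ h.low ((s - k₁ : ℕ) : ℤ)
    have e2 := hb' _ low_true ((s - k₁ + J : ℕ) : ℤ)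
    have e3 := hb' _ (low_lt v₀) ((s - k₁ + (J - j) : ℕ) : ℤ)
    have c1 : (((s - k₁ : ℕ) : ℤ) : ℝ) = s - k₁ := by rw [Int.cast_natCast, Nat.cast_sub h.k₁s]
    have c2 : (((s - k₁ + J : ℕ) : ℤ) : ℝ) = s - k₁ + J := by
      rw [Int.cast_natCast, Nat.cast_add, Nat.cast_sub h.k₁s]
    have c3 : (((s - k₁ + (J - j) : ℕ) : ℤ) : ℝ) = s - k₁ + (J - j) := by
      rw [Int.cast_natCast, Nat.cast_add, Nat.cast_sub h.k₁s, Nat.cast_sub hj]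
    rw [mi1, hti1, c1] at e1
    rw [hti, c2] at e2
    rw [mi2, hti1, hti2, c3] at e3
    have g1 := le_antisymm (e1.2 le_rfl) (e1.1 le_rfl)
    have g2 := le_antisymm (e2.2 le_rfl) (e2.1 le_rfl)
    have g3 := le_antisymm (e3.2 (by linarith)) (e3.1 (by linarith))
    have g4 := tot_eq_lt_add_ge v₀ n
    refine ⟨g1, g2, ?_⟩
    rw [g3] at g4
    have : tot n = s - k₁ + J := g2
    linarith
  have Abd : ∀ u ∈ wA.support, ms b₁ u = s ∧ tot u = s + q := by
    intro u hu
    have hb' := (hAp u hu).2.2.2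
    have e1 := hb' b₁ h.low s
    have e2 := hb' _ low_true ((s + q : ℕ) : ℤ)
    rw [ma1, hta1] at e1
    rw [htα] at e2
    push_cast at e1 e2
    exact ⟨le_antisymm (e1.2 le_rfl) (e1.1 le_rfl), le_antisymm (e2.2 le_rfl) (e2.1 le_rfl)⟩
  have ma3 : ms (fun v => v < v₀) α = (s + q) * (t₂ - l) - (f - l * γ v₀ - j * l) := by
    have : tot α = tot a1 + tot a2 + tot a3 := by rw [hα, map_add, map_add]
    rw [ma2]
    rw [hta3, hρ3] at this
    rw [htα] at this
    push_cast at this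
    linarith
  have Aupper : ∀ n : ℕ, n ≤ s + q → f - l * γ v₀ - j * l ≤ n * (t₂ - l) → ∀ u ∈ wA.support,
      ms (fun v => v₀ ≤ v) u ≤ n := by
    intro n hn hle u hu
    have e3 := ((hAp u hu).2.2.2 _ (low_lt v₀) ((s + q : ℤ) - n)).1 (by
      rw [ma3]; push_cast; linarith)
    have g4 := tot_eq_lt_add_ge v₀ u
    rw [(Abd u hu).2] at g4
    push_cast at e3
    linarith
  have Alower : ∀ n : ℕ, n * (t₂ - l) ≤ f - l * γ v₀ - j * l → ∀ u ∈ wA.support,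
      (n : ℝ) ≤ ms (fun v => v₀ ≤ v) u := by
    intro n hle u hu
    have e3 := ((hAp u hu).2.2.2 _ (low_lt v₀) ((s + q : ℤ) - n)).2 (by
      rw [ma3]; push_cast; linarith)
    have g4 := tot_eq_lt_add_ge v₀ u
    rw [(Abd u hu).2] at g4
    push_cast at e3
    linarith
  have hjq : j + 1 ≤ s + q := by have := h.k₂J; have := h.k₂pos; omega
  have Imem : ∀ u ∈ (wI.mapDomain (fun n => γ + n)).support, ∃ n ∈ wI.support, γ + n = u :=
    fun u hu => exists_of_mem_support_mapDomain _ _ hu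
  refine ⟨e, wI.mapDomain (fun n => γ + n), wA, he0, mapDomain_nonneg _ hI0, hA0', ?_, ?_, ?_⟩
  · rw [ev_mapDomain_add, hIt, hIe, hAe]
    ext v
    have := hsum v
    rw [hρ] at this
    simp only [Finsupp.coe_sub, Finsupp.coe_smul, Pi.sub_apply, Pi.smul_apply, Finsupp.coe_add,
      Pi.add_apply] at this ⊢
    linarith
  · refine ⟨fun v hv => heb v (Finsupp.mem_support_iff.1 hv), ?_, ?_, ?_, ?_, hAc, ?_⟩
    · intro u hu
      obtain ⟨n, hn, rfl⟩ := Imem u hu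
      obtain ⟨g1, g2, g3⟩ := Ibd n hn
      refine ⟨add_nonneg h.nonneg (hIp n hn).1, ?_, ?_⟩
      · rw [map_add, h.ms₁, g1]; ring
      · rw [map_add, h.ms₂, g2, hq]; ring
    · exact fun u hu => ⟨(hAp u hu).1, Abd u hu⟩
    · exact fun u hu => (hAp u hu).2.1
    · intro u hu u' hu'
      obtain ⟨n, hn, rfl⟩ := Imem u hu
      obtain ⟨n', hn', rfl⟩ := Imem u' hu'
      rcases hIc n hn n' hn' with hr | hr
      · left; intro x; simpa using hr x
      · right; intro x; simpa using hr x
    · intro v hv u hu v' hv' huv'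
      apply hoe v v' (Finsupp.mem_support_iff.1 hv)
      have h3 := Finsupp.mem_support_iff.1 ((hAp u hu).2.2.1 (Finsupp.mem_support_iff.2 huv'))
      rw [av, z2 a2 ha2b v' (Or.inl hv'), z3 a3 ha3b v' (fun hv => h.not_b hv hv'), add_zero,
        add_zero] at h3
      exact ha1x v' h3
  · refine ⟨?_, ?_, ?_, j, hj, ?_, ?_, ?_, ?_⟩
    · intro u hu v
      obtain ⟨n, hn, rfl⟩ := Imem u hu
      simpa using (hIp n hn).2.1 v
    · intro v hv u hu v' hv' huv'
      obtain ⟨n, hn, rfl⟩ := Imem u hu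
      apply hoe v v' (Finsupp.mem_support_iff.1 hv)
      have h3 := Finsupp.mem_support_iff.1 ((hIp n hn).2.2.1
        ((Finsupp.mem_support_iff (a := v')).2 (by simpa using huv')))
      rw [iv, z2 i2 hi2b v' (Or.inl hv'), z3 i3 hi3b v' (fun hv => h.not_b hv hv'), add_zero,
        add_zero] at h3
      exact hi1x v' h3
    · intro u hu u' hu' v v' hbb hvv huv huv'
      obtain ⟨n, hn, rfl⟩ := Imem u hu
      have h3 := Finsupp.mem_support_iff.1 ((hIp n hn).2.2.1
        ((Finsupp.mem_support_iff (a := v)).2 (by simpa using huv)))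
      have h4 := Finsupp.mem_support_iff.1 ((hAp u' hu').2.2.1 (Finsupp.mem_support_iff.2 huv'))
      rw [iv] at h3
      rw [av] at h4
      rcases blk v with hv | ⟨hv, hv'⟩ | hv
      · rw [z2 i2 hi2b v (Or.inl hv.1), z3 i3 hi3b v hv.2, add_zero, add_zero] at h3
        rw [z2 a2 ha2b v' (Or.inl (hbb.1 hv.1)), z3 a3 ha3b v' (fun h => hv.2 (hvv.2 h)), add_zero,
          add_zero] at h4
        exact ho1 v v' h3 h4
      · rw [z1 i1 hi1b v hv'.1, z3 i3 hi3b v hv'.2, zero_add, add_zero] at h3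
        rw [z1 a1 ha1b v' (fun h => hv'.1 (hbb.2 h)), z3 a3 ha3b v' (fun h => hv'.2 (hvv.2 h)),
          zero_add, add_zero] at h4
        exact ho2 v v' h3 h4
      · rw [z1 i1 hi1b v hv.2, z2 i2 hi2b v (Or.inr hv.1), zero_add, zero_add] at h3
        rw [z1 a1 ha1b v' (fun h => hv.2 (hbb.2 h)), z2 a2 ha2b v' (Or.inr (hvv.1 hv.1)),
          zero_add, zero_add] at h4
        exact ho3 v v' h3 h4
    · intro u hu
      obtain ⟨n, hn, rfl⟩ := Imem u hu
      rw [map_add, h.ms_ge, (Ibd n hn).2.2]; ring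
    · exact fun u hu => Alower j (by linarith) u hu
    · intro hjJ2 u hu
      have := Aupper (j + 1) hjq (by have := hjJ hjJ2; push_cast; linarith) u hu
      push_cast at this
      exact this
    · rcases htight with ⟨v, hv, hav⟩ | h2 | ⟨h2, h3⟩
      · left
        have hρv : ρ v = 0 := by rw [hρ]; simp [hav]
        have s1 := hsum v
        have s2 := he0 v
        have s3 := hi0 v
        have s4 := hα0 v
        simp only [Finsupp.coe_zero, Pi.zero_apply] at s2 s3 s4
        refine ⟨v, hv, ?_, ?_, ?_⟩
        · intro hve
          exact (Finsupp.mem_support_iff.1 hve) (by linarith)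
        · intro u hu
          by_contra hne
          exact Finsupp.mem_support_iff.1 ((hAp u hu).2.2.1 (Finsupp.mem_support_iff.2 hne))
            (by linarith)
        · intro u hu
          obtain ⟨n, hn, rfl⟩ := Imem u hu
          by_contra hne
          exact Finsupp.mem_support_iff.1 ((hIp n hn).2.2.1
            ((Finsupp.mem_support_iff (a := v)).2 (by simpa using hne))) (by linarith)
      · right; left
        exact fun u hu => le_antisymm (Aupper j (by omega) (by linarith) u hu)
          (Alower j (by linarith) u hu)
      · right; right
        refine ⟨h2, fun u hu => le_antisymm ?_ ?_⟩
        · have := Aupper (j + 1) hjq (by push_cast; linarith) u hu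
          push_cast at this
          exact this
        · have := Alower (j + 1) (by push_cast; linarith) u hu
          push_cast at this
          exact this

end Cells

section Cells
variable {ι : Type*}

theorem ms_ev_const (p : ι → Prop) {w : (ι →₀ ℝ) →₀ ℝ} {c : ℝ} (h : ∀ u ∈ w.support, ms p u = c) :
    ms p (ev w) = tot w * c := by
  rw [ms_ev p w subset_rfl, tot_eq_sum w subset_rfl, Finset.sum_mul]
  exact Finset.sum_congr rfl (fun u hu => by rw [h u hu])

theorem ms_ev_ge (p : ι → Prop) {w : (ι →₀ ℝ) →₀ ℝ} (hw : 0 ≤ w) {c : ℝ}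
    (h : ∀ u ∈ w.support, c ≤ ms p u) : tot w * c ≤ ms p (ev w) := by
  rw [ms_ev p w subset_rfl, tot_eq_sum w subset_rfl, Finset.sum_mul]
  exact Finset.sum_le_sum (fun u hu => mul_le_mul_of_nonneg_left (h u hu) (hw u))

theorem ms_ev_le (p : ι → Prop) {w : (ι →₀ ℝ) →₀ ℝ} (hw : 0 ≤ w) {c : ℝ}
    (h : ∀ u ∈ w.support, ms p u ≤ c) : ms p (ev w) ≤ tot w * c := by
  rw [ms_ev p w subset_rfl, tot_eq_sum w subset_rfl, Finset.sum_mul]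
  exact Finset.sum_le_sum (fun u hu => mul_le_mul_of_nonneg_left (h u hu) (hw u))

theorem ev_sub_smul_apply (w : (ι →₀ ℝ) →₀ ℝ) (γ : ι →₀ ℝ) (v : ι) :
    (ev w - tot w • γ) v = ∑ u ∈ w.support, w u * (u v - γ v) := by
  rw [Finsupp.sub_apply, ev_apply w v subset_rfl, Finsupp.smul_apply, tot_eq_sum w subset_rfl,
    smul_eq_mul, Finset.sum_mul, ← Finset.sum_sub_distrib]
  exact Finset.sum_congr rfl (fun u _ => by ring)

theorem ev_sub_smul_ne {w : (ι →₀ ℝ) →₀ ℝ} {γ : ι →₀ ℝ} {v : ι} (h : (ev w - tot w • γ) v ≠ 0) :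
    ∃ u ∈ w.support, u v ≠ γ v := by
  by_contra hcon
  push Not at hcon
  apply h
  rw [ev_sub_smul_apply]
  exact Finset.sum_eq_zero (fun u hu => by rw [hcon u hu, sub_self, mul_zero])

variable [LinearOrder ι]
variable {b₁ : ι → Prop} {γ : ι →₀ ℝ} {v₀ : ι} {s q k₁ k₂ J : ℕ} {E : Set ι}
  {I A : Set (ι →₀ ℝ)} {e e' : ι →₀ ℝ} {bI bA bI' bA' : (ι →₀ ℝ) →₀ ℝ}

theorem Common.ms_e (h : Common b₁ s q E I A) (he : (e.support : Set ι) ⊆ E) :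
    ms b₁ e = tot e := ms_eq_tot (fun v hv => h.eb v (he hv))

theorem Common.e_zero (h : Common b₁ s q E I A) (he : (e.support : Set ι) ⊆ E) {v : ι}
    (hv : ¬ b₁ v) : e v = 0 := by
  by_contra hne
  exact hv (h.eb v (he (Finsupp.mem_support_iff.2 hne)))

theorem Common.masses (h : Common b₁ s q E I A) (he : (e.support : Set ι) ⊆ E)
    (hI : (bI.support : Set (ι →₀ ℝ)) ⊆ I) (hA : (bA.support : Set (ι →₀ ℝ)) ⊆ A) :
    ms b₁ (e + ev bI + ev bA) = tot e + s * (tot bI + tot bA) ∧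
    tot (e + ev bI + ev bA) = tot e + (s + q) * (tot bI + tot bA) := by
  constructor
  · rw [map_add, map_add, h.ms_e he, ms_ev_const b₁ (fun u hu => (h.nnI u (hI hu)).2.1),
      ms_ev_const b₁ (fun u hu => (h.nnA u (hA hu)).2.1)]
    ring
  · rw [map_add, map_add, ms_ev_const _ (fun u hu => (h.nnI u (hI hu)).2.2),
      ms_ev_const _ (fun u hu => (h.nnA u (hA hu)).2.2)]
    ring

theorem plain_unique (hq : 0 < q) (he : 0 ≤ e) (he' : 0 ≤ e') (hA : 0 ≤ bA) (hA' : 0 ≤ bA')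
    {I I' : Set (ι →₀ ℝ)}
    (h : Common b₁ s q (e.support : Set ι) I (bA.support : Set (ι →₀ ℝ)))
    (h' : Common b₁ s q (e'.support : Set ι) I' (bA'.support : Set (ι →₀ ℝ)))
    (heq : e + ev bA = e' + ev bA') : e = e' ∧ bA = bA' := by
  have hq' : (0 : ℝ) < q := by exact_mod_cast hq
  have m := h.masses (bI := 0) subset_rfl (by simp) subset_rfl
  have m' := h'.masses (bI := 0) subset_rfl (by simp) subset_rfl
  simp only [map_zero, add_zero, zero_add] at m m'
  rw [heq, m'.1, m'.2] at m
  have htA : tot bA = tot bA' := by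
    apply mul_left_cancel₀ hq'.ne'
    linarith [m.1, m.2]
  have hte : tot e = tot e' := by rw [htA] at m; linarith [m.1]
  have hsp := split_unique_on b₁ he (ev_nonneg hA (fun u hu => (h.nnA u hu).1)) he'
    (ev_nonneg hA' (fun u hu => (h'.nnA u hu).1))
    (fun v v' _ hv' hve hv'e => by
      obtain ⟨u, hu, huv⟩ := ev_apply_ne hv'e
      exact h.ea v (Finsupp.mem_support_iff.2 hve) u hu v' hv' huv)
    (fun v v' _ hv' hve hv'e => by
      obtain ⟨u, hu, huv⟩ := ev_apply_ne hv'e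
      exact h'.ea v (Finsupp.mem_support_iff.2 hve) u hu v' hv' huv)
    (fun v _ => by rw [← Finsupp.add_apply, heq, Finsupp.add_apply])
    (by rw [h.ms_e subset_rfl, h'.ms_e subset_rfl, hte])
  have hee : e = e' := by
    ext v
    by_cases hv : b₁ v
    · exact (hsp v hv).1
    · rw [h.e_zero subset_rfl hv, h'.e_zero subset_rfl hv]
  refine ⟨hee, ?_⟩
  rw [hee] at heq
  exact chain_unique (fun _ => 0) _ bA bA' rfl hA hA' h.chA h'.chA
    (fun u hu x => by rw [sub_zero]; exact ms_ZZ (fun v _ => h.intA u hu v))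
    (fun u hu x => by rw [sub_zero]; exact ms_ZZ (fun v _ => h'.intA u hu v))
    htA (add_left_cancel heq)

theorem plain_ZZ {E : Set ι} {A : Finset (ι →₀ ℝ)} {I : Set (ι →₀ ℝ)}
    (h : Common b₁ s q E I (A : Set (ι →₀ ℝ)))
    (he : (e.support : Set ι) ⊆ E) (hA : bA.support ⊆ A) (ht : tot bA ∈ ZZ)
    (hi : ∀ v, (e + ev bA) v ∈ ZZ) : (∀ v, e v ∈ ZZ) ∧ ∀ u, bA u ∈ ZZ := by
  have hA' : (bA.support : Set (ι →₀ ℝ)) ⊆ A := fun u hu => hA hu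
  have m := h.masses (bI := 0) he (by simp) hA'
  simp only [map_zero, add_zero, zero_add] at m
  have hsp := split_ZZ_on b₁ (P := E) (R := {v | ∃ u ∈ A, u v ≠ 0}) (p := e) (r := ev bA)
    (fun v hv v' hv' _ hb => by
      obtain ⟨u, hu, huv⟩ := hv'
      exact h.ea v hv u hu v' hb huv)
    (fun v hv => he (Finsupp.mem_support_iff.2 hv))
    (fun v hv => by
      obtain ⟨u, hu, huv⟩ := ev_apply_ne hv
      exact ⟨u, hA hu, huv⟩)
    (by
      rw [h.ms_e he, ← sub_eq_iff_eq_add.2 m.1]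
      exact sub_mem (ms_ZZ (fun v _ => hi v)) (mul_mem (natCast_mem_ZZ _) ht))
    (fun v _ => hi v)
  have hez : ∀ v, e v ∈ ZZ := fun v => by
    by_cases hv : b₁ v
    · exact (hsp v hv).1
    · rw [h.e_zero he hv]; exact zero_mem _
  refine ⟨hez, chain_ZZ (fun _ => 0) _ A rfl h.chA
    (fun u hu x => by rw [sub_zero]; exact ms_ZZ (fun v _ => h.intA u hu v)) bA hA ht
    (fun x => ?_)⟩
  rw [mul_zero, sub_zero]
  apply ms_ZZ
  intro v _
  have := sub_mem (hi v) (hez v)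
  simpa using this

theorem ms_ge_I {j : ℕ}
    (hj : ∀ u ∈ I, ms (fun v => v₀ ≤ v) u = j + γ v₀) (hI : (bI.support : Set (ι →₀ ℝ)) ⊆ I) :
    ms (fun v => v₀ ≤ v) (ev bI) = tot bI * (j + γ v₀) :=
  ms_ev_const _ (fun u hu => hj u (hI hu))

theorem blocks (b₁ : ι → Prop) (v₀ v : ι) :
    b₁ v ∨ (¬ b₁ v ∧ v < v₀) ∨ v₀ ≤ v := by
  by_cases hb : b₁ v
  · exact Or.inl hb
  · rcases lt_or_ge v v₀ with hv | hv
    · exact Or.inr (Or.inl ⟨hb, hv⟩)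
    · exact Or.inr (Or.inr hv)

theorem cell_ZZ {I A : Finset (ι →₀ ℝ)} (hd : CellData b₁ γ v₀ s q k₁ k₂ J)
    (h : Common b₁ s q E (I : Set (ι →₀ ℝ)) (A : Set (ι →₀ ℝ)))
    (hc : Cell b₁ γ v₀ J E (I : Set (ι →₀ ℝ)) (A : Set (ι →₀ ℝ)))
    (he : (e.support : Set ι) ⊆ E) (hI : bI.support ⊆ I) (hA : bA.support ⊆ A)
    (hI0 : tot bI = 0) (ht : tot bA ∈ ZZ) (hi : ∀ v, (e + ev bI + ev bA) v ∈ ZZ) :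
    (∀ v, e v ∈ ZZ) ∧ (∀ u, bI u ∈ ZZ) ∧ ∀ u, bA u ∈ ZZ := by
  have hA' : (bA.support : Set (ι →₀ ℝ)) ⊆ A := fun u hu => hA hu
  have hI' : (bI.support : Set (ι →₀ ℝ)) ⊆ I := fun u hu => hI hu
  obtain ⟨j, -, hj, -⟩ := hc.tight
  have m := h.masses he hI' hA'
  rw [hI0, zero_add] at m
  have neI : ∀ v, ev bI v ≠ 0 → ∃ u ∈ I, u v ≠ γ v := fun v hv => by
    have : (ev bI - tot bI • γ) v ≠ 0 := by simpa [hI0] using hv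
    obtain ⟨u, hu, huv⟩ := ev_sub_smul_ne this
    exact ⟨u, hI hu, huv⟩
  have neA : ∀ v, ev bA v ≠ 0 → ∃ u ∈ A, u v ≠ 0 := fun v hv => by
    obtain ⟨u, hu, huv⟩ := ev_apply_ne hv
    exact ⟨u, hA hu, huv⟩
  have hsp := split_ZZ_on b₁ (P := E) (R := {v | (∃ u ∈ I, u v ≠ γ v) ∨ ∃ u ∈ A, u v ≠ 0})
    (p := e) (r := ev bI + ev bA)
    (fun v hv v' hv' _ hb => by
      rcases hv' with ⟨u, hu, huv⟩ | ⟨u, hu, huv⟩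
      · exact hc.ei v hv u hu v' hb huv
      · exact h.ea v hv u hu v' hb huv)
    (fun v hv => he (Finsupp.mem_support_iff.2 hv))
    (fun v hv => by
      by_cases h0 : ev bI v = 0
      · right
        rw [Finsupp.add_apply, h0, zero_add] at hv
        exact neA v hv
      · exact Or.inl (neI v h0))
    (by
      rw [h.ms_e he, ← sub_eq_iff_eq_add.2 m.1]
      exact sub_mem (ms_ZZ (fun v _ => hi v)) (mul_mem (natCast_mem_ZZ _) ht))
    (fun v _ => by
      have := hi v
      rwa [add_assoc, Finsupp.add_apply] at this)
  have hez : ∀ v, e v ∈ ZZ := fun v => by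
    by_cases hv : b₁ v
    · exact (hsp v hv).1
    · rw [h.e_zero he hv]; exact zero_mem _
  have hia : ∀ v, ev bI v + ev bA v ∈ ZZ := fun v => by
    have := sub_mem (hi v) (hez v)
    have e1 : (e + ev bI + ev bA) v - e v = ev bI v + ev bA v := by
      simp only [Finsupp.add_apply]; ring
    rwa [e1] at this
  have mI1 : ms b₁ (ev bI) = 0 := by
    rw [ms_ev_const b₁ (fun u hu => (h.nnI u (hI hu)).2.1), hI0, zero_mul]
  have mIt : tot (ev bI) = 0 := by
    rw [ms_ev_const _ (fun u hu => (h.nnI u (hI hu)).2.2), hI0, zero_mul]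
  have mI3 : ms (fun v => v₀ ≤ v) (ev bI) = 0 := by
    rw [ms_ge_I hj hI', hI0, zero_mul]
  have mI2 : ms (fun v => ¬ b₁ v ∧ v < v₀) (ev bI) = 0 := by
    have := hd.tot_eq (ev bI)
    rw [mI1, mIt, mI3] at this
    linarith
  have block : ∀ b : ι → Prop, ms b (ev bI) = 0 →
      (∀ v v', b v → b v' → (b₁ v ↔ b₁ v') ∧ (v₀ ≤ v ↔ v₀ ≤ v')) →
      ∀ v, b v → ev bI v ∈ ZZ ∧ ev bA v ∈ ZZ := fun b hb0 hb =>
    split_ZZ_on b (P := {v | ∃ u ∈ I, u v ≠ γ v}) (R := {v | ∃ u ∈ A, u v ≠ 0})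
      (fun v hv v' hv' hbv hbv' => by
        obtain ⟨u, hu, huv⟩ := hv
        obtain ⟨u', hu', huv'⟩ := hv'
        exact hc.ia u hu u' hu' v v' (hb v v' hbv hbv').1 (hb v v' hbv hbv').2 huv huv')
      neI neA (by rw [hb0]; exact zero_mem _) (fun v _ => hia v)
  have hall : ∀ v, ev bI v ∈ ZZ ∧ ev bA v ∈ ZZ := fun v => by
    rcases blocks b₁ v₀ v with hv | hv | hv
    · exact block b₁ mI1 (fun v v' hv hv' => ⟨by simp [hv, hv'],
        iff_of_false (fun hh => hd.not_b hh hv) (fun hh => hd.not_b hh hv')⟩) v hv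
    · exact block _ mI2 (fun v v' hv hv' => ⟨iff_of_false hv.1 hv'.1,
        iff_of_false (not_le.2 hv.2) (not_le.2 hv'.2)⟩) v hv
    · exact block _ mI3 (fun v v' hv hv' => ⟨iff_of_false (hd.not_b hv) (hd.not_b hv'),
        iff_of_true hv hv'⟩) v hv
  refine ⟨hez, chain_ZZ (fun x => pre x γ) _ I rfl h.chI (fun u hu x => ?_) bI hI
    (by rw [hI0]; exact zero_mem _) (fun x => ?_), chain_ZZ (fun _ => 0) _ A rfl h.chA
    (fun u hu x => by rw [sub_zero]; exact ms_ZZ (fun v _ => h.intA u hu v)) bA hA ht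
    (fun x => ?_)⟩
  · rw [← map_sub]
    exact ms_ZZ (fun v _ => hc.intI u hu v)
  · rw [hI0, zero_mul, sub_zero]
    exact ms_ZZ (fun v _ => (hall v).1)
  · rw [mul_zero, sub_zero]
    exact ms_ZZ (fun v _ => (hall v).2)

theorem cell_index (hd : CellData b₁ γ v₀ s q k₁ k₂ J) (h : Common b₁ s q E I A)
    (hc : Cell b₁ γ v₀ J E I A) :
    ∃ (H : (ι →₀ ℝ) →ₗ[ℝ] ℝ) (δ : ℝ), 0 < δ ∧ δ < 1 ∧
      (∀ (e : ι →₀ ℝ) (bI bA : (ι →₀ ℝ) →₀ ℝ), (e.support : Set ι) ⊆ E →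
        (bI.support : Set (ι →₀ ℝ)) ⊆ I → (bA.support : Set (ι →₀ ℝ)) ⊆ A →
        H (e + ev bI + ev bA) = δ * tot bI) ∧
      (∀ a : ι →₀ ℝ, (∀ v, a v ∈ ZZ) → (tot a - ms b₁ a) / q ∈ ZZ → H a ∈ ZZ) ∧
      (∀ c : ι →₀ ℝ, (∀ v, c v - γ v ∈ ZZ) → tot c - ms b₁ c = 0 → H c - δ ∈ ZZ) ∧
      ∃ x, γ x ≠ 0 ∧ H (Finsupp.single x 1) ≠ 0 := by
  have hq0 : 0 < q := by have := hd.k₂J; have := hd.k₂pos; omega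
  have hq : (0 : ℝ) < q := by exact_mod_cast hq0
  obtain ⟨j, hjJ, hj, -, -, ht⟩ := hc.tight
  have hjq : (j : ℝ) < q := by
    have := hd.k₂J; have := hd.k₂pos
    exact_mod_cast (show j < q by omega)
  have hge : ∀ (e : ι →₀ ℝ) (bI bA : (ι →₀ ℝ) →₀ ℝ), (e.support : Set ι) ⊆ E →
        (bI.support : Set (ι →₀ ℝ)) ⊆ I → (bA.support : Set (ι →₀ ℝ)) ⊆ A → ∀ c : ℝ,
        (∀ u ∈ A, ms (fun v => v₀ ≤ v) u = c) →
        ms (fun v => v₀ ≤ v) (e + ev bI + ev bA) = tot bI * (j + γ v₀) + tot bA * c := by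
    intro e bI bA he hI hA c hcA
    rw [map_add, map_add, ms_ge_I hj hI, ms_ev_const _ (fun u hu => hcA u (hA hu)),
      ms_zero_of (fun v hv hv0 => hd.not_b hv0 (h.eb v (he hv))), zero_add]
  have ht2 : ∀ (e : ι →₀ ℝ) (bI bA : (ι →₀ ℝ) →₀ ℝ), (e.support : Set ι) ⊆ E →
        (bI.support : Set (ι →₀ ℝ)) ⊆ I → (bA.support : Set (ι →₀ ℝ)) ⊆ A →
        (tot (e + ev bI + ev bA) - ms b₁ (e + ev bI + ev bA)) / q = tot bI + tot bA := by
    intro e bI bA he hI hA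
    have m := h.masses he hI hA
    rw [m.1, m.2]
    field_simp
    ring
  have fc : ∀ c : ι →₀ ℝ, (∀ v, c v - γ v ∈ ZZ) → ms (fun v => v₀ ≤ v) c - γ v₀ ∈ ZZ := by
    intro c hc
    rw [← hd.ms_ge, ← map_sub]
    exact ms_ZZ (fun v _ => hc v)
  have s1 : ms (fun v => v₀ ≤ v) (Finsupp.single v₀ (1 : ℝ)) = 1 := ms_single _ _ _ le_rfl
  have s2 : tot (Finsupp.single v₀ (1 : ℝ)) = 1 := ms_single _ _ _ trivial
  have s3 : ms b₁ (Finsupp.single v₀ (1 : ℝ)) = 0 := ms_single_not _ _ _ hd.v₀b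
  rcases ht with ⟨v, hv, hvE, hvA, hvI⟩ | hA | ⟨hlt, hA⟩
  · refine ⟨Finsupp.lapply v, γ v, lt_of_le_of_ne (hd.nonneg v) hv.symm, hd.lt_one v, ?_, ?_, ?_,
      v, hv, by simp⟩
    · intro e bI bA he hI hA
      simp only [Finsupp.lapply_apply, Finsupp.add_apply]
      have e1 : e v = 0 := by
        by_contra hne; exact hvE (he (Finsupp.mem_support_iff.2 hne))
      have e2 : ev bA v = 0 := by
        by_contra hne
        obtain ⟨u, hu, huv⟩ := ev_apply_ne hne
        exact huv (hvA u (hA hu))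
      have e3 : (ev bI - tot bI • γ) v = 0 := by
        by_contra hne
        obtain ⟨u, hu, huv⟩ := ev_sub_smul_ne hne
        exact huv (hvI u (hI hu))
      simp only [Finsupp.sub_apply, Finsupp.smul_apply, smul_eq_mul] at e3
      rw [e1, e2]
      linarith
    · exact fun a ha _ => ha v
    · exact fun c hc _ => hc v
  · refine ⟨ms (fun v => v₀ ≤ v) - (j / q : ℝ) • (tot - ms b₁), γ v₀, hd.pos, hd.lt_one v₀,
      ?_, ?_, ?_, v₀, hd.pos.ne', ?_⟩
    · intro e bI bA he hI hA'
      have g1 := hge e bI bA he hI hA' j hA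
      have g2 := ht2 e bI bA he hI hA'
      simp only [LinearMap.sub_apply, LinearMap.smul_apply, smul_eq_mul]
      rw [g1, div_mul_eq_mul_div, mul_div_assoc, g2]
      ring
    · intro a ha hat
      simp only [LinearMap.sub_apply, LinearMap.smul_apply, smul_eq_mul]
      rw [div_mul_eq_mul_div, mul_div_assoc]
      exact sub_mem (ms_ZZ fun v _ => ha v) (mul_mem (natCast_mem_ZZ _) hat)
    · intro c hc hct
      simp only [LinearMap.sub_apply, LinearMap.smul_apply, smul_eq_mul]
      rw [hct, mul_zero, sub_zero]
      exact fc c hc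
    · simp only [LinearMap.sub_apply, LinearMap.smul_apply, smul_eq_mul]
      rw [s1, s2, s3, sub_zero, mul_one]
      intro h0
      have : (j : ℝ) / q < 1 := by rwa [div_lt_one hq]
      linarith
  · have hjq' : ((j : ℝ) + 1) < q := by
      have := hd.k₂J; have := hd.k₂pos
      exact_mod_cast (show j + 1 < q by omega)
    have hlt1 := hd.lt_one v₀
    have hpos := hd.pos
    refine ⟨((j + 1) / q : ℝ) • (tot - ms b₁) - ms (fun v => v₀ ≤ v), 1 - γ v₀, by linarith,
      by linarith, ?_, ?_, ?_, v₀, hd.pos.ne', ?_⟩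
    · intro e bI bA he hI hA'
      have g1 := hge e bI bA he hI hA' (j + 1) hA
      have g2 := ht2 e bI bA he hI hA'
      simp only [LinearMap.sub_apply, LinearMap.smul_apply, smul_eq_mul]
      rw [g1, div_mul_eq_mul_div, mul_div_assoc, g2]
      ring
    · intro a ha hat
      simp only [LinearMap.sub_apply, LinearMap.smul_apply, smul_eq_mul]
      rw [div_mul_eq_mul_div, mul_div_assoc]
      exact sub_mem (mul_mem (add_mem (natCast_mem_ZZ _) (one_mem _)) hat)
        (ms_ZZ fun v _ => ha v)
    · intro c hc hct
      simp only [LinearMap.sub_apply, LinearMap.smul_apply, smul_eq_mul]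
      rw [hct, mul_zero]
      have := sub_mem (neg_mem (fc c hc)) (one_mem ZZ)
      convert this using 1
      ring
    · simp only [LinearMap.sub_apply, LinearMap.smul_apply, smul_eq_mul]
      rw [s1, s2, s3, sub_zero, mul_one]
      intro h0
      have : ((j : ℝ) + 1) / q < 1 := by rwa [div_lt_one hq]
      linarith

theorem CellData.q_pos (h : CellData b₁ γ v₀ s q k₁ k₂ J) : 0 < q := by
  have := h.k₂J
  have := h.k₂pos
  omega

theorem Cell.γ_le (hd : CellData b₁ γ v₀ s q k₁ k₂ J) (h : Common b₁ s q E I A)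
    (hc : Cell b₁ γ v₀ J E I A) {u : ι →₀ ℝ} (hu : u ∈ I) (v : ι) : 0 ≤ u v - γ v := by
  obtain ⟨n, hn⟩ := hc.intI u hu v
  have h1 := (h.nnI u hu).1 v
  have h2 := hd.lt_one v
  simp only [Finsupp.coe_zero, Pi.zero_apply] at h1
  have h3 : (-1 : ℝ) < n := by
    have hn' : (n : ℝ) = u v - γ v := hn
    rw [hn']; linarith
  have h4 : (-1 : ℤ) < n := by exact_mod_cast h3
  have h5 : (0 : ℝ) ≤ n := by exact_mod_cast (show (0 : ℤ) ≤ n by omega)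
  have hn' : (n : ℝ) = u v - γ v := hn
  rwa [← hn']

theorem Cell.sub_nonneg (hd : CellData b₁ γ v₀ s q k₁ k₂ J)
    (h : Common b₁ s q E (bI.support : Set (ι →₀ ℝ)) A)
    (hc : Cell b₁ γ v₀ J E (bI.support : Set (ι →₀ ℝ)) A) (hb : 0 ≤ bI) :
    0 ≤ ev bI - tot bI • γ := by
  intro v
  rw [ev_sub_smul_apply]
  exact Finset.sum_nonneg (fun u hu => mul_nonneg (hb u) (Cell.γ_le hd h hc hu v))

/-- The conditions which determine the weight `l` of the special vector `γ`. -/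
structure Weight (γ : ι →₀ ℝ) (v₀ : ι) (J : ℕ) (a : ι →₀ ℝ) (f t : ℝ) (l : ℝ) (j : ℕ) : Prop where
  nonneg : 0 ≤ l
  le : l • γ ≤ a
  lower : j * t + l * γ v₀ ≤ f
  upper : j < J → f + l * (1 - γ v₀) ≤ (j + 1) * t
  tight : (∃ v, γ v ≠ 0 ∧ a v = l * γ v) ∨ f = j * t + l * γ v₀ ∨
    (j < J ∧ f + l * (1 - γ v₀) = (j + 1) * t)

theorem Weight.not_lt {κ : Type*} {γ a : κ →₀ ℝ} {v₀ : κ} {J : ℕ} {f t l l' : ℝ} {j : ℕ} (hγ : 0 ≤ γ) (h1 : γ v₀ < 1)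
    (h0 : 0 < γ v₀) (h : Weight γ v₀ J a f t l j) (h' : Weight γ v₀ J a f t l' j) : ¬ l < l' := by
  intro hlt
  rcases h.tight with ⟨v, hv, hav⟩ | h2 | ⟨h2, h3⟩
  · have hv' := lt_of_le_of_ne (hγ v) hv.symm
    have := h'.le v
    simp only [Finsupp.smul_apply, smul_eq_mul] at this
    rw [hav] at this
    exact absurd (le_of_mul_le_mul_right this hv') (not_le.2 hlt)
  · have := h'.lower
    have := mul_lt_mul_of_pos_right hlt h0
    linarith
  · have := h'.upper h2
    have := mul_lt_mul_of_pos_right hlt (show 0 < 1 - γ v₀ by linarith)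
    linarith

theorem Weight.zero_of_lt {κ : Type*} {γ a : κ →₀ ℝ} {v₀ : κ} {J : ℕ} {f t l l' : ℝ} {j j' : ℕ} (ht : 0 ≤ t) (h1 : γ v₀ < 1)
    (h0 : 0 < γ v₀) (h : Weight γ v₀ J a f t l j) (h' : Weight γ v₀ J a f t l' j') (hj' : j' ≤ J)
    (hlt : j < j') : l = 0 ∧ l' = 0 := by
  have a1 := h.upper (hlt.trans_le hj')
  have a2 := h'.lower
  have a3 : ((j : ℝ) + 1) * t ≤ j' * t :=
    mul_le_mul_of_nonneg_right (by exact_mod_cast hlt) ht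
  have a4 := mul_nonneg h.nonneg (show 0 ≤ 1 - γ v₀ by linarith)
  have a5 := mul_nonneg h'.nonneg h0.le
  constructor
  · rcases mul_eq_zero.1 (show l * (1 - γ v₀) = 0 by linarith) with h | h
    · exact h
    · linarith
  · rcases mul_eq_zero.1 (show l' * γ v₀ = 0 by linarith) with h | h
    · exact h
    · linarith

theorem Cell.weight (hd : CellData b₁ γ v₀ s q k₁ k₂ J) (he : 0 ≤ e) (hI : 0 ≤ bI) (hA : 0 ≤ bA)
    (h : Common b₁ s q (e.support : Set ι) (bI.support : Set (ι →₀ ℝ))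
      (bA.support : Set (ι →₀ ℝ)))
    (hc : Cell b₁ γ v₀ J (e.support : Set ι) (bI.support : Set (ι →₀ ℝ))
      (bA.support : Set (ι →₀ ℝ))) :
    ∃ j ≤ J, (∀ u ∈ bI.support, ms (fun v => v₀ ≤ v) u = j + γ v₀) ∧
      Weight γ v₀ J (e + ev bI + ev bA) (ms (fun v => v₀ ≤ v) (e + ev bI + ev bA))
      (tot bI + tot bA) (tot bI) j := by
  obtain ⟨j, hjJ, hj, hl, hu, ht⟩ := hc.tight
  have hα := ev_nonneg hA (fun u hu => (h.nnA u hu).1)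
  have hi := Cell.sub_nonneg hd h hc hI
  have hf : ms (fun v => v₀ ≤ v) (e + ev bI + ev bA) =
      tot bI * (j + γ v₀) + ms (fun v => v₀ ≤ v) (ev bA) := by
    rw [map_add, map_add, ms_ge_I hj subset_rfl,
      ms_zero_of (fun v hv hv0 => hd.not_b hv0 (h.eb v hv)), zero_add]
  refine ⟨j, hjJ, hj, ms_nonneg _ hI, ?_, ?_, ?_, ?_⟩
  · intro v
    have e1 := he v
    have e2 := hi v
    have e3 := hα v
    simp only [Finsupp.coe_zero, Pi.zero_apply, Finsupp.sub_apply, Finsupp.add_apply] at *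
    linarith
  · have := ms_ev_ge _ hA hl
    rw [hf]; linarith
  · intro hjJ
    have := ms_ev_le _ hA (hu hjJ)
    rw [hf]; linarith
  · rcases ht with ⟨v, hv, hvE, hvA, hvI⟩ | hA' | ⟨hlt, hA'⟩
    · refine Or.inl ⟨v, hv, ?_⟩
      have e1 : e v = 0 := Finsupp.notMem_support_iff.1 hvE
      have e2 : ev bA v = 0 := by
        by_contra hne
        obtain ⟨u, hu, huv⟩ := ev_apply_ne hne
        exact huv (hvA u hu)
      have e3 : (ev bI - tot bI • γ) v = 0 := by
        by_contra hne
        obtain ⟨u, hu, huv⟩ := ev_sub_smul_ne hne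
        exact huv (hvI u hu)
      simp only [Finsupp.sub_apply, Finsupp.smul_apply, smul_eq_mul] at e3
      rw [Finsupp.add_apply, Finsupp.add_apply, e1, e2]
      linarith
    · right; left
      rw [hf, ms_ev_const _ hA']; ring
    · right; right
      refine ⟨hlt, ?_⟩
      rw [hf, ms_ev_const _ hA']; ring

theorem cell_unique (hd : CellData b₁ γ v₀ s q k₁ k₂ J) (he : 0 ≤ e) (hI : 0 ≤ bI) (hA : 0 ≤ bA)
    (he' : 0 ≤ e') (hI' : 0 ≤ bI') (hA' : 0 ≤ bA')
    (h : Common b₁ s q (e.support : Set ι) (bI.support : Set (ι →₀ ℝ))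
      (bA.support : Set (ι →₀ ℝ)))
    (hc : Cell b₁ γ v₀ J (e.support : Set ι) (bI.support : Set (ι →₀ ℝ))
      (bA.support : Set (ι →₀ ℝ)))
    (h' : Common b₁ s q (e'.support : Set ι) (bI'.support : Set (ι →₀ ℝ))
      (bA'.support : Set (ι →₀ ℝ)))
    (hc' : Cell b₁ γ v₀ J (e'.support : Set ι) (bI'.support : Set (ι →₀ ℝ))
      (bA'.support : Set (ι →₀ ℝ)))
    (heq : e + ev bI + ev bA = e' + ev bI' + ev bA') : e = e' ∧ bI = bI' ∧ bA = bA' := by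
  have hq : (0 : ℝ) < q := by exact_mod_cast hd.q_pos
  have m := h.masses (e := e) (bI := bI) (bA := bA) subset_rfl subset_rfl subset_rfl
  have m' := h'.masses (e := e') (bI := bI') (bA := bA') subset_rfl subset_rfl subset_rfl
  rw [← heq] at m'
  have ht2 : tot bI + tot bA = tot bI' + tot bA' := by
    apply mul_left_cancel₀ hq.ne'
    linarith [m.1, m.2, m'.1, m'.2]
  have hte : tot e = tot e' := by
    have h1 := m.1
    have h2 := m'.1
    rw [ht2] at h1; linarith
  have t0 : 0 ≤ tot bI + tot bA := add_nonneg (ms_nonneg _ hI) (ms_nonneg _ hA)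
  obtain ⟨j, hjJ, hj, hw⟩ := Cell.weight hd he hI hA h hc
  obtain ⟨j', hjJ', hj', hw'⟩ := Cell.weight hd he' hI' hA' h' hc'
  rw [← heq, ← ht2] at hw'
  have hzero : tot bI = 0 ∧ tot bI' = 0 → e = e' ∧ bI = bI' ∧ bA = bA' := by
    rintro ⟨z1, z2⟩
    have z1 := eq_zero_of_tot_eq_zero hI z1
    have z2 := eq_zero_of_tot_eq_zero hI' z2
    obtain ⟨r1, r2⟩ := plain_unique hd.q_pos he he' hA hA' h h' (by simpa [z1, z2] using heq)
    exact ⟨r1, z1.trans z2.symm, r2⟩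
  rcases lt_trichotomy j j' with hlt | rfl | hlt
  · exact hzero (hw.zero_of_lt t0 (hd.lt_one _) hd.pos hw' hjJ' hlt)
  rotate_left
  · exact hzero (hw'.zero_of_lt t0 (hd.lt_one _) hd.pos hw hjJ hlt).symm
  have hll : tot bI = tot bI' := le_antisymm
    (not_lt.1 (hw'.not_lt hd.nonneg (hd.lt_one _) hd.pos hw))
    (not_lt.1 (hw.not_lt hd.nonneg (hd.lt_one _) hd.pos hw'))
  have htA : tot bA = tot bA' := by linarith
  obtain ⟨i, hi⟩ : ∃ i, i = ev bI - tot bI • γ := ⟨_, rfl⟩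
  obtain ⟨i', hi'⟩ : ∃ i', i' = ev bI' - tot bI' • γ := ⟨_, rfl⟩
  have i0 : 0 ≤ i := hi ▸ Cell.sub_nonneg hd h hc hI
  have i0' : 0 ≤ i' := hi' ▸ Cell.sub_nonneg hd h' hc' hI'
  have neI : ∀ v, i v ≠ 0 → ∃ u ∈ bI.support, u v ≠ γ v :=
    fun v hv => ev_sub_smul_ne (by rwa [← hi])
  have neI' : ∀ v, i' v ≠ 0 → ∃ u ∈ bI'.support, u v ≠ γ v :=
    fun v hv => ev_sub_smul_ne (by rwa [← hi'])
  have neA : ∀ v, ev bA v ≠ 0 → ∃ u ∈ bA.support, u v ≠ 0 := fun v hv => ev_apply_ne hv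
  have neA' : ∀ v, ev bA' v ≠ 0 → ∃ u ∈ bA'.support, u v ≠ 0 := fun v hv => ev_apply_ne hv
  have α0 := ev_nonneg hA (fun u hu => (h.nnA u hu).1)
  have α0' := ev_nonneg hA' (fun u hu => (h'.nnA u hu).1)
  have hsum : ∀ v, e v + (i v + ev bA v) = e' v + (i' v + ev bA' v) := by
    intro v
    have := DFunLike.congr_fun heq v
    rw [hi, hi', hll]
    simp only [Finsupp.add_apply, Finsupp.sub_apply] at this ⊢
    linarith
  have ord : ∀ {e : ι →₀ ℝ} {bI bA : (ι →₀ ℝ) →₀ ℝ} {i : ι →₀ ℝ},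
      Common b₁ s q (e.support : Set ι) (bI.support : Set (ι →₀ ℝ)) (bA.support : Set (ι →₀ ℝ)) →
      Cell b₁ γ v₀ J (e.support : Set ι) (bI.support : Set (ι →₀ ℝ))
        (bA.support : Set (ι →₀ ℝ)) → (∀ v, i v ≠ 0 → ∃ u ∈ bI.support, u v ≠ γ v) →
      ∀ v v', b₁ v → b₁ v' → e v ≠ 0 → (i + ev bA) v' ≠ 0 → v ≤ v' := by
    intro e bI bA i h hc hn v v' _ hv' hve hv'e
    by_cases h0 : i v' = 0
    · rw [Finsupp.add_apply, h0, zero_add] at hv'e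
      obtain ⟨u, hu, huv⟩ := ev_apply_ne hv'e
      exact h.ea v (Finsupp.mem_support_iff.2 hve) u hu v' hv' huv
    · obtain ⟨u, hu, huv⟩ := hn v' h0
      exact hc.ei v (Finsupp.mem_support_iff.2 hve) u hu v' hv' huv
  have hsp := split_unique_on b₁ he (add_nonneg i0 α0) he' (add_nonneg i0' α0') (ord h hc neI)
    (ord h' hc' neI') (fun v _ => hsum v) (by rw [h.ms_e subset_rfl, h'.ms_e subset_rfl, hte])
  have hee : e = e' := by
    ext v
    by_cases hv : b₁ v
    · exact (hsp v hv).1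
    · rw [h.e_zero subset_rfl hv, h'.e_zero subset_rfl hv]
  have hia : ∀ v, i v + ev bA v = i' v + ev bA' v := fun v => by
    have := hsum v
    rw [hee] at this
    linarith
  have mI1 : ms b₁ (ev bI) = ms b₁ (ev bI') := by
    rw [ms_ev_const b₁ (fun u hu => (h.nnI u hu).2.1),
      ms_ev_const b₁ (fun u hu => (h'.nnI u hu).2.1), hll]
  have mIt : tot (ev bI) = tot (ev bI') := by
    rw [ms_ev_const _ (fun u hu => (h.nnI u hu).2.2),
      ms_ev_const _ (fun u hu => (h'.nnI u hu).2.2), hll]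
  have mI3 : ms (fun v => v₀ ≤ v) (ev bI) = ms (fun v => v₀ ≤ v) (ev bI') := by
    rw [ms_ge_I hj subset_rfl, ms_ge_I hj' subset_rfl, hll]
  have mI2 : ms (fun v => ¬ b₁ v ∧ v < v₀) (ev bI) = ms (fun v => ¬ b₁ v ∧ v < v₀) (ev bI') := by
    have := hd.tot_eq (ev bI)
    have := hd.tot_eq (ev bI')
    linarith
  have block : ∀ b : ι → Prop, ms b (ev bI) = ms b (ev bI') →
      (∀ v v', b v → b v' → (b₁ v ↔ b₁ v') ∧ (v₀ ≤ v ↔ v₀ ≤ v')) →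
      ∀ v, b v → i v = i' v ∧ ev bA v = ev bA' v := fun b hb0 hb =>
    split_unique_on b i0 α0 i0' α0'
      (fun v v' hbv hbv' hv hv' => by
        obtain ⟨u, hu, huv⟩ := neI v hv
        obtain ⟨u', hu', huv'⟩ := neA v' hv'
        exact hc.ia u hu u' hu' v v' (hb v v' hbv hbv').1 (hb v v' hbv hbv').2 huv huv')
      (fun v v' hbv hbv' hv hv' => by
        obtain ⟨u, hu, huv⟩ := neI' v hv
        obtain ⟨u', hu', huv'⟩ := neA' v' hv'
        exact hc'.ia u hu u' hu' v v' (hb v v' hbv hbv').1 (hb v v' hbv hbv').2 huv huv')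
      (fun v _ => hia v) (by rw [hi, hi', map_sub, map_sub, hll, hb0])
  have hall : ∀ v, i v = i' v ∧ ev bA v = ev bA' v := fun v => by
    rcases blocks b₁ v₀ v with hv | hv | hv
    · exact block b₁ mI1 (fun v v' hv hv' => ⟨by simp [hv, hv'],
        iff_of_false (fun hh => hd.not_b hh hv) (fun hh => hd.not_b hh hv')⟩) v hv
    · exact block _ mI2 (fun v v' hv hv' => ⟨iff_of_false hv.1 hv'.1,
        iff_of_false (not_le.2 hv.2) (not_le.2 hv'.2)⟩) v hv
    · exact block _ mI3 (fun v v' hv hv' => ⟨iff_of_false (hd.not_b hv) (hd.not_b hv'),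
        iff_of_true hv hv'⟩) v hv
  refine ⟨hee, chain_unique (fun x => pre x γ) _ bI bI' rfl hI hI' h.chI h'.chI
    (fun u hu x => ?_) (fun u hu x => ?_) hll ?_,
    chain_unique (fun _ => 0) _ bA bA' rfl hA hA' h.chA h'.chA
    (fun u hu x => by rw [sub_zero]; exact ms_ZZ (fun v _ => h.intA u hu v))
    (fun u hu x => by rw [sub_zero]; exact ms_ZZ (fun v _ => h'.intA u hu v)) htA
    (Finsupp.ext fun v => (hall v).2)⟩
  · rw [← map_sub]
    exact ms_ZZ (fun v _ => hc.intI u hu v)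
  · rw [← map_sub]
    exact ms_ZZ (fun v _ => hc'.intI u hu v)
  · have : i = i' := Finsupp.ext fun v => (hall v).1
    rw [hi, hi', hll] at this
    exact sub_left_injective this

end Cells

section Lift
variable {W : Type*} [AddCommGroup W] [Module ℝ W]

theorem ev_mapDomain_ev (b : (W →₀ ℝ) →₀ ℝ) : ev (b.mapDomain ev) = (ev (ev b) : W) := by
  induction b using Finsupp.induction_linear with
  | zero => simp
  | add a b ha hb => rw [Finsupp.mapDomain_add, map_add, map_add, map_add, ha, hb]
  | single v c => rw [Finsupp.mapDomain_single, ev_single, ev_single, map_smul]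

theorem ev_combine (e : W →₀ ℝ) (bI bA : (W →₀ ℝ) →₀ ℝ) :
    ev (e + bI.mapDomain ev + bA.mapDomain ev) = (ev (e + ev bI + ev bA) : W) := by
  simp only [map_add, ev_mapDomain_ev]

theorem exists_lift {E : Finset W} {I A : Finset (W →₀ ℝ)} (w : W →₀ ℝ) :
    (w.support : Set W) ⊆ ↑E ∪ ev '' (I : Set (W →₀ ℝ)) ∪ ev '' (A : Set (W →₀ ℝ)) →
    ∃ (e : W →₀ ℝ) (bI bA : (W →₀ ℝ) →₀ ℝ), e.support ⊆ E ∧ bI.support ⊆ I ∧ bA.support ⊆ A ∧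
      w = e + bI.mapDomain ev + bA.mapDomain ev ∧ (0 ≤ w → 0 ≤ e ∧ 0 ≤ bI ∧ 0 ≤ bA) := by
  classical
  induction w using Finsupp.induction with
  | zero => exact fun _ => ⟨0, 0, 0, by simp, by simp, by simp, by simp, fun _ => by simp⟩
  | single_add x c f hx hc ih =>
    intro h
    rw [Finsupp.support_single_add hx hc] at h
    obtain ⟨e, bI, bA, he, hI, hA, hf, hp⟩ := ih (fun v hv => h (by simp [Finset.mem_coe.1 hv]))
    have hpos : 0 ≤ Finsupp.single x c + f → 0 ≤ c ∧ 0 ≤ f := by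
      intro h0
      constructor
      · have := h0 x
        simpa [Finsupp.notMem_support_iff.1 hx] using this
      · intro v
        by_cases hv : v = x
        · rw [hv, Finsupp.notMem_support_iff.1 hx]; simp
        · have := h0 v
          simpa [Finsupp.single_apply, Ne.symm hv] using this
    have hxm := h (show x ∈ _ by simp)
    rcases hxm with (hxE | ⟨u, hu, rfl⟩) | ⟨u, hu, rfl⟩
    · refine ⟨Finsupp.single x c + e, bI, bA, support_add_subset ?_ he, hI, hA, ?_, fun h0 => ?_⟩
      · exact Finsupp.support_single_subset.trans (Finset.singleton_subset_iff.2 hxE)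
      · rw [hf]; abel
      · obtain ⟨h1, h2⟩ := hpos h0
        exact ⟨add_nonneg (Finsupp.single_nonneg.2 h1) (hp h2).1, (hp h2).2⟩
    · refine ⟨e, Finsupp.single u c + bI, bA, he, support_add_subset ?_ hI, hA, ?_, fun h0 => ?_⟩
      · exact Finsupp.support_single_subset.trans (Finset.singleton_subset_iff.2 hu)
      · rw [hf, Finsupp.mapDomain_add, Finsupp.mapDomain_single]; abel
      · obtain ⟨h1, h2⟩ := hpos h0
        exact ⟨(hp h2).1, add_nonneg (Finsupp.single_nonneg.2 h1) (hp h2).2.1, (hp h2).2.2⟩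
    · refine ⟨e, bI, Finsupp.single u c + bA, he, hI, support_add_subset ?_ hA, ?_, fun h0 => ?_⟩
      · exact Finsupp.support_single_subset.trans (Finset.singleton_subset_iff.2 hu)
      · rw [hf, Finsupp.mapDomain_add, Finsupp.mapDomain_single]; abel
      · obtain ⟨h1, h2⟩ := hpos h0
        exact ⟨(hp h2).1, (hp h2).2.1, add_nonneg (Finsupp.single_nonneg.2 h1) (hp h2).2.2⟩

theorem combine_support {E : Set W} {I A : Set (W →₀ ℝ)} {e : W →₀ ℝ} {bI bA : (W →₀ ℝ) →₀ ℝ}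
    (he : (e.support : Set W) ⊆ E) (hI : (bI.support : Set (W →₀ ℝ)) ⊆ I)
    (hA : (bA.support : Set (W →₀ ℝ)) ⊆ A) :
    ((e + bI.mapDomain ev + bA.mapDomain ev).support : Set W) ⊆ E ∪ ev '' I ∪ ev '' A := by
  intro x hx
  by_contra hcon
  simp only [Set.mem_union, not_or] at hcon
  obtain ⟨⟨h1, h2⟩, h3⟩ := hcon
  apply Finsupp.mem_support_iff.1 (Finset.mem_coe.1 hx)
  have e1 : e x = 0 := Finsupp.notMem_support_iff.1 (fun h => h1 (he h))
  have e2 : (bI.mapDomain ev) x = 0 := Finsupp.notMem_support_iff.1 (fun h => by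
    obtain ⟨u, hu, rfl⟩ := exists_of_mem_support_mapDomain _ _ h
    exact h2 ⟨u, hI hu, rfl⟩)
  have e3 : (bA.mapDomain ev) x = 0 := Finsupp.notMem_support_iff.1 (fun h => by
    obtain ⟨u, hu, rfl⟩ := exists_of_mem_support_mapDomain _ _ h
    exact h3 ⟨u, hA hu, rfl⟩)
  rw [Finsupp.add_apply, Finsupp.add_apply, e1, e2, e3]
  ring

theorem ev_mem_of_ZZ {G : AddSubgroup W} {a : W →₀ ℝ} (h : ∀ v ∈ a.support, v ∈ G)
    (hz : ∀ v, a v ∈ ZZ) : ev a ∈ G := by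
  rw [ev, Finsupp.linearCombination_apply, Finsupp.sum]
  refine sum_mem (fun v hv => ?_)
  obtain ⟨n, hn⟩ := hz v
  rw [← hn, id, show (Int.castRingHom ℝ) n = (n : ℝ) from rfl, Int.cast_smul_eq_zsmul]
  exact zsmul_mem (h v hv) n

theorem mem_closure_iff_ev {S : Finset W} {y : W} : y ∈ AddSubgroup.closure (S : Set W) ↔
    ∃ a : W →₀ ℝ, a.support ⊆ S ∧ (∀ v, a v ∈ ZZ) ∧ ev a = y := by
  classical
  constructor
  · intro hy
    induction hy using AddSubgroup.closure_induction with
    | mem x hx =>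
      refine ⟨Finsupp.single x 1, Finsupp.support_single_subset.trans
        (Finset.singleton_subset_iff.2 hx), fun v => ?_, by rw [ev_single, one_smul]⟩
      rw [Finsupp.single_apply]
      split_ifs
      · exact one_mem _
      · exact zero_mem _
    | zero => exact ⟨0, by simp, fun v => zero_mem _, by simp⟩
    | add x y _ _ hx hy =>
      obtain ⟨a, ha, haz, rfl⟩ := hx
      obtain ⟨b, hb, hbz, rfl⟩ := hy
      exact ⟨a + b, support_add_subset ha hb, fun v => add_mem (haz v) (hbz v), map_add _ _ _⟩
    | neg x _ hx =>
      obtain ⟨a, ha, haz, rfl⟩ := hx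
      exact ⟨-a, by rwa [Finsupp.support_neg], fun v => neg_mem (haz v), map_neg _ _⟩
  · rintro ⟨a, ha, hz, rfl⟩
    exact ev_mem_of_ZZ (fun v hv => AddSubgroup.subset_closure (ha hv)) hz

end Lift

section Stage
variable {W : Type*} [AddCommGroup W] [Module ℝ W]

/-- A triangulated cone with vertices in `Λ` of two colours, together with an order on `W`. -/
structure St [LinearOrder W] (U : Submodule ℝ W) (Λ : AddSubgroup W) (C : Set W)
    (K : Set (Finset W)) (l1 l2 : W →ₗ[ℝ] ℝ) : Prop where
  tri : Tri C K
  cone : IsCone C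
  vert : ∀ S ∈ K, ∀ v ∈ S, v ∈ Λ ∧ ((l1 v = 1 ∧ l2 v = 0) ∨ (l1 v = 0 ∧ l2 v = 1))
  lat : ∀ y ∈ Λ, y ∈ U
  int : ∀ y ∈ Λ, l1 y ∈ ZZ ∧ l2 y ∈ ZZ
  uni : ∀ S ∈ K, (∀ v ∈ S, l2 v = 0) → ∀ β : W →₀ ℝ, β.support ⊆ S → ev β ∈ Λ → ∀ v, β v ∈ ZZ
  fin : ∀ r : ℝ, {y | y ∈ Λ ∧ y ∈ C ∧ l1 y + l2 y ≤ r}.Finite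
  ord : ∀ u v, l2 u < l2 v → u < v

variable [LinearOrder W] {U : Submodule ℝ W} {Λ : AddSubgroup W} {C : Set W}
    {K : Set (Finset W)} {l1 l2 : W →ₗ[ℝ] ℝ}

theorem St.low (h : St U Λ C K l1 l2) : Low (fun v => l2 v ≤ 0) := by
  intro v v' hvv hv'
  by_contra hcon
  exact absurd (h.ord v' v (by push Not at hcon; linarith)) (not_lt.2 hvv)

theorem St.l_ev (h : St U Λ C K l1 l2) {S : Finset W} (hS : S ∈ K) {a : W →₀ ℝ}
    (ha : a.support ⊆ S) : l1 (ev a) = ms (fun v => l2 v ≤ 0) a ∧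
      l2 (ev a) = tot a - ms (fun v => l2 v ≤ 0) a := by
  classical
  rw [map_ev l1 a ha, map_ev l2 a ha, ms_eq_sum _ a ha, tot_eq_sum a ha, Finset.sum_filter,
    ← Finset.sum_sub_distrib]
  constructor
  · refine Finset.sum_congr rfl (fun v hv => ?_)
    rcases (h.vert S hS v hv).2 with ⟨e1, e2⟩ | ⟨e1, e2⟩
    · simp [e1, e2]
    · simp [e1, e2]
  · refine Finset.sum_congr rfl (fun v hv => ?_)
    rcases (h.vert S hS v hv).2 with ⟨e1, e2⟩ | ⟨e1, e2⟩
    · simp [e2]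
    · have : ¬ (1 : ℝ) ≤ 0 := by norm_num
      simp [e2, this]

theorem St.l_nonneg (h : St U Λ C K l1 l2) {y : W} (hy : y ∈ C) : 0 ≤ l1 y ∧ 0 ≤ l2 y := by
  obtain ⟨w, hw, hS, rfl⟩ := h.tri.cover y hy
  obtain ⟨e1, e2⟩ := h.l_ev hS subset_rfl
  rw [e1, e2]
  exact ⟨ms_nonneg _ hw, sub_nonneg.2 (ms_mono hw (fun _ _ => trivial))⟩

theorem St.finite (h : St U Λ C K l1 l2) : K.Finite := by
  classical
  have hf := h.fin 1
  refine (Finset.finite_toSet hf.toFinset.powerset).subset (fun S hS => ?_)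
  rw [Finset.mem_coe, Finset.mem_powerset]
  intro v hv
  rw [Set.Finite.mem_toFinset]
  obtain ⟨h1, h2⟩ := h.vert S hS v hv
  refine ⟨h1, ?_, ?_⟩
  · have := h.tri.mem_of_subset hS (β := Finsupp.single v 1) (Finsupp.single_nonneg.2 zero_le_one)
      (Finsupp.support_single_subset.trans (Finset.singleton_subset_iff.2 hv))
    rwa [ev_single, one_smul] at this
  · rcases h2 with ⟨e1, e2⟩ | ⟨e1, e2⟩ <;> rw [e1, e2] <;> norm_num

/-- A small representation of `z` by a simplex of `K`. -/
structure Zc (K : Set (Finset W)) (z : W) (c : W →₀ ℝ) : Prop where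
  ne : c ≠ 0
  lt : ∀ v, |c v| < 1
  ev : ev c = z
  mem : c.support ∈ K

/-- A small representation of `z` together with its associated cell data. -/
structure ZData (K : Set (Finset W)) (l2 : W →ₗ[ℝ] ℝ) (z : W) (s q : ℕ) (c γ : W →₀ ℝ) (v₀ : W)
    (k₁ k₂ J : ℕ) : Prop where
  zc : Zc K z c
  fr : ∀ v, γ v = Int.fract (c v)
  data : CellData (fun v => l2 v ≤ 0) γ v₀ s q k₁ k₂ J

theorem Zc.fract_ne {X : Type*} [AddCommGroup X] [Module ℝ X] {K : Set (Finset X)} {z : X}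
    {c : X →₀ ℝ} (h : Zc K z c) (v : X) : Int.fract (c v) ≠ 0 ↔ c v ≠ 0 := by
  rw [not_iff_not]
  constructor
  · intro h0
    obtain ⟨n, hn⟩ := Int.fract_eq_zero_iff.1 h0
    have := abs_lt.1 (h.lt v)
    exact ZZ_eq_zero ⟨n, hn⟩ this.1 this.2
  · intro h0
    rw [h0, Int.fract_zero]

theorem ZData.γ_ne {z : W} {s q k₁ k₂ J : ℕ} {c γ : W →₀ ℝ} {v₀ : W}
    (h : ZData K l2 z s q c γ v₀ k₁ k₂ J) (v : W) : γ v ≠ 0 ↔ c v ≠ 0 := by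
  rw [h.fr, h.zc.fract_ne]

theorem ZData.sub_mem {z : W} {s q k₁ k₂ J : ℕ} {c γ : W →₀ ℝ} {v₀ : W}
    (h : ZData K l2 z s q c γ v₀ k₁ k₂ J) (v : W) : c v - γ v ∈ ZZ := by
  rw [h.fr, Int.self_sub_fract]
  exact intCast_mem_ZZ _

theorem ZData.eq {z : W} {s q k₁ k₂ J k₁' k₂' J' : ℕ} {c γ γ' : W →₀ ℝ} {v₀ v₀' : W}
    (h : ZData K l2 z s q c γ v₀ k₁ k₂ J) (h' : ZData K l2 z s q c γ' v₀' k₁' k₂' J') :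
    γ = γ' ∧ v₀ = v₀' ∧ J = J' := by
  have hγ : γ = γ' := Finsupp.ext fun v => by rw [h.fr, h'.fr]
  subst hγ
  refine ⟨rfl, le_antisymm (h'.data.le_v₀ _ h.data.pos.ne') (h.data.le_v₀ _ h'.data.pos.ne'), ?_⟩
  have e1 : (k₁ : ℝ) = k₁' := h.data.ms₁.symm.trans h'.data.ms₁
  have e2 : (k₁ + k₂ : ℝ) = k₁' + k₂' := h.data.ms₂.symm.trans h'.data.ms₂
  have e3 : k₂ = k₂' := by
    have : (k₂ : ℝ) = k₂' := by linarith
    exact_mod_cast this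
  have := h.data.k₂J
  have := h'.data.k₂J
  omega

theorem St.exists_zdata (h : St U Λ C K l1 l2) {z : W} (hz : z ∈ Λ) (hz1 : l1 z = 0)
    (hz2 : l2 z = 0) {s q : ℕ} {c : W →₀ ℝ} (hc : Zc K z c) (hs : c.support.card ≤ s)
    (hq : c.support.card ≤ q) : ∃ γ v₀ k₁ k₂ J, ZData K l2 z s q c γ v₀ k₁ k₂ J := by
  classical
  obtain ⟨e1, e2⟩ := h.l_ev hc.mem subset_rfl
  rw [hc.ev, hz1] at e1
  rw [hc.ev, hz2, ← e1, sub_zero] at e2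
  obtain ⟨γ, hγ⟩ : ∃ γ : W →₀ ℝ, ∀ v, γ v = Int.fract (c v) :=
    ⟨c.mapRange Int.fract Int.fract_zero, fun v => by simp⟩
  have hγc : ∀ v, γ v ≠ 0 ↔ c v ≠ 0 := fun v => by rw [hγ, hc.fract_ne]
  have hγs : γ.support ⊆ c.support := fun v hv =>
    Finsupp.mem_support_iff.2 ((hγc v).1 (Finsupp.mem_support_iff.1 hv))
  have hγf : ∀ v, γ v = c v + if c v < 0 then 1 else 0 := by
    intro v
    have hb := abs_lt.1 (hc.lt v)
    rw [hγ, Int.fract]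
    split_ifs with h0
    · have : ⌊c v⌋ = -1 := Int.floor_eq_iff.2 ⟨by push_cast; linarith, by push_cast; linarith⟩
      rw [this]; push_cast; ring
    · have : ⌊c v⌋ = 0 := Int.floor_eq_iff.2 ⟨by push_cast; linarith, by push_cast; linarith⟩
      rw [this]; push_cast; ring
  have hmsγ : ∀ p : W → Prop, ms p γ = ms p c +
      ((c.support.filter p).filter (fun v => c v < 0)).card := by
    intro p
    rw [ms_eq_sum p γ hγs, ms_eq_sum p c subset_rfl, Finset.sum_congr rfl (fun v _ => hγf v),
      Finset.sum_add_distrib, Finset.sum_boole]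
  have hcne : c.support.Nonempty := Finsupp.support_nonempty_iff.2 hc.ne
  obtain ⟨v₀, hv₀, hmax⟩ := Finset.exists_max_image c.support id hcne
  have hmax : ∀ v ∈ c.support, v ≤ v₀ := hmax
  have hv₀b : ¬ l2 v₀ ≤ 0 := by
    intro hb
    have hall : ∀ v ∈ c.support, l2 v = 0 := fun v hv => by
      have := h.low v v₀ (hmax v hv) hb
      rcases (h.vert _ hc.mem v hv).2 with ⟨-, e⟩ | ⟨-, e⟩ <;> linarith
    have := h.uni _ hc.mem hall c subset_rfl (by rwa [hc.ev])
    apply hc.ne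
    ext v
    have hb := abs_lt.1 (hc.lt v)
    exact ZZ_eq_zero (this v) hb.1 hb.2
  have htot : tot c = ms (fun v => l2 v ≤ 0) c + ms (fun v => ¬ l2 v ≤ 0) c :=
    ms_split (fun v _ => by simp [le_or_gt]) (fun v _ h h' => h' h)
  have h2 : ms (fun v => ¬ l2 v ≤ 0) c = 0 := by linarith
  have hneg : ∃ v ∈ c.support, ¬ l2 v ≤ 0 ∧ c v < 0 := by
    by_contra hcon
    push Not at hcon
    rw [ms_eq_sum _ c subset_rfl, Finset.sum_eq_zero_iff_of_nonneg (fun v hv => by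
      have := Finset.mem_filter.1 hv
      exact hcon v this.1 (not_le.1 this.2))] at h2
    exact Finsupp.mem_support_iff.1 hv₀ (h2 v₀ (Finset.mem_filter.2 ⟨hv₀, hv₀b⟩))
  have hk₂ : ((c.support.filter (fun v => ¬ l2 v ≤ 0)).filter (fun v => c v < 0)).card ≤ q :=
    ((Finset.card_filter_le _ _).trans (Finset.card_filter_le _ _)).trans hq
  refine ⟨γ, v₀, ((c.support.filter (fun v => l2 v ≤ 0)).filter (fun v => c v < 0)).card,
    ((c.support.filter (fun v => ¬ l2 v ≤ 0)).filter (fun v => c v < 0)).card,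
    q - ((c.support.filter (fun v => ¬ l2 v ≤ 0)).filter (fun v => c v < 0)).card, hc, hγ,
    h.low, hv₀b, fun v => ?_, fun v => ?_, ?_, fun v hv => ?_, ?_, ?_, ?_, ?_, ?_⟩
  · rw [hγ]; exact Int.fract_nonneg _
  · rw [hγ]; exact Int.fract_lt_one _
  · refine lt_of_le_of_ne ?_ (Ne.symm ((hγc v₀).2 (Finsupp.mem_support_iff.1 hv₀)))
    rw [hγ]; exact Int.fract_nonneg _
  · exact hmax v (Finsupp.mem_support_iff.2 ((hγc v).1 hv))
  · rw [hmsγ, ← e1, zero_add]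
  · rw [ms_split (p := fun v => l2 v ≤ 0) (q := fun v => ¬ l2 v ≤ 0)
      (fun v _ => by simp [le_or_gt]) (fun v _ h h' => h' h), hmsγ, hmsγ, ← e1, h2, zero_add, zero_add]
    congr!
  · exact ((Finset.card_filter_le _ _).trans (Finset.card_filter_le _ _)).trans hs
  · omega
  · obtain ⟨v, hv, hv2, hvn⟩ := hneg
    exact Finset.card_pos.2 ⟨v, Finset.mem_filter.2 ⟨Finset.mem_filter.2 ⟨hv, hv2⟩, hvn⟩⟩

/-- The generators of a simplex of the refined triangulation. -/
structure Val (K : Set (Finset W)) (l2 : W →ₗ[ℝ] ℝ) (z : W) (s q : ℕ) (E : Finset W)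
    (I A : Finset (W →₀ ℝ)) : Prop where
  sub : ∃ Δ ∈ K, E ⊆ Δ ∧ (∀ u ∈ I, u.support ⊆ Δ) ∧ ∀ u ∈ A, u.support ⊆ Δ
  com : Common (fun v => l2 v ≤ 0) s q (E : Set W) (I : Set (W →₀ ℝ)) (A : Set (W →₀ ℝ))
  special : ∀ u ∈ I, ∃ c, Zc K z c ∧ c.support ⊆ u.support
  cell : ∀ c γ v₀ k₁ k₂ J, ZData K l2 z s q c γ v₀ k₁ k₂ J →
    (∀ v, c v ≠ 0 → v ∈ E ∨ (∃ u ∈ I, u v ≠ 0) ∨ ∃ u ∈ A, u v ≠ 0) →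
    Cell (fun v => l2 v ≤ 0) γ v₀ J (E : Set W) (I : Set (W →₀ ℝ)) (A : Set (W →₀ ℝ))

theorem Val.mono {z : W} {s q : ℕ} {E E' : Finset W} {I I' A A' : Finset (W →₀ ℝ)}
    (h : Val K l2 z s q E I A) (hE : E' ⊆ E) (hI : I' ⊆ I) (hA : A' ⊆ A) :
    Val K l2 z s q E' I' A' where
  sub := by
    obtain ⟨Δ, hΔ, h1, h2, h3⟩ := h.sub
    exact ⟨Δ, hΔ, hE.trans h1, fun u hu => h2 u (hI hu), fun u hu => h3 u (hA hu)⟩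
  com := h.com.mono (Finset.coe_subset.2 hE) (Finset.coe_subset.2 hI) (Finset.coe_subset.2 hA)
  special u hu := h.special u (hI hu)
  cell c γ v₀ k₁ k₂ J hc hs := (h.cell c γ v₀ k₁ k₂ J hc (fun v hv => by
    rcases hs v hv with h | ⟨u, hu, huv⟩ | ⟨u, hu, huv⟩
    · exact Or.inl (hE h)
    · exact Or.inr (Or.inl ⟨u, hI hu, huv⟩)
    · exact Or.inr (Or.inr ⟨u, hA hu, huv⟩))).mono (Finset.coe_subset.2 hE)
      (Finset.coe_subset.2 hI) (Finset.coe_subset.2 hA)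

/-- The refined triangulation. -/
def refine (K : Set (Finset W)) (l2 : W →ₗ[ℝ] ℝ) (z : W) (s q : ℕ) : Set (Finset W) :=
  {S | ∃ (E : Finset W) (I A : Finset (W →₀ ℝ)), Val K l2 z s q E I A ∧
    (S : Set W) ⊆ ↑E ∪ ev '' (I : Set (W →₀ ℝ)) ∪ ev '' (A : Set (W →₀ ℝ))}

theorem exists_eq_of_mem_refine {z : W} {s q : ℕ} {S : Finset W} (h : S ∈ refine K l2 z s q) :
    ∃ (E : Finset W) (I A : Finset (W →₀ ℝ)), Val K l2 z s q E I A ∧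
      (S : Set W) = ↑E ∪ ev '' (I : Set (W →₀ ℝ)) ∪ ev '' (A : Set (W →₀ ℝ)) := by
  classical
  obtain ⟨E, I, A, hV, hS⟩ := h
  refine ⟨E.filter (· ∈ S), I.filter (fun u => ev u ∈ S), A.filter (fun u => ev u ∈ S),
    hV.mono (Finset.filter_subset _ _) (Finset.filter_subset _ _) (Finset.filter_subset _ _), ?_⟩
  apply Set.Subset.antisymm
  · intro x hx
    rcases hS hx with (h | ⟨u, hu, rfl⟩) | ⟨u, hu, rfl⟩
    · exact Or.inl (Or.inl (Finset.mem_filter.2 ⟨h, hx⟩))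
    · exact Or.inl (Or.inr ⟨u, Finset.mem_filter.2 ⟨hu, hx⟩, rfl⟩)
    · exact Or.inr ⟨u, Finset.mem_filter.2 ⟨hu, hx⟩, rfl⟩
  · rintro x ((h | ⟨u, hu, rfl⟩) | ⟨u, hu, rfl⟩)
    · exact (Finset.mem_filter.1 h).2
    · exact (Finset.mem_filter.1 hu).2
    · exact (Finset.mem_filter.1 hu).2

end Stage

section Refine
variable {W : Type*} [AddCommGroup W] [Module ℝ W]
variable [LinearOrder W] {U : Submodule ℝ W} {Λ : AddSubgroup W} {C : Set W}
    {K : Set (Finset W)} {l1 l2 : W →ₗ[ℝ] ℝ} {z : W} {s q : ℕ}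

theorem exists_val_of_mem_refine {w : W →₀ ℝ} (h : w.support ∈ refine K l2 z s q) (hw : 0 ≤ w) :
    ∃ (e : W →₀ ℝ) (bI bA : (W →₀ ℝ) →₀ ℝ), 0 ≤ e ∧ 0 ≤ bI ∧ 0 ≤ bA ∧
      Val K l2 z s q e.support bI.support bA.support ∧
      w = e + bI.mapDomain ev + bA.mapDomain ev := by
  obtain ⟨E, I, A, hV, hS⟩ := h
  obtain ⟨e, bI, bA, he, hI, hA, rfl, h0⟩ := exists_lift w hS
  exact ⟨e, bI, bA, (h0 hw).1, (h0 hw).2.1, (h0 hw).2.2, hV.mono he hI hA, rfl⟩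

theorem Val.nonneg {e : W →₀ ℝ} {bI bA : (W →₀ ℝ) →₀ ℝ}
    (h : Val K l2 z s q e.support bI.support bA.support) (he : 0 ≤ e) (hI : 0 ≤ bI)
    (hA : 0 ≤ bA) : 0 ≤ e + ev bI + ev bA :=
  add_nonneg (add_nonneg he (ev_nonneg hI (fun u hu => (h.com.nnI u hu).1)))
    (ev_nonneg hA (fun u hu => (h.com.nnA u hu).1))

theorem combine_apply_ne {ι : Type*} {E : Finset ι} {I A : Finset (ι →₀ ℝ)} {e : ι →₀ ℝ}
    {bI bA : (ι →₀ ℝ) →₀ ℝ} (he : e.support ⊆ E) (hI : bI.support ⊆ I) (hA : bA.support ⊆ A)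
    {v : ι} (hv : (e + ev bI + ev bA) v ≠ 0) :
    v ∈ E ∨ (∃ u ∈ I, u v ≠ 0) ∨ ∃ u ∈ A, u v ≠ 0 := by
  by_contra hcon
  push Not at hcon
  obtain ⟨h1, h2, h3⟩ := hcon
  apply hv
  have e1 : e v = 0 := Finsupp.notMem_support_iff.1 (fun h => h1 (he h))
  have e2 : (ev bI) v = 0 := by
    by_contra hne
    obtain ⟨u, hu, huv⟩ := ev_apply_ne hne
    exact huv (h2 u (hI hu))
  have e3 : (ev bA) v = 0 := by
    by_contra hne
    obtain ⟨u, hu, huv⟩ := ev_apply_ne hne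
    exact huv (h3 u (hA hu))
  rw [Finsupp.add_apply, Finsupp.add_apply, e1, e2, e3]
  ring

theorem Val.combine_subset {E : Finset W} {I A : Finset (W →₀ ℝ)} (h : Val K l2 z s q E I A)
    {e : W →₀ ℝ} {bI bA : (W →₀ ℝ) →₀ ℝ} (he : e.support ⊆ E) (hI : bI.support ⊆ I)
    (hA : bA.support ⊆ A) : ∃ Δ ∈ K, (e + ev bI + ev bA).support ⊆ Δ := by
  obtain ⟨Δ, hΔ, h1, h2, h3⟩ := h.sub
  refine ⟨Δ, hΔ, fun v hv => ?_⟩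
  rcases combine_apply_ne he hI hA (Finsupp.mem_support_iff.1 hv) with h | ⟨u, hu, hv⟩ | ⟨u, hu, hv⟩
  · exact h1 h
  · exact h2 u hu (Finsupp.mem_support_iff.2 hv)
  · exact h3 u hu (Finsupp.mem_support_iff.2 hv)

theorem Val.I_eq_zero {e : W →₀ ℝ} {bI bA : (W →₀ ℝ) →₀ ℝ}
    (h : Val K l2 z s q e.support bI.support bA.support) (he : 0 ≤ e) (hI : 0 ≤ bI)
    (hA : 0 ≤ bA) (hno : ¬ ∃ c, Zc K z c ∧ c.support ⊆ (e + ev bI + ev bA).support) : bI = 0 := by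
  by_contra hne
  obtain ⟨u, hu⟩ := Finsupp.support_nonempty_iff.2 hne
  obtain ⟨c, hc, hcs⟩ := h.special u hu
  refine hno ⟨c, hc, fun v hv => ?_⟩
  have hv' := Finsupp.mem_support_iff.1 (hcs hv)
  have hpos : 0 < (ev bI) v :=
    ev_apply_ne_of hI (fun u hu => (h.com.nnI u hu).1) hu hv'
  have h1 := ev_nonneg hI (fun u hu => (h.com.nnI u hu).1) v
  have h2 := ev_nonneg hA (fun u hu => (h.com.nnA u hu).1) v
  have h3 := he v
  simp only [Finsupp.coe_zero, Pi.zero_apply] at h1 h2 h3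
  rw [Finsupp.mem_support_iff, Finsupp.add_apply, Finsupp.add_apply]
  linarith

theorem St.refine_tri (h : St U Λ C K l1 l2) (hz : z ∈ Λ) (hz1 : l1 z = 0) (hz2 : l2 z = 0)
    (hq : 0 < q) (hcard : ∀ c, Zc K z c → c.support.card ≤ s ∧ c.support.card ≤ q) :
    Tri {y | y ∈ C ∧ 0 ≤ (l1 - ((s : ℝ) / q) • l2) y} (refine K l2 z s q) where
  down := fun S ⟨E, I, A, hV, hS⟩ S' hS' =>
    ⟨E, I, A, hV, (Finset.coe_subset.2 hS').trans hS⟩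
  cover := by
    rintro y ⟨hy, hy1⟩
    have hq' : (0 : ℝ) < q := by exact_mod_cast hq
    obtain ⟨a, ha, haK, rfl⟩ := h.tri.cover y hy
    obtain ⟨e1, e2⟩ := h.l_ev haK subset_rfl
    obtain ⟨n1, n2⟩ := h.l_nonneg hy
    obtain ⟨t₂, ht₂⟩ : ∃ t₂, t₂ = l2 (ev a) / q := ⟨_, rfl⟩
    obtain ⟨t₁, ht₁⟩ : ∃ t₁, t₁ = (l1 - ((s : ℝ) / q) • l2) (ev a) := ⟨_, rfl⟩
    have hl2 : l2 (ev a) = q * t₂ := by rw [ht₂]; field_simp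
    have hl1 : l1 (ev a) = t₁ + s * t₂ := by
      rw [ht₁, ht₂, LinearMap.sub_apply, LinearMap.smul_apply, smul_eq_mul]; ring
    have ht₂0 : 0 ≤ t₂ := by rw [ht₂]; positivity
    rw [← ht₁] at hy1
    have h1 : ms (fun v => l2 v ≤ 0) a = t₁ + s * t₂ := by rw [← e1, hl1]
    have htot : tot a = t₁ + (s + q) * t₂ := by
      have : tot a = l2 (ev a) + ms (fun v => l2 v ≤ 0) a := by rw [e2]; ring
      rw [this, h1, hl2]; ring
    have hmem : ∀ (e : W →₀ ℝ) (bI bA : (W →₀ ℝ) →₀ ℝ), 0 ≤ e → 0 ≤ bI → 0 ≤ bA →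
        e + ev bI + ev bA = a → Common (fun v => l2 v ≤ 0) s q (e.support : Set W)
          (bI.support : Set (W →₀ ℝ)) (bA.support : Set (W →₀ ℝ)) →
        (∃ Δ ∈ K, e.support ⊆ Δ ∧ (∀ u ∈ bI.support, u.support ⊆ Δ) ∧
          ∀ u ∈ bA.support, u.support ⊆ Δ) ∧
        (∀ v, (v ∈ e.support ∨ (∃ u ∈ bI.support, u v ≠ 0) ∨ ∃ u ∈ bA.support, u v ≠ 0) →
          v ∈ a.support) := by
      intro e bI bA he hI hA hea hcom
      have hI' := ev_nonneg hI (fun u hu => (hcom.nnI u hu).1)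
      have hA' := ev_nonneg hA (fun u hu => (hcom.nnA u hu).1)
      have key : ∀ v, (v ∈ e.support ∨ (∃ u ∈ bI.support, u v ≠ 0) ∨ ∃ u ∈ bA.support, u v ≠ 0) →
          v ∈ a.support := by
        intro v hv
        have g1 := he v
        have g2 := hI' v
        have g3 := hA' v
        simp only [Finsupp.coe_zero, Pi.zero_apply] at g1 g2 g3
        rw [← hea, Finsupp.mem_support_iff, Finsupp.add_apply, Finsupp.add_apply]
        rcases hv with hv | ⟨u, hu, hv⟩ | ⟨u, hu, hv⟩
        · have := lt_of_le_of_ne g1 (Ne.symm (Finsupp.mem_support_iff.1 hv))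
          linarith
        · have := ev_apply_ne_of hI (fun u hu => (hcom.nnI u hu).1) hu hv
          linarith
        · have := ev_apply_ne_of hA (fun u hu => (hcom.nnA u hu).1) hu hv
          linarith
      exact ⟨⟨a.support, haK, fun v hv => key v (Or.inl hv),
        fun u hu v hv => key v (Or.inr (Or.inl ⟨u, hu, Finsupp.mem_support_iff.1 hv⟩)),
        fun u hu v hv => key v (Or.inr (Or.inr ⟨u, hu, Finsupp.mem_support_iff.1 hv⟩))⟩, key⟩
    have done : ∀ (e : W →₀ ℝ) (bI bA : (W →₀ ℝ) →₀ ℝ), 0 ≤ e → 0 ≤ bI → 0 ≤ bA →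
        e + ev bI + ev bA = a → Val K l2 z s q e.support bI.support bA.support →
        ∃ w : W →₀ ℝ, 0 ≤ w ∧ w.support ∈ refine K l2 z s q ∧ ev w = ev a := by
      intro e bI bA he hI hA hea hV
      exact ⟨e + bI.mapDomain ev + bA.mapDomain ev, add_nonneg (add_nonneg he
        (mapDomain_nonneg _ hI)) (mapDomain_nonneg _ hA), ⟨_, _, _, hV,
        combine_support subset_rfl subset_rfl subset_rfl⟩, by rw [ev_combine, hea]⟩
    by_cases hex : ∃ c, Zc K z c ∧ c.support ⊆ a.support
    · obtain ⟨c, hc, hca⟩ := hex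
      obtain ⟨γ, v₀, k₁, k₂, J, hd⟩ := h.exists_zdata hz hz1 hz2 hc (hcard c hc).1 (hcard c hc).2
      have ht₂pos : 0 < t₂ := by
        have hv₀ : v₀ ∈ a.support :=
          hca (Finsupp.mem_support_iff.2 ((hd.γ_ne v₀).1 hd.data.pos.ne'))
        have h3 : ms (fun v => l2 v ≤ 0) a + a v₀ ≤ tot a := by
          have := ms_split (p := fun v => l2 v ≤ 0) (q := fun v => ¬ l2 v ≤ 0) (r := fun _ => True)
            (a := a) (fun v _ => by simp [le_or_gt]) (fun v _ h h' => h' h)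
          have h4 := apply_le_ms ha (p := fun v => ¬ l2 v ≤ 0) hd.data.v₀b
          linarith
        have h4 : 0 < a v₀ := lt_of_le_of_ne (ha v₀) (Ne.symm (Finsupp.mem_support_iff.1 hv₀))
        have h5 : 0 < (q : ℝ) * t₂ := by rw [← hl2, e2]; linarith
        exact pos_of_mul_pos_right h5 hq'.le
      obtain ⟨e, bI, bA, he, hI, hA, hea, hcom, hcell⟩ :=
        cell_exists hd.data ha hy1 ht₂pos h1 htot
      obtain ⟨hsub, hkey⟩ := hmem e bI bA he hI hA hea hcom
      refine done e bI bA he hI hA hea ⟨hsub, hcom, fun u hu => ⟨c, hc, fun v hv => ?_⟩, ?_⟩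
      · have h6 := hcell.γ_le hd.data hcom hu v
        have h7 := (hd.γ_ne v).2 (Finsupp.mem_support_iff.1 hv)
        have h8 := hd.data.nonneg v
        simp only [Finsupp.coe_zero, Pi.zero_apply] at h8
        have := lt_of_le_of_ne h8 (Ne.symm h7)
        rw [Finsupp.mem_support_iff]
        linarith
      · intro c' γ' v₀' k₁' k₂' J' hd' hs
        have hcc : c = c' := h.tri.inj haK hca
          (fun v hv => hkey v (hs v (Finsupp.mem_support_iff.1 hv))) (by rw [hc.ev, hd'.zc.ev])
        subst hcc
        obtain ⟨rfl, rfl, rfl⟩ := hd.eq hd'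
        exact hcell
    · obtain ⟨e, bA, he, hA, hea, hcom⟩ := plain_exists h.low ha hy1 ht₂0 h1 htot
      have hea' : e + ev (0 : (W →₀ ℝ) →₀ ℝ) + ev bA = a := by rw [map_zero, add_zero, hea]
      have hcom' : Common (fun v => l2 v ≤ 0) s q (e.support : Set W)
          ((0 : (W →₀ ℝ) →₀ ℝ).support : Set (W →₀ ℝ)) (bA.support : Set (W →₀ ℝ)) := by
        simpa using hcom
      obtain ⟨hsub, hkey⟩ := hmem e 0 bA he le_rfl hA hea' hcom'
      refine done e 0 bA he le_rfl hA hea' ⟨hsub, hcom', fun u hu => by simp at hu, ?_⟩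
      intro c γ v₀ k₁ k₂ J hd hs
      exact absurd ⟨c, hd.zc, fun v hv => hkey v (hs v (Finsupp.mem_support_iff.1 hv))⟩ hex
  mem := by
    intro w hw hS
    have hq' : (0 : ℝ) < q := by exact_mod_cast hq
    obtain ⟨e, bI, bA, he, hI, hA, hV, rfl⟩ := exists_val_of_mem_refine hS hw
    obtain ⟨Δ, hΔ, hs⟩ := hV.combine_subset subset_rfl subset_rfl subset_rfl
    rw [ev_combine]
    refine ⟨h.tri.mem_of_subset hΔ (hV.nonneg he hI hA) hs, ?_⟩
    obtain ⟨e1, e2⟩ := h.l_ev hΔ hs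
    obtain ⟨m1, m2⟩ := hV.com.masses subset_rfl subset_rfl subset_rfl
    rw [LinearMap.sub_apply, LinearMap.smul_apply, smul_eq_mul, e1, e2, m2, m1]
    have : tot e + s * (tot bI + tot bA) - (s : ℝ) / q * (tot e + (s + q) * (tot bI + tot bA) -
        (tot e + s * (tot bI + tot bA))) = tot e := by field_simp; ring
    rw [this]
    exact ms_nonneg _ he
  uniq := by
    intro w w' hw hw' hS hS' heq
    obtain ⟨e, bI, bA, he, hI, hA, hV, rfl⟩ := exists_val_of_mem_refine hS hw
    obtain ⟨e', bI', bA', he', hI', hA', hV', rfl⟩ := exists_val_of_mem_refine hS' hw'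
    obtain ⟨Δ, hΔ, hs⟩ := hV.combine_subset subset_rfl subset_rfl subset_rfl
    obtain ⟨Δ', hΔ', hs'⟩ := hV'.combine_subset subset_rfl subset_rfl subset_rfl
    rw [ev_combine, ev_combine] at heq
    have haa := h.tri.uniq _ _ (hV.nonneg he hI hA) (hV'.nonneg he' hI' hA')
      (h.tri.down _ hΔ _ hs) (h.tri.down _ hΔ' _ hs') heq
    by_cases hex : ∃ c, Zc K z c ∧ c.support ⊆ (e + ev bI + ev bA).support
    · obtain ⟨c, hc, hca⟩ := hex
      obtain ⟨γ, v₀, k₁, k₂, J, hd⟩ := h.exists_zdata hz hz1 hz2 hc (hcard c hc).1 (hcard c hc).2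
      have hcell := hV.cell c γ v₀ k₁ k₂ J hd (fun v hv => combine_apply_ne subset_rfl subset_rfl
        subset_rfl (Finsupp.mem_support_iff.1 (hca (Finsupp.mem_support_iff.2 hv))))
      rw [haa] at hca
      have hcell' := hV'.cell c γ v₀ k₁ k₂ J hd (fun v hv => combine_apply_ne subset_rfl subset_rfl
        subset_rfl (Finsupp.mem_support_iff.1 (hca (Finsupp.mem_support_iff.2 hv))))
      obtain ⟨rfl, rfl, rfl⟩ := cell_unique hd.data he hI hA he' hI' hA' hV.com hcell hV'.com hcell'
        haa
      rfl
    · have h0 := hV.I_eq_zero he hI hA hex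
      rw [haa] at hex
      have h0' := hV'.I_eq_zero he' hI' hA' hex
      subst h0 h0'
      rw [map_zero, add_zero, add_zero] at haa
      obtain ⟨rfl, rfl⟩ := plain_unique hq he he' hA hA' hV.com hV'.com haa
      rfl

end Refine

section Refine
variable {W : Type*} [AddCommGroup W] [Module ℝ W]

/-- The sublattice of `Λ` where `l` is a multiple of `q`. -/
noncomputable def latDiv (Λ : AddSubgroup W) (l : W →ₗ[ℝ] ℝ) (q : ℕ) : AddSubgroup W :=
  Λ ⊓ ZZ.toAddSubgroup.comap (((1 : ℝ) / q) • l).toAddMonoidHom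

theorem mem_latDiv {Λ : AddSubgroup W} {l : W →ₗ[ℝ] ℝ} {q : ℕ} {y : W} :
    y ∈ latDiv Λ l q ↔ y ∈ Λ ∧ (((1 : ℝ) / q) • l) y ∈ ZZ := Iff.rfl

variable [LinearOrder W] {U : Submodule ℝ W} {Λ : AddSubgroup W} {C : Set W}
    {K : Set (Finset W)} {l1 l2 : W →ₗ[ℝ] ℝ} {z : W} {s q : ℕ}

theorem St.ev_mem_lat (h : St U Λ C K l1 l2) {Δ : Finset W} (hΔ : Δ ∈ K) {a : W →₀ ℝ}
    (ha : a.support ⊆ Δ) (hz : ∀ v, a v ∈ ZZ) : ev a ∈ Λ :=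
  ev_mem_of_ZZ (fun v hv => (h.vert Δ hΔ v (ha hv)).1) hz

theorem St.refine_vert (h : St U Λ C K l1 l2) (hz : z ∈ Λ) (hz1 : l1 z = 0) (hz2 : l2 z = 0)
    (hcard : ∀ c, Zc K z c → c.support.card ≤ s ∧ c.support.card ≤ q)
    {E : Finset W} {I A : Finset (W →₀ ℝ)} (hV : Val K l2 z s q E I A) :
    (∀ v ∈ E, v ∈ Λ ∧ l1 v = 1 ∧ l2 v = 0) ∧
    (∀ u ∈ I, ev u ∈ Λ ∧ l1 (ev u) = s ∧ l2 (ev u) = q) ∧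
    ∀ u ∈ A, ev u ∈ Λ ∧ l1 (ev u) = s ∧ l2 (ev u) = q := by
  obtain ⟨Δ, hΔ, h1, h2, h3⟩ := hV.sub
  refine ⟨fun v hv => ?_, fun u hu => ⟨?_, ?_⟩, fun u hu => ⟨?_, ?_⟩⟩
  · obtain ⟨e1, e2⟩ := h.vert Δ hΔ v (h1 hv)
    refine ⟨e1, e2.resolve_right (fun h => ?_)⟩
    have := hV.com.eb v hv
    linarith
  · obtain ⟨c, hc, hcu⟩ := hV.special u hu
    obtain ⟨γ, v₀, k₁, k₂, J, hd⟩ := h.exists_zdata hz hz1 hz2 hc (hcard c hc).1 (hcard c hc).2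
    have hV' := hV.mono (Finset.empty_subset E) (Finset.singleton_subset_iff.2 hu)
      (Finset.empty_subset A)
    have hcell := hV'.cell c γ v₀ k₁ k₂ J hd (fun v hv => Or.inr (Or.inl
      ⟨u, Finset.mem_singleton_self u, Finsupp.mem_support_iff.1
        (hcu (Finsupp.mem_support_iff.2 hv))⟩))
    have := h.ev_mem_lat hΔ (a := u - c) (support_sub_subset (h2 u hu) (hcu.trans (h2 u hu)))
      (fun v => by
        have := sub_mem (hcell.intI u (by simp) v) (hd.sub_mem v)
        rw [Finsupp.sub_apply]
        convert this using 1
        ring)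
    rw [map_sub, hc.ev] at this
    simpa using add_mem this hz
  · obtain ⟨e1, e2⟩ := h.l_ev hΔ (h2 u hu)
    obtain ⟨-, m1, m2⟩ := hV.com.nnI u hu
    rw [e1, e2, m2, m1]
    exact ⟨rfl, by ring⟩
  · exact h.ev_mem_lat hΔ (h3 u hu) (hV.com.intA u hu)
  · obtain ⟨e1, e2⟩ := h.l_ev hΔ (h3 u hu)
    obtain ⟨-, m1, m2⟩ := hV.com.nnA u hu
    rw [e1, e2, m2, m1]
    exact ⟨rfl, by ring⟩

theorem St.refine_st (h : St U Λ C K l1 l2) (hz : z ∈ Λ) (hz1 : l1 z = 0) (hz2 : l2 z = 0)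
    (hq : 0 < q) (hcard : ∀ c, Zc K z c → c.support.card ≤ s ∧ c.support.card ≤ q) :
    St U (latDiv Λ l2 q) {y | y ∈ C ∧ 0 ≤ (l1 - ((s : ℝ) / q) • l2) y}
      (refine K l2 z s q) (l1 - ((s : ℝ) / q) • l2) (((1 : ℝ) / q) • l2) := by
  have hq' : (0 : ℝ) < q := by exact_mod_cast hq
  have htri := h.refine_tri hz hz1 hz2 hq hcard
  have hl2 : ∀ y, (((1 : ℝ) / q) • l2) y = l2 y / q := fun y => by
    rw [LinearMap.smul_apply, smul_eq_mul]; ring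
  have hl1 : ∀ y, (l1 - ((s : ℝ) / q) • l2) y = l1 y - s * (l2 y / q) := fun y => by
    rw [LinearMap.sub_apply, LinearMap.smul_apply, smul_eq_mul]; ring
  have hE : ∀ v, l1 v = 1 → l2 v = 0 →
      (l1 - ((s : ℝ) / q) • l2) v = 1 ∧ (((1 : ℝ) / q) • l2) v = 0 := fun v h1 h2 => by
    rw [hl1, hl2, h1, h2]; simp
  have hA : ∀ v, l1 v = s → l2 v = q →
      (l1 - ((s : ℝ) / q) • l2) v = 0 ∧ (((1 : ℝ) / q) • l2) v = 1 := fun v h1 h2 => by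
    rw [hl1, hl2, h1, h2, div_self hq'.ne']; simp
  refine ⟨htri, ⟨⟨h.cone.zero, by simp⟩, ?_, ?_⟩, ?_, ?_, ?_, ?_, ?_, ?_⟩
  · rintro x ⟨hx, hx1⟩ y ⟨hy, hy1⟩
    exact ⟨h.cone.add x hx y hy, by rw [map_add]; exact add_nonneg hx1 hy1⟩
  · rintro x ⟨hx, hx1⟩ t ht
    exact ⟨h.cone.smul x hx t ht, by rw [map_smul]; exact mul_nonneg ht hx1⟩
  · rintro S ⟨E, I, A, hV, hS⟩ v hv
    obtain ⟨v1, v2, v3⟩ := h.refine_vert hz hz1 hz2 hcard hV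
    rw [mem_latDiv]
    rcases hS hv with (hv | ⟨u, hu, rfl⟩) | ⟨u, hu, rfl⟩
    · obtain ⟨e1, e2, e3⟩ := v1 v hv
      obtain ⟨f1, f2⟩ := hE v e2 e3
      exact ⟨⟨e1, by rw [f2]; exact zero_mem _⟩, Or.inl ⟨f1, f2⟩⟩
    · obtain ⟨e1, e2, e3⟩ := v2 u hu
      obtain ⟨f1, f2⟩ := hA _ e2 e3
      exact ⟨⟨e1, by rw [f2]; exact one_mem _⟩, Or.inr ⟨f1, f2⟩⟩
    · obtain ⟨e1, e2, e3⟩ := v3 u hu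
      obtain ⟨f1, f2⟩ := hA _ e2 e3
      exact ⟨⟨e1, by rw [f2]; exact one_mem _⟩, Or.inr ⟨f1, f2⟩⟩
  · exact fun y hy => h.lat y hy.1
  · intro y hy
    refine ⟨?_, hy.2⟩
    have h2 := hy.2
    change (((1 : ℝ) / q) • l2) y ∈ ZZ at h2
    rw [hl2] at h2
    rw [hl1]
    exact sub_mem (h.int y hy.1).1 (mul_mem (natCast_mem_ZZ s) h2)
  · rintro S ⟨E, I, A, hV, hS⟩ hS0 β hβ hβΛ
    obtain ⟨v1, v2, v3⟩ := h.refine_vert hz hz1 hz2 hcard hV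
    obtain ⟨Δ, hΔ, h1, -⟩ := hV.sub
    have hSE : S ⊆ E := by
      intro v hv
      have h0 := hS0 v hv
      rcases hS hv with (hv | ⟨u, hu, rfl⟩) | ⟨u, hu, rfl⟩
      · exact hv
      · obtain ⟨e1, e2, e3⟩ := v2 u hu
        rw [(hA _ e2 e3).2] at h0
        exact absurd h0 one_ne_zero
      · obtain ⟨e1, e2, e3⟩ := v3 u hu
        rw [(hA _ e2 e3).2] at h0
        exact absurd h0 one_ne_zero
    exact h.uni S (h.tri.down Δ hΔ _ (hSE.trans h1)) (fun v hv => (v1 v (hSE hv)).2.2) β hβ hβΛ.1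
  · intro r
    refine (h.fin ((s + q + 1) * r)).subset ?_
    rintro y ⟨hy, ⟨hyC, hy1⟩, hr⟩
    refine ⟨hy.1, hyC, ?_⟩
    have n2 : 0 ≤ l2 y / q := div_nonneg (h.l_nonneg hyC).2 hq'.le
    rw [hl1] at hy1
    rw [hl1, hl2] at hr
    have e : l2 y = q * (l2 y / q) := by field_simp
    have hsq : (0 : ℝ) ≤ s + q := by positivity
    have := mul_le_mul_of_nonneg_left hr (show (0 : ℝ) ≤ s + q + 1 by linarith)
    have h3 := mul_nonneg hsq hy1
    have e2 : l1 y + l2 y = (l1 y - s * (l2 y / q)) + (s + q) * (l2 y / q) := by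
      rw [add_mul, ← e]; ring
    rw [e2]
    refine le_trans ?_ this
    nlinarith
  · intro u v huv
    apply h.ord
    rw [hl2, hl2] at huv
    exact (div_lt_div_iff_of_pos_right hq').1 huv

theorem St.reorder (h : St U Λ C K l1 l2) (o' : LinearOrder W)
    (ho' : ∀ u v, l2 u < l2 v → o'.lt u v) : @St W _ _ o' U Λ C K l1 l2 := by
  obtain ⟨h1, h2, h3, h4, h5, h6, h7, -⟩ := h
  exact ⟨h1, h2, h3, h4, h5, h6, h7, ho'⟩

theorem exists_order {V : Type*} [o : LinearOrder V] (l κ : V → ℝ) : ∃ o' : LinearOrder V,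
    (∀ u v, l u < l v → o'.lt u v) ∧ (∀ u v, l u = l v → κ u < κ v → o'.lt u v) ∧
    ∀ u v, l u = l v → κ u = κ v → o.lt u v → o'.lt u v := by
  let f : V → ℝ ×ₗ ℝ ×ₗ V := fun v => toLex (l v, toLex (κ v, v))
  have hf : Function.Injective f := by
    intro u v huv
    have h1 : (l u, toLex (κ u, u)) = (l v, toLex (κ v, v)) := toLex.injective huv
    have h2 := congrArg Prod.snd h1
    exact congrArg Prod.snd (toLex.injective h2)
  refine ⟨LinearOrder.lift' f hf, fun u v huv => ?_, fun u v h1 h2 => ?_, fun u v h1 h2 h3 => ?_⟩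
  · change f u < f v
    exact Prod.Lex.toLex_lt_toLex.2 (Or.inl huv)
  · change f u < f v
    exact Prod.Lex.toLex_lt_toLex.2 (Or.inr ⟨h1, Prod.Lex.toLex_lt_toLex.2 (Or.inl h2)⟩)
  · change f u < f v
    exact Prod.Lex.toLex_lt_toLex.2
      (Or.inr ⟨h1, Prod.Lex.toLex_lt_toLex.2 (Or.inr ⟨h2, h3⟩)⟩)

/-- The data of a full-dimensional simplex of the refined triangulation. -/
structure FullVal (U : Submodule ℝ W) (K : Set (Finset W)) (l2 : W →ₗ[ℝ] ℝ) (z : W) (s q : ℕ)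
    (S Δ E : Finset W) (I A : Finset (W →₀ ℝ)) : Prop where
  val : Val K l2 z s q E I A
  eq : (S : Set W) = ↑E ∪ ev '' (I : Set (W →₀ ℝ)) ∪ ev '' (A : Set (W →₀ ℝ))
  mem : Δ ∈ K
  subE : E ⊆ Δ
  subI : ∀ u ∈ I, u.support ⊆ Δ
  subA : ∀ u ∈ A, u.support ⊆ Δ
  full : Full U Δ
  used : ∀ v ∈ Δ, v ∈ E ∨ (∃ u ∈ I, u v ≠ 0) ∨ ∃ u ∈ A, u v ≠ 0
  lift : ∀ y ∈ U, ∃ (e : W →₀ ℝ) (bI bA : (W →₀ ℝ) →₀ ℝ), e.support ⊆ E ∧ bI.support ⊆ I ∧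
    bA.support ⊆ A ∧ ev (e + ev bI + ev bA) = y

theorem FullVal.combine_support {S Δ E : Finset W} {I A : Finset (W →₀ ℝ)}
    (hv : FullVal U K l2 z s q S Δ E I A) {e : W →₀ ℝ} {bI bA : (W →₀ ℝ) →₀ ℝ}
    (he : e.support ⊆ E) (hI : bI.support ⊆ I) (hA : bA.support ⊆ A) :
    (e + ev bI + ev bA).support ⊆ Δ := by
  intro v hv'
  rcases combine_apply_ne he hI hA (Finsupp.mem_support_iff.1 hv') with h | ⟨u, hu, h⟩ | ⟨u, hu, h⟩
  · exact hv.subE h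
  · exact hv.subI u hu (Finsupp.mem_support_iff.2 h)
  · exact hv.subA u hu (Finsupp.mem_support_iff.2 h)

theorem St.exists_fullVal (h : St U Λ C K l1 l2) {S : Finset W} (hS : S ∈ refine K l2 z s q)
    (hF : Full U S) : ∃ Δ E I A, FullVal U K l2 z s q S Δ E I A := by
  obtain ⟨E, I, A, hV, hSe⟩ := exists_eq_of_mem_refine hS
  obtain ⟨Δ, hΔ, h1, h2, h3⟩ := hV.sub
  have hlift : ∀ y ∈ U, ∃ (e : W →₀ ℝ) (bI bA : (W →₀ ℝ) →₀ ℝ), e.support ⊆ E ∧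
      bI.support ⊆ I ∧ bA.support ⊆ A ∧ ev (e + ev bI + ev bA) = y := by
    intro y hy
    obtain ⟨β, hβ, rfl⟩ := mem_span_iff_ev.1 (hF hy)
    obtain ⟨e, bI, bA, he, hI, hA, rfl, -⟩ := exists_lift β
      ((Finset.coe_subset.2 hβ).trans hSe.subset)
    exact ⟨e, bI, bA, he, hI, hA, (ev_combine _ _ _).symm⟩
  have hsub : ∀ (e : W →₀ ℝ) (bI bA : (W →₀ ℝ) →₀ ℝ), e.support ⊆ E →
      bI.support ⊆ I → bA.support ⊆ A → (e + ev bI + ev bA).support ⊆ Δ := by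
    intro e bI bA he hI hA v hv
    rcases combine_apply_ne he hI hA (Finsupp.mem_support_iff.1 hv) with h | ⟨u, hu, h⟩ | ⟨u, hu, h⟩
    · exact h1 h
    · exact h2 u hu (Finsupp.mem_support_iff.2 h)
    · exact h3 u hu (Finsupp.mem_support_iff.2 h)
  refine ⟨Δ, E, I, A, hV, hSe, hΔ, h1, h2, h3, fun y hy => ?_, fun v hv => ?_, hlift⟩
  · obtain ⟨e, bI, bA, he, hI, hA, rfl⟩ := hlift y hy
    exact mem_span_iff_ev.2 ⟨_, hsub e bI bA he hI hA, rfl⟩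
  · obtain ⟨e, bI, bA, he, hI, hA, hev⟩ := hlift v (h.lat v (h.vert Δ hΔ v hv).1)
    have := h.tri.inj hΔ (hsub e bI bA he hI hA)
      (Finsupp.support_single_subset.trans (Finset.singleton_subset_iff.2 hv))
      (β' := Finsupp.single v 1) (by rw [hev, ev_single, one_smul])
    exact combine_apply_ne he hI hA (v := v) (by rw [this]; simp)

end Refine

section Index
variable {W : Type*} [AddCommGroup W] [Module ℝ W]

/-- Among any `n + 1` elements of `Λ` two are congruent modulo the group generated by `S`. -/
def PP (S : Finset W) (Λ : AddSubgroup W) (n : ℕ) : Prop :=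
  ∀ y : Fin (n + 1) → W, (∀ i, y i ∈ Λ) →
    ∃ i j, i ≠ j ∧ y i - y j ∈ AddSubgroup.closure (S : Set W)

variable [LinearOrder W] {U : Submodule ℝ W} {Λ : AddSubgroup W} {C : Set W}
    {K : Set (Finset W)} {l1 l2 : W →ₗ[ℝ] ℝ} {z : W} {s q : ℕ}
    {S Δ E : Finset W} {I A : Finset (W →₀ ℝ)}

theorem FullVal.mem_closure (hv : FullVal U K l2 z s q S Δ E I A) {e : W →₀ ℝ}
    {bI bA : (W →₀ ℝ) →₀ ℝ} (he : e.support ⊆ E) (hI : bI.support ⊆ I) (hA : bA.support ⊆ A)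
    (ze : ∀ v, e v ∈ ZZ) (zI : ∀ v, bI v ∈ ZZ) (zA : ∀ v, bA v ∈ ZZ) :
    ev (e + ev bI + ev bA) ∈ AddSubgroup.closure (S : Set W) := by
  have hSe : ∀ x ∈ (E : Set W) ∪ ev '' (I : Set (W →₀ ℝ)) ∪ ev '' (A : Set (W →₀ ℝ)),
      x ∈ AddSubgroup.closure (S : Set W) := by
    intro x hx
    rw [← hv.eq] at hx
    exact AddSubgroup.subset_closure hx
  have hcomap : ∀ (b : (W →₀ ℝ) →₀ ℝ), (∀ u, b u ∈ ZZ) →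
      (∀ u ∈ b.support, ev u ∈ AddSubgroup.closure (S : Set W)) →
      ev (ev b) ∈ AddSubgroup.closure (S : Set W) := by
    intro b hb hbu
    exact ev_mem_of_ZZ (G := (AddSubgroup.closure (S : Set W)).comap
      (ev : (W →₀ ℝ) →ₗ[ℝ] W).toAddMonoidHom) hbu hb
  rw [map_add, map_add]
  refine add_mem (add_mem (ev_mem_of_ZZ (fun v hve => hSe v (Or.inl (Or.inl (he hve)))) ze)
    (hcomap bI zI (fun u hu => hSe _ (Or.inl (Or.inr ⟨u, hI hu, rfl⟩)))))
    (hcomap bA zA (fun u hu => hSe _ (Or.inr ⟨u, hA hu, rfl⟩)))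

theorem FullVal.l_eq (hv : FullVal U K l2 z s q S Δ E I A) (h : St U Λ C K l1 l2) (hq : 0 < q)
    {e : W →₀ ℝ} {bI bA : (W →₀ ℝ) →₀ ℝ} (he : e.support ⊆ E) (hI : bI.support ⊆ I)
    (hA : bA.support ⊆ A) :
    (((1 : ℝ) / q) • l2) (ev (e + ev bI + ev bA)) = tot bI + tot bA ∧
      (l1 - ((s : ℝ) / q) • l2) (ev (e + ev bI + ev bA)) = tot e := by
  have hq' : (0 : ℝ) < q := by exact_mod_cast hq
  obtain ⟨e1, e2⟩ := h.l_ev hv.mem (hv.combine_support he hI hA)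
  obtain ⟨m1, m2⟩ := hv.val.com.masses (e := e) (bI := bI) (bA := bA)
    (Finset.coe_subset.2 he) (Finset.coe_subset.2 hI) (Finset.coe_subset.2 hA)
  rw [LinearMap.sub_apply, LinearMap.smul_apply, smul_eq_mul, e1, e2, m2, m1]
  constructor
  · field_simp
    ring
  · rw [LinearMap.smul_apply, smul_eq_mul, e2, m2, m1]
    field_simp
    ring

theorem FullVal.int_of_mem (hv : FullVal U K l2 z s q S Δ E I A) (h : St U Λ C K l1 l2)
    {a : W →₀ ℝ} (ha : a.support ⊆ Δ) (hm : ev a ∈ AddSubgroup.closure (Δ : Set W)) (v : W) :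
    a v ∈ ZZ := by
  obtain ⟨b, hb, hbz, hbe⟩ := mem_closure_iff_ev.1 hm
  rw [← h.tri.inj hv.mem hb ha hbe]
  exact hbz v

theorem FullVal.I_empty (hv : FullVal U K l2 z s q S Δ E I A)
    (hno : ¬ ∃ c, Zc K z c ∧ c.support ⊆ Δ) : I = ∅ := by
  rw [Finset.eq_empty_iff_forall_notMem]
  intro u hu
  obtain ⟨c, hc, hcu⟩ := hv.val.special u hu
  exact hno ⟨c, hc, hcu.trans (hv.subI u hu)⟩

theorem FullVal.PP_of_not (hv : FullVal U K l2 z s q S Δ E I A) (h : St U Λ C K l1 l2)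
    (hq : 0 < q) (hno : ¬ ∃ c, Zc K z c ∧ c.support ⊆ Δ) {n : ℕ} (hP : PP Δ Λ n) :
    PP S (latDiv Λ l2 q) n := by
  intro y hy
  obtain ⟨i, j, hij, hm⟩ := hP y (fun i => (hy i).1)
  refine ⟨i, j, hij, ?_⟩
  have hI0 := hv.I_empty hno
  obtain ⟨e, bI, bA, he, hI, hA, heq⟩ := hv.lift (y i - y j)
    (U.sub_mem (h.lat _ (hy i).1) (h.lat _ (hy j).1))
  have hbI : bI = 0 := by
    rw [hI0, Finset.subset_empty, Finsupp.support_eq_empty] at hI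
    exact hI
  have hΛ : y i - y j ∈ latDiv Λ l2 q := sub_mem (hy i) (hy j)
  have hl := (hv.l_eq h hq he hI hA).1
  have hz := hv.int_of_mem h (hv.combine_support he hI hA) (by rwa [heq])
  rw [heq, hbI, map_zero, zero_add] at hl
  have := plain_ZZ (e := e) (bA := bA) hv.val.com (Finset.coe_subset.2 he) hA (hl ▸ hΛ.2)
    (by simpa [hbI] using hz)
  rw [← heq]
  exact hv.mem_closure he hI hA this.1 (by rw [hbI]; exact fun v => zero_mem _) this.2

theorem FullVal.PP_of_zc (hv : FullVal U K l2 z s q S Δ E I A) (h : St U Λ C K l1 l2)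
    (hz : z ∈ Λ) (hz1 : l1 z = 0) (hz2 : l2 z = 0) (hq : 0 < q)
    (hcard : ∀ c, Zc K z c → c.support.card ≤ s ∧ c.support.card ≤ q)
    {c : W →₀ ℝ} (hc : Zc K z c) (hcΔ : c.support ⊆ Δ) {n : ℕ} (hP : PP Δ Λ (n + 1)) :
    PP S (latDiv Λ l2 q) n := by
  classical
  obtain ⟨γ, v₀, k₁, k₂, J, hd⟩ := h.exists_zdata hz hz1 hz2 hc (hcard c hc).1 (hcard c hc).2
  have hcell := hv.val.cell c γ v₀ k₁ k₂ J hd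
    (fun v hv' => hv.used v (hcΔ (Finsupp.mem_support_iff.2 hv')))
  obtain ⟨H, δ, hδ0, hδ1, hH, hHZ, hHc, x, hx, hHx⟩ := cell_index hd.data hv.val.com hcell
  have hxΔ : x ∈ Δ := hcΔ (Finsupp.mem_support_iff.2 ((hd.γ_ne x).1 hx))
  have hH' : ∀ (e : W →₀ ℝ) (bI bA : (W →₀ ℝ) →₀ ℝ), e.support ⊆ E → bI.support ⊆ I →
      bA.support ⊆ A → H (e + ev bI + ev bA) = δ * tot bI := fun e bI bA he hI hA =>
    hH e bI bA (Finset.coe_subset.2 he) (Finset.coe_subset.2 hI) (Finset.coe_subset.2 hA)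
  obtain ⟨u₀, hu₀⟩ : I.Nonempty := by
    obtain ⟨e, bI, bA, he, hI, hA, heq⟩ := hv.lift x (h.lat x (h.vert Δ hv.mem x hxΔ).1)
    have h1 := h.tri.inj hv.mem (hv.combine_support he hI hA)
      (Finsupp.support_single_subset.trans (Finset.singleton_subset_iff.2 hxΔ))
      (β' := Finsupp.single x 1) (by rw [heq, ev_single, one_smul])
    rw [← h1, hH' e bI bA he hI hA] at hHx
    by_contra hcon
    rw [Finset.not_nonempty_iff_eq_empty] at hcon
    rw [hcon, Finset.subset_empty, Finsupp.support_eq_empty] at hI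
    rw [hI, map_zero, mul_zero] at hHx
    exact hHx rfl
  have hu₀Λ : ev u₀ ∈ latDiv Λ l2 q := by
    obtain ⟨e1, e2, e3⟩ := (h.refine_vert hz hz1 hz2 hcard hv.val).2.1 u₀ hu₀
    refine mem_latDiv.2 ⟨e1, ?_⟩
    rw [LinearMap.smul_apply, smul_eq_mul, e3, one_div_mul_cancel (by exact_mod_cast hq.ne')]
    exact one_mem _
  have hu₀S : ev u₀ ∈ AddSubgroup.closure (S : Set W) := by
    apply AddSubgroup.subset_closure
    rw [hv.eq]
    exact Or.inl (Or.inr ⟨u₀, hu₀, rfl⟩)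
  have hnorm : ∀ y ∈ latDiv Λ l2 q, ∃ (y' : W) (e : W →₀ ℝ) (bI bA : (W →₀ ℝ) →₀ ℝ),
      y - y' ∈ AddSubgroup.closure (S : Set W) ∧ y' ∈ latDiv Λ l2 q ∧ e.support ⊆ E ∧
      bI.support ⊆ I ∧ bA.support ⊆ A ∧ ev (e + ev bI + ev bA) = y' ∧ 0 ≤ tot bI ∧ tot bI < 1 := by
    intro y hy
    obtain ⟨e, bI, bA, he, hI, hA, heq⟩ := hv.lift y (h.lat y hy.1)
    refine ⟨y - ⌊tot bI⌋ • ev u₀, e, bI - Finsupp.single u₀ (⌊tot bI⌋ : ℝ), bA, ?_, ?_, he,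
      support_sub_subset hI (Finsupp.support_single_subset.trans
        (Finset.singleton_subset_iff.2 hu₀)), hA, ?_, ?_, ?_⟩
    · rw [sub_sub_cancel]
      exact zsmul_mem hu₀S _
    · exact sub_mem hy (zsmul_mem hu₀Λ _)
    · rw [← heq, map_sub, ev_single, ← Int.cast_smul_eq_zsmul ℝ]
      simp only [map_add, map_sub, map_smul]
      abel
    · rw [map_sub, ms_single _ _ _ trivial]
      exact sub_nonneg.2 (Int.floor_le _)
    · rw [map_sub, ms_single _ _ _ trivial]
      linarith [Int.lt_floor_add_one (tot bI)]
  intro y hy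
  choose y' e bI bA h1 h2 he hI hA heq h0 h3 using fun i => hnorm (y i) (hy i)
  have key : ∀ i, ¬ z - y' i ∈ AddSubgroup.closure (Δ : Set W) := by
    intro i hm
    have ha := hv.combine_support (he i) (hI i) (hA i)
    have hzz := hv.int_of_mem h (a := c - (e i + ev (bI i) + ev (bA i)))
      (support_sub_subset hcΔ ha) (by rwa [map_sub, hc.ev, heq])
    have hl := h.l_ev hv.mem (support_sub_subset hcΔ ha)
    have g1 := hHZ _ hzz (by
      rw [← hl.2, map_sub, hc.ev, heq, map_sub, hz2, zero_sub, neg_div]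
      apply neg_mem
      have := (h2 i).2
      change (((1 : ℝ) / q) • l2) (y' i) ∈ ZZ at this
      rw [LinearMap.smul_apply, smul_eq_mul] at this
      convert this using 1
      ring)
    have g2 := hHc c hd.sub_mem (by rw [← (h.l_ev hv.mem hcΔ).2, hc.ev, hz2])
    rw [map_sub, hH' _ _ _ (he i) (hI i) (hA i)] at g1
    have g3 : δ * (1 - tot (bI i)) ∈ ZZ := by
      convert sub_mem g1 g2 using 1
      ring
    have p1 : 0 < δ * (1 - tot (bI i)) := mul_pos hδ0 (by linarith [h3 i])
    have p2 : δ * (1 - tot (bI i)) < 1 := by nlinarith [h0 i, h3 i]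
    exact p1.ne' (ZZ_eq_zero g3 (by linarith) p2)
  obtain ⟨i, j, hij, hm⟩ := hP (Fin.cons z y') (fun i => by
    refine Fin.cases ?_ (fun i => ?_) i
    · simpa using hz
    · simpa using (h2 i).1)
  induction i using Fin.cases with
  | zero =>
    induction j using Fin.cases with
    | zero => exact absurd rfl hij
    | succ j =>
      simp only [Fin.cons_zero, Fin.cons_succ] at hm
      exact absurd hm (key j)
  | succ i =>
    induction j using Fin.cases with
    | zero =>
      simp only [Fin.cons_zero, Fin.cons_succ] at hm
      exact absurd (by simpa using neg_mem hm) (key i)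
    | succ j =>
      simp only [Fin.cons_succ] at hm
      refine ⟨i, j, fun hc => hij (by rw [hc]), ?_⟩
      have ee := support_sub_subset (he i) (he j)
      have eI := support_sub_subset (hI i) (hI j)
      have eA := support_sub_subset (hA i) (hA j)
      have heq' : ev (e i - e j + ev (bI i - bI j) + ev (bA i - bA j)) = y' i - y' j := by
        rw [← heq i, ← heq j]
        simp only [map_add, map_sub]
        abel
      have ha := hv.combine_support ee eI eA
      have hzz := hv.int_of_mem h ha (by rwa [heq'])
      have hΛ : y' i - y' j ∈ latDiv Λ l2 q := sub_mem (h2 i) (h2 j)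
      have hl := h.l_ev hv.mem ha
      have hlZ := (mem_latDiv.1 hΛ).2
      have g1 := hHZ _ hzz (by
        rw [← hl.2, heq']
        rw [LinearMap.smul_apply, smul_eq_mul] at hlZ
        convert hlZ using 1
        ring)
      rw [hH' _ _ _ ee eI eA, map_sub] at g1
      have p1 : -1 < δ * (tot (bI i) - tot (bI j)) := by
        nlinarith [h0 i, h0 j, h3 i, h3 j]
      have p2 : δ * (tot (bI i) - tot (bI j)) < 1 := by
        nlinarith [h0 i, h0 j, h3 i, h3 j]
      have g2 := ZZ_eq_zero g1 p1 p2
      have g3 : tot (bI i - bI j) = 0 := by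
        rw [map_sub]
        exact (mul_eq_zero.1 g2).resolve_left hδ0.ne'
      have g4 := (hv.l_eq h hq ee eI eA).1
      rw [g3, zero_add, heq'] at g4
      have := cell_ZZ (e := e i - e j) hd.data hv.val.com hcell (Finset.coe_subset.2 ee) eI eA g3
        (by rw [← g4]; exact hlZ) hzz
      have g5 := hv.mem_closure ee eI eA this.1 this.2.1 this.2.2
      rw [heq'] at g5
      have : y i - y j = (y i - y' i) + (y' i - y' j) - (y j - y' j) := by abel
      rw [this]
      exact sub_mem (add_mem (h1 i) g5) (h1 j)

end Index

theorem ms_mapDomain {ι κ : Type*} (f : ι → κ) (p : κ → Prop) (w : ι →₀ ℝ) :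
    ms p (w.mapDomain f) = ms (fun v => p (f v)) w := by
  induction w using Finsupp.induction_linear with
  | zero => simp
  | add a b ha hb => rw [Finsupp.mapDomain_add, map_add, map_add, ha, hb]
  | single v c =>
    rw [Finsupp.mapDomain_single]
    by_cases h : p (f v)
    · rw [ms_single p (f v) c h, ms_single (fun v => p (f v)) v c h]
    · rw [ms_single_not p (f v) c h, ms_single_not (fun v => p (f v)) v c h]

theorem pre_ext_on {ι : Type*} [LinearOrder ι] {a b : ι →₀ ℝ} {V : Finset ι} (ha : a.support ⊆ V)
    (hb : b.support ⊆ V) (h : ∀ x ∈ V, pre x a = pre x b) : a = b := by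
  classical
  refine pre_ext (fun x => ?_)
  by_cases hne : (V.filter (· ≤ x)).Nonempty
  · have hm := Finset.max'_mem _ hne
    set m := (V.filter (· ≤ x)).max' hne with hmd
    obtain ⟨hmV, hmx⟩ := Finset.mem_filter.1 hm
    have key : ∀ c : ι →₀ ℝ, c.support ⊆ V → pre x c = pre m c := fun c hc =>
      ms_congr (fun v hv => ⟨fun hvx => Finset.le_max' _ _ (Finset.mem_filter.2 ⟨hc hv, hvx⟩),
        fun hvm => hvm.trans hmx⟩)
    rw [key a ha, key b hb, h m hmV]
  · rw [Finset.not_nonempty_iff_eq_empty] at hne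
    have key : ∀ c : ι →₀ ℝ, c.support ⊆ V → pre x c = 0 := fun c hc =>
      ms_zero_of (fun v hv hvx => by
        have : v ∈ V.filter (· ≤ x) := Finset.mem_filter.2 ⟨hc hv, hvx⟩
        rw [hne] at this
        simp at this)
    rw [key a ha, key b hb]

/-- The sum of the partial sums of `u` over `V`, for the order `o`. -/
noncomputable def preSum {ι : Type*} (o : LinearOrder ι) (V : Finset ι) (u : ι →₀ ℝ) : ℝ := ∑ x ∈ V, pre x u

section Index
variable {W : Type*} [AddCommGroup W] [Module ℝ W]

/-- `z` has a representation by `Δ` all of whose partial sums lie in `(-1, 0]`. -/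
def Good [LinearOrder W] (Λ : AddSubgroup W) (l1 l2 : W →ₗ[ℝ] ℝ) (z : W) (Δ : Finset W) : Prop :=
  z ∈ Λ ∧ l1 z = 0 ∧ l2 z = 0 ∧ z ≠ 0 ∧
    ∃ c : W →₀ ℝ, c.support ⊆ Δ ∧ ev c = z ∧ ∀ x, -1 < pre x c ∧ pre x c ≤ 0

variable [o : LinearOrder W] {U : Submodule ℝ W} {Λ : AddSubgroup W} {C : Set W}
    {K : Set (Finset W)} {l1 l2 : W →ₗ[ℝ] ℝ} {z : W} {s q : ℕ}
    {S Δ E : Finset W} {I A : Finset (W →₀ ℝ)}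

theorem St.exists_order (h : St U Λ C K l1 l2) (q : ℕ) (hq : 0 < q) :
    ∃ (o' : LinearOrder W) (V : Finset W), (∀ S ∈ K, S ⊆ V) ∧ (∀ u v, l2 u < l2 v → o'.lt u v) ∧
      (∀ u v, l2 u = 0 → l2 v = 0 → o.lt u v → o'.lt u v) ∧
      ∀ u v : W →₀ ℝ, 0 ≤ u → 0 ≤ v → u.support ∈ K → v.support ∈ K → l2 (ev u) = q →
        l2 (ev v) = q → preSum o V v < preSum o V u → o'.lt (ev u) (ev v) := by
  classical
  let V : Finset W := h.finite.toFinset.biUnion id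
  have hKV : ∀ S ∈ K, S ⊆ V := fun S hS v hv =>
    Finset.mem_biUnion.2 ⟨S, h.finite.mem_toFinset.2 hS, hv⟩
  have hcoord : ∀ y : W, ∃ a : W →₀ ℝ, ∀ b : W →₀ ℝ, 0 ≤ b → b.support ∈ K → ev b = y → a = b := by
    intro y
    by_cases hy : ∃ b : W →₀ ℝ, 0 ≤ b ∧ b.support ∈ K ∧ ev b = y
    · obtain ⟨b, hb, hbK, rfl⟩ := hy
      exact ⟨b, fun b' hb' hbK' he => h.tri.uniq _ _ hb hb' hbK hbK' he.symm⟩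
    · exact ⟨0, fun b hb hbK he => absurd ⟨b, hb, hbK, he⟩ hy⟩
  choose a ha using hcoord
  obtain ⟨o', h1, h2, h3⟩ := ConeTri.exists_order (fun v => l2 v)
    (fun y => if l2 y = 0 then 0 else - preSum o V (a y))
  have hq' : (q : ℝ) ≠ 0 := by exact_mod_cast hq.ne'
  refine ⟨o', V, hKV, h1,
    fun u v hu hv huv => h3 u v (by rw [hu, hv]) (by simp [hu, hv]) huv,
    fun u v hu hv huK hvK eu evq hlt => h2 _ _ (by rw [eu, evq]) ?_⟩
  simp only [eu, evq, hq', if_false]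
  rw [ha _ u hu huK rfl, ha _ v hv hvK rfl]
  linarith

theorem FullVal.exists_good_rep (hv : FullVal U K l2 z s q S Δ E I A) (h : St U Λ C K l1 l2)
    (hz : z ∈ Λ) (hz1 : l1 z = 0) (hz2 : l2 z = 0) (hq : 0 < q)
    (hcard : ∀ c, Zc K z c → c.support.card ≤ s ∧ c.support.card ≤ q)
    (hno : ¬ ∃ c, Zc K z c ∧ c.support ⊆ Δ) {z' : W} (hg : Good Λ l1 l2 z' Δ)
    {le' : W → W → Prop} (le_rfl' : ∀ u, le' u u) (htr : ∀ u v w, le' u v → le' v w → le' u w)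
    (lt_le : ∀ u v, ¬ le' v u → le' u v) (V : Finset W) (hKV : ∀ S ∈ K, S ⊆ V)
    (ho1 : ∀ u v, l2 u < l2 v → ¬ le' v u)
    (ho2 : ∀ u v, l2 u = 0 → l2 v = 0 → u < v → ¬ le' v u)
    (ho3 : ∀ u v : W →₀ ℝ, 0 ≤ u → 0 ≤ v → u.support ∈ K → v.support ∈ K → l2 (ev u) = q →
        l2 (ev v) = q → preSum o V v < preSum o V u → ¬ le' (ev v) (ev u)) :
    ∃ w : W →₀ ℝ, w.support ⊆ S ∧ ev w = z' ∧
      ∀ x, -1 < ms (fun v => le' v x) w ∧ ms (fun v => le' v x) w ≤ 0 := by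
  classical
  obtain ⟨hzΛ, hz1', hz2', hz0, c, hcΔ, hcz, hcx⟩ := hg
  have hl1' : (l1 - ((s : ℝ) / q) • l2) z' = 0 := by
    rw [LinearMap.sub_apply, LinearMap.smul_apply, hz1', hz2']; simp
  have hl2' : (((1 : ℝ) / q) • l2) z' = 0 := by
    rw [LinearMap.smul_apply, hz2']; simp
  have hq' : (0 : ℝ) < q := by exact_mod_cast hq
  obtain ⟨e, bI, bA, he, hI, hA, heq⟩ := hv.lift z' (h.lat _ hzΛ)
  have hI0 := hv.I_empty hno
  have hbI : bI = 0 := by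
    rw [hI0, Finset.subset_empty, Finsupp.support_eq_empty] at hI
    exact hI
  subst hbI
  obtain ⟨t1, t2⟩ := hv.l_eq h hq he hI hA
  rw [heq, hl2', map_zero, zero_add] at t1
  rw [heq, hl1'] at t2
  have hce : c = e + ev bA := by
    have := h.tri.inj hv.mem hcΔ (hv.combine_support he hI hA) (by rw [heq, hcz])
    rw [this, map_zero, add_zero]
  have hEl : ∀ v ∈ E, l2 v = 0 := fun v hvE =>
    ((h.refine_vert hz hz1 hz2 hcard hv.val).1 v hvE).2.2
  have hAl : ∀ u ∈ A, l2 (ev u) = q := fun u hu =>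
    ((h.refine_vert hz hz1 hz2 hcard hv.val).2.2 u hu).2.2
  -- letters of vectors in `A` come after the elements of `E`
  have hafter : ∀ v ∈ E, ∀ u ∈ A, ∀ v', u v' ≠ 0 → v ≤ v' := by
    intro v hvE u hu v' hv'
    by_cases hb : l2 v' ≤ 0
    · exact hv.val.com.ea v hvE u hu v' hb hv'
    · exact (h.ord v v' (by rw [hEl v hvE]; exact not_le.1 hb)).le
  refine ⟨e + bA.mapDomain ev, ?_, ?_, fun x => ?_⟩
  · have := ConeTri.combine_support (e := e) (bI := 0) (Finset.coe_subset.2 he) (I := (I : Set (W →₀ ℝ)))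
      (by simp) (Finset.coe_subset.2 hA)
    rw [← hv.eq, Finset.coe_subset] at this
    simpa using this
  · rw [← heq, ← ev_combine]
    simp
  have hval : ms (fun v => le' v x) (e + bA.mapDomain ev) =
      ms (fun v => le' v x) e + ms (fun u => le' (ev u) x) bA := by
    rw [map_add]
    congr 1
    exact ms_mapDomain ev (fun v => le' v x) bA
  rw [hval]
  suffices hs : (ms (fun v => le' v x) e + ms (fun u => le' (ev u) x) bA = 0) ∨
      ∃ x₀, ms (fun v => le' v x) e + ms (fun u => le' (ev u) x) bA = pre x₀ c by
    rcases hs with hs | ⟨x₀, hs⟩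
    · rw [hs]; norm_num
    · rw [hs]; exact hcx x₀
  have hE0 : 0 < l2 x → ms (fun v => le' v x) e = 0 := fun hx => by
    rw [ms_eq_tot (fun v hve => lt_le _ _ (ho1 _ _ (by rw [hEl v (he hve)]; exact hx))), ← t2]
  have hA0 : l2 x < q → ms (fun u => le' (ev u) x) bA = 0 := fun hx =>
    ms_zero_of (fun u hu => (ho1 _ _ (by rw [hAl u (hA hu)]; exact hx)))
  rcases lt_trichotomy (l2 x) 0 with hx | hx | hx
  · left
    rw [hA0 (by linarith), ms_zero_of (fun v hve => (ho1 _ _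
      (by rw [hEl v (he hve)]; exact hx))), add_zero]
  · rw [hA0 (by linarith)]
    have hpe : ms (fun v => le' v x) e = pre x e := by
      refine ms_congr (fun v hve => ⟨fun hvx => ?_, fun hvx => ?_⟩)
      · by_contra hcon
        exact ho2 x v hx (hEl v (he hve)) (not_le.1 hcon) hvx
      · rcases hvx.lt_or_eq with h1 | h1
        · exact lt_le _ _ (ho2 v x (hEl v (he hve)) hx h1)
        · rw [h1]; exact le_rfl' x
    rw [hpe, add_zero]
    by_cases hall : ∀ v ∈ E, v ≤ x
    · left
      rw [pre, ms_eq_tot (fun v hve => hall v (he hve)), ← t2]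
    · right
      push Not at hall
      obtain ⟨v, hvE, hvx⟩ := hall
      refine ⟨x, ?_⟩
      have : pre x (ev bA) = 0 := ms_zero_of (fun v' hv' hle => by
        obtain ⟨u, hu, huv⟩ := ev_apply_ne (Finsupp.mem_support_iff.1 hv')
        exact absurd (hafter v hvE u (hA hu) v' huv) (not_le.2 (hle.trans_lt hvx)))
      rw [hce, map_add, this, add_zero]
  · rw [hE0 hx, zero_add]
    rcases lt_trichotomy (l2 x) q with hxq | hxq | hxq
    · left
      exact hA0 hxq
    · by_cases hF : (A.filter (fun u => le' (ev u) x)).Nonempty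
      · by_cases hG : (A.filter (fun u => ¬ le' (ev u) x)).Nonempty
        · right
          have hsub : ∀ u ∈ A, u.support ∈ K := fun u hu =>
            h.tri.down Δ hv.mem _ (hv.subA u hu)
          obtain ⟨x₀, hx₀⟩ := Chain.cut (S := A.filter (fun u => le' (ev u) x))
            (T := A.filter (fun u => ¬ le' (ev u) x))
            (hv.val.com.chA.mono (Finset.coe_subset.2 (Finset.filter_subset _ _)))
            (hv.val.com.chA.mono (Finset.coe_subset.2 (Finset.filter_subset _ _))) hF hG (by
              intro u hu u' hu'
              obtain ⟨huA, hux⟩ := Finset.mem_filter.1 hu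
              obtain ⟨huA', hux'⟩ := Finset.mem_filter.1 hu'
              have hne : u ≠ u' := fun heq => hux' (heq ▸ hux)
              refine ⟨?_, hne⟩
              rcases hv.val.com.chA u huA u' huA' with hr | hr
              · exact hr
              exfalso
              have hle : ∀ y, pre y u ≤ pre y u' := fun y => by
                rcases hr y with h | h <;> linarith
              have hlt : preSum o V u < preSum o V u' := by
                apply Finset.sum_lt_sum (fun y _ => hle y)
                by_contra hcon
                push Not at hcon
                exact hne (pre_ext_on (hKV _ (hsub u huA)) (hKV _ (hsub u' huA'))
                  (fun y hy => le_antisymm (hle y) (hcon y hy)))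
              have := ho3 u' u (hv.val.com.nnA u' huA').1 (hv.val.com.nnA u huA).1
                (hsub u' huA') (hsub u huA) (hAl u' huA') (hAl u huA) hlt
              exact hux' (htr _ _ _ (lt_le _ _ this) hux))
          refine ⟨x₀, ?_⟩
          obtain ⟨u₁, hu₁⟩ := hF
          obtain ⟨u₂, hu₂⟩ := hG
          have hpe : pre x₀ e = 0 := by
            rw [pre, ms_eq_tot (fun v hve => ?_), ← t2]
            have hpos : pre x₀ u₁ ≠ 0 := by
              have g1 := hx₀ u₁ hu₁ u₂ hu₂
              have g2 := ms_nonneg (fun v => v ≤ x₀)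
                (hv.val.com.nnA u₂ (Finset.mem_filter.1 hu₂).1).1
              have g3 : 0 ≤ pre x₀ u₂ := g2
              intro g4
              linarith
            have : ∃ v' ∈ u₁.support, v' ≤ x₀ := by
              by_contra hcon
              push Not at hcon
              exact hpos (ms_zero_of (fun v' hv' => not_le.2 (hcon v' hv')))
            obtain ⟨v', hv', hvx⟩ := this
            exact (hafter v (he hve) u₁ (Finset.mem_filter.1 hu₁).1 v'
              (Finsupp.mem_support_iff.1 hv')).trans hvx
          have hpA : ∀ u ∈ A, bA u * pre x₀ u = bA u * pre x₀ u₂ +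
              if le' (ev u) x then bA u else 0 := by
            intro u hu
            split_ifs with hc
            · have := hx₀ u (Finset.mem_filter.2 ⟨hu, hc⟩) u₂ hu₂
              have : pre x₀ u = pre x₀ u₂ + 1 := by linarith
              rw [this]; ring
            · have g1 := hx₀ u₁ hu₁ u (Finset.mem_filter.2 ⟨hu, hc⟩)
              have g2 := hx₀ u₁ hu₁ u₂ hu₂
              have : pre x₀ u = pre x₀ u₂ := by linarith
              rw [this]; ring
          rw [hce, map_add, hpe, zero_add, ms_ev _ bA hA]
          change _ = ∑ u ∈ A, bA u * pre x₀ u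
          rw [Finset.sum_congr rfl hpA, Finset.sum_add_distrib, ← Finset.sum_mul,
            ← tot_eq_sum bA hA, ← t1, zero_mul, zero_add, ms_eq_sum _ bA hA, Finset.sum_filter]
        · left
          rw [Finset.not_nonempty_iff_eq_empty, Finset.filter_eq_empty_iff] at hG
          rw [ms_eq_tot (fun u hu => not_not.1 (hG (hA hu))), ← t1]
      · left
        rw [Finset.not_nonempty_iff_eq_empty, Finset.filter_eq_empty_iff] at hF
        exact ms_zero_of (fun u hu => hF (hA hu))
    · left
      rw [ms_eq_tot (fun u hu => lt_le _ _ (ho1 _ _ (by rw [hAl u (hA hu)]; exact hxq))), ← t1]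

end Index

section Reorder
variable {W : Type*} [AddCommGroup W] [Module ℝ W] {o' : LinearOrder W} [o : LinearOrder W]
variable {U : Submodule ℝ W} {Λ : AddSubgroup W} {C : Set W}
    {K : Set (Finset W)} {l1 l2 : W →ₗ[ℝ] ℝ} {z : W} {s q : ℕ}
    {S Δ E : Finset W} {I A : Finset (W →₀ ℝ)}

theorem FullVal.good (hv : FullVal U K l2 z s q S Δ E I A) (h : St U Λ C K l1 l2)
    (hz : z ∈ Λ) (hz1 : l1 z = 0) (hz2 : l2 z = 0) (hq : 0 < q)
    (hcard : ∀ c, Zc K z c → c.support.card ≤ s ∧ c.support.card ≤ q)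
    (hno : ¬ ∃ c, Zc K z c ∧ c.support ⊆ Δ) {z' : W} (hg : Good Λ l1 l2 z' Δ)
    (V : Finset W) (hKV : ∀ S ∈ K, S ⊆ V)
    (ho1 : ∀ u v, l2 u < l2 v → o'.lt u v)
    (ho2 : ∀ u v, l2 u = 0 → l2 v = 0 → o.lt u v → o'.lt u v)
    (ho3 : ∀ u v : W →₀ ℝ, 0 ≤ u → 0 ≤ v → u.support ∈ K → v.support ∈ K → l2 (ev u) = q →
        l2 (ev v) = q → preSum o V v < preSum o V u → o'.lt (ev u) (ev v)) :
    @Good W _ _ o' (latDiv Λ l2 q) (l1 - ((s : ℝ) / q) • l2) (((1 : ℝ) / q) • l2) z' S := by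
  have lt_nle : ∀ u v, o'.lt u v → ¬ o'.le v u := fun u v huv => (@not_le W o' v u).2 huv
  obtain ⟨w, hw⟩ := hv.exists_good_rep (o := o) h hz hz1 hz2 hq hcard hno hg (le' := o'.le)
    (fun u => @le_refl W o'.toPreorder u) (fun u v w => @le_trans W o'.toPreorder u v w)
    (fun u v huv => @le_of_not_ge W o' v u huv) V hKV
    (fun u v huv => lt_nle _ _ (ho1 u v huv)) (fun u v h1 h2 h3 => lt_nle _ _ (ho2 u v h1 h2 h3))
    (fun u v h1 h2 h3 h4 h5 h6 h7 => lt_nle _ _ (ho3 u v h1 h2 h3 h4 h5 h6 h7))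
  obtain ⟨hzΛ, hz1', hz2', hz0, -⟩ := hg
  have hl2' : (((1 : ℝ) / q) • l2) z' = 0 := by
    rw [LinearMap.smul_apply, hz2']; simp
  refine ⟨mem_latDiv.2 ⟨hzΛ, by rw [hl2']; exact zero_mem _⟩, ?_, hl2', hz0, w, hw⟩
  rw [LinearMap.sub_apply, LinearMap.smul_apply, hz1', hz2']; simp

theorem St.stage_aux (h : St U Λ C K l1 l2) (hz : z ∈ Λ) (hz1 : l1 z = 0) (hz2 : l2 z = 0)
    (hq : 0 < q) (hcard : ∀ c, Zc K z c → c.support.card ≤ s ∧ c.support.card ≤ q)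
    (V : Finset W) (hKV : ∀ S ∈ K, S ⊆ V)
    (ho1 : ∀ u v, l2 u < l2 v → o'.lt u v)
    (ho2 : ∀ u v, l2 u = 0 → l2 v = 0 → o.lt u v → o'.lt u v)
    (ho3 : ∀ u v : W →₀ ℝ, 0 ≤ u → 0 ≤ v → u.support ∈ K → v.support ∈ K → l2 (ev u) = q →
        l2 (ev v) = q → preSum o V v < preSum o V u → o'.lt (ev u) (ev v)) :
    ∃ (K' : Set (Finset W)),
      @St W _ _ o' U (latDiv Λ l2 q) {y | y ∈ C ∧ 0 ≤ (l1 - ((s : ℝ) / q) • l2) y} K'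
        (l1 - ((s : ℝ) / q) • l2) (((1 : ℝ) / q) • l2) ∧
      ∀ S ∈ K', Full U S → ∃ Δ ∈ K, Full U Δ ∧
        ((∃ c, Zc K z c ∧ c.support ⊆ Δ) → ∀ n, PP Δ Λ (n + 1) → PP S (latDiv Λ l2 q) n) ∧
        ((¬ ∃ c, Zc K z c ∧ c.support ⊆ Δ) → (∀ n, PP Δ Λ n → PP S (latDiv Λ l2 q) n) ∧
          ∀ z', Good Λ l1 l2 z' Δ → @Good W _ _ o' (latDiv Λ l2 q) (l1 - ((s : ℝ) / q) • l2)
            (((1 : ℝ) / q) • l2) z' S) := by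
  refine ⟨refine K l2 z s q, (h.refine_st hz hz1 hz2 hq hcard).reorder o' (fun u v huv => ?_),
    fun S hS hF => ?_⟩
  · have hq' : (0 : ℝ) < q := by exact_mod_cast hq
    apply ho1
    rw [LinearMap.smul_apply, LinearMap.smul_apply, smul_eq_mul, smul_eq_mul] at huv
    exact lt_of_mul_lt_mul_left huv (by positivity)
  · obtain ⟨Δ, E, I, A, hv⟩ := h.exists_fullVal hS hF
    refine ⟨Δ, hv.mem, hv.full, ?_, fun hno => ⟨fun n => hv.PP_of_not h hq hno, fun z' hg =>
      hv.good h hz hz1 hz2 hq hcard hno hg V hKV ho1 ho2 ho3⟩⟩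
    rintro ⟨c, hc, hcΔ⟩ n
    exact hv.PP_of_zc h hz hz1 hz2 hq hcard hc hcΔ

end Reorder

section Index
variable {W : Type*} [AddCommGroup W] [Module ℝ W] [o : LinearOrder W]
variable {U : Submodule ℝ W} {Λ : AddSubgroup W} {C : Set W}
    {K : Set (Finset W)} {l1 l2 : W →ₗ[ℝ] ℝ} {z : W} {s q : ℕ}
    {S Δ E : Finset W} {I A : Finset (W →₀ ℝ)}

/-- One step of the refinement procedure. -/
theorem St.stage (h : St U Λ C K l1 l2) (hz : z ∈ Λ) (hz1 : l1 z = 0) (hz2 : l2 z = 0)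
    (hq : 0 < q) (hcard : ∀ c, Zc K z c → c.support.card ≤ s ∧ c.support.card ≤ q) :
    ∃ (o' : LinearOrder W) (K' : Set (Finset W)),
      @St W _ _ o' U (latDiv Λ l2 q) {y | y ∈ C ∧ 0 ≤ (l1 - ((s : ℝ) / q) • l2) y} K'
        (l1 - ((s : ℝ) / q) • l2) (((1 : ℝ) / q) • l2) ∧
      ∀ S ∈ K', Full U S → ∃ Δ ∈ K, Full U Δ ∧
        ((∃ c, Zc K z c ∧ c.support ⊆ Δ) → ∀ n, PP Δ Λ (n + 1) → PP S (latDiv Λ l2 q) n) ∧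
        ((¬ ∃ c, Zc K z c ∧ c.support ⊆ Δ) → (∀ n, PP Δ Λ n → PP S (latDiv Λ l2 q) n) ∧
          ∀ z', @Good W _ _ o Λ l1 l2 z' Δ → @Good W _ _ o' (latDiv Λ l2 q) (l1 - ((s : ℝ) / q) • l2)
            (((1 : ℝ) / q) • l2) z' S) := by
  obtain ⟨o', V, hKV, ho1, ho2, ho3⟩ := h.exists_order q hq
  exact ⟨o', @St.stage_aux W _ _ o' o U Λ C K l1 l2 z s q h hz hz1 hz2 hq hcard V hKV ho1 ho2 ho3⟩

end Index

section Good
variable {W : Type*} [AddCommGroup W]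

theorem PP.mono {S : Finset W} {Λ : AddSubgroup W} {n m : ℕ} (h : PP S Λ n) (hnm : n ≤ m) :
    PP S Λ m := by
  intro y hy
  obtain ⟨i, j, hij, hm⟩ := h (fun i => y (Fin.castLE (by omega) i)) (fun i => hy _)
  exact ⟨_, _, fun he => hij (Fin.castLE_injective _ he), hm⟩

theorem PP.one {S : Finset W} {Λ : AddSubgroup W} (h : PP S Λ 1) {y : W} (hy : y ∈ Λ) :
    y ∈ AddSubgroup.closure (S : Set W) := by
  obtain ⟨i, j, hij, hm⟩ := h ![y, 0] (fun i => by fin_cases i <;> simp [hy, zero_mem])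
  fin_cases i <;> fin_cases j <;> simp at hij hm <;> exact hm

theorem PP_of_le {S : Finset W} {Λ : AddSubgroup W}
    (h : ∀ y ∈ Λ, y ∈ AddSubgroup.closure (S : Set W)) : PP S Λ 1 :=
  fun y hy => ⟨0, 1, by simp, sub_mem (h _ (hy 0)) (h _ (hy 1))⟩

variable [Module ℝ W] [LinearOrder W] {U : Submodule ℝ W} {Λ : AddSubgroup W} {C : Set W}
    {K : Set (Finset W)} {l1 l2 : W →ₗ[ℝ] ℝ} {z : W} {S Δ : Finset W}

theorem Good.exists_zc (h : St U Λ C K l1 l2) (hΔ : Δ ∈ K) (hg : Good Λ l1 l2 z Δ) :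
    ∃ c, Zc K z c ∧ c.support ⊆ Δ := by
  classical
  obtain ⟨-, -, -, hz, c, hc, hcz, hx⟩ := hg
  refine ⟨c, ⟨?_, fun v => ?_, hcz, h.tri.down Δ hΔ _ hc⟩, hc⟩
  · rintro rfl
    exact hz (by rw [← hcz, map_zero])
  · have h1 := pre_eq_lt_add v c
    have h2 : -1 < ms (fun u => u < v) c ∧ ms (fun u => u < v) c ≤ 0 := by
      rcases (low_lt v).cases c.support with h | ⟨v', -, -, h⟩
      · rw [h c subset_rfl]; norm_num
      · rw [h c subset_rfl]; exact hx v'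
    have h3 := hx v
    rw [abs_lt]
    constructor <;> linarith

theorem St.exists_good (h : St U Λ C K l1 l2) (hΔ : Δ ∈ K) (hF : Full U Δ) {y : W} (hy : y ∈ Λ)
    (hyΔ : y ∉ AddSubgroup.closure (Δ : Set W)) : ∃ z, Good Λ l1 l2 z Δ := by
  obtain ⟨β, hβ, rfl⟩ := mem_span_iff_ev.1 (hF (h.lat y hy))
  set c := tr (fun p : ℝ => p - ⌈p⌉) β with hcd
  have hc : c.support ⊆ Δ := (tr_support _ _).trans hβ
  have hms : ∀ {p : W → Prop}, Low p → ms p c = ms p β - ⌈ms p β⌉ := fun hp => by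
    rw [hcd, ms_tr hp]; simp
  have hint : ∀ v, (β - c) v ∈ ZZ := by
    intro v
    have e1 := pre_eq_lt_add v β
    have : (β - c) v = (⌈pre v β⌉ : ℝ) - ⌈ms (fun u => u < v) β⌉ := by
      rw [Finsupp.sub_apply, hcd, tr_apply]
      linarith
    rw [this]
    exact sub_mem (intCast_mem_ZZ _) (intCast_mem_ZZ _)
  have hsub : (β - c).support ⊆ Δ := support_sub_subset hβ hc
  have heq : ev c = ev β - ev (β - c) := by rw [map_sub]; abel
  have hceil : ∀ x ∈ ZZ, x - (⌈x⌉ : ℝ) = 0 := by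
    rintro _ ⟨n, rfl⟩
    simp
  obtain ⟨e1, e2⟩ := h.l_ev hΔ hβ
  obtain ⟨i1, i2⟩ := h.int _ hy
  obtain ⟨c1, c2⟩ := h.l_ev hΔ hc
  have hm1 : ms (fun v => l2 v ≤ 0) c = 0 := by
    rw [hms h.low]
    exact hceil _ (e1 ▸ i1)
  have hm2 : tot c = 0 := by
    rw [hms low_true]
    refine hceil _ ?_
    have : tot β = l1 (ev β) + l2 (ev β) := by rw [e1, e2]; ring
    rw [this]
    exact add_mem i1 i2
  refine ⟨ev c, ?_, by rw [c1, hm1], by rw [c2, hm1, hm2, sub_zero], fun h0 => hyΔ ?_, c, hc, rfl,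
    fun x => ?_⟩
  · rw [heq]
    exact sub_mem hy (h.ev_mem_lat hΔ hsub hint)
  · rw [mem_closure_iff_ev]
    refine ⟨β - c, hsub, hint, ?_⟩
    rw [map_sub, h0, sub_zero]
  · rw [pre, hms (low_le x)]
    constructor
    · linarith [Int.ceil_lt_add_one (ms (fun v => v ≤ x) β)]
    · linarith [Int.le_ceil (ms (fun v => v ≤ x) β)]

theorem St.exists_PP_of_mem (h : St U Λ C K l1 l2) (hS : S ∈ K) (hF : Full U S) :
    ∃ n, PP S Λ n := by
  classical
  have hfin := h.fin S.card
  have hfr : ∀ y ∈ Λ, ∃ y' ∈ hfin.toFinset, y - y' ∈ AddSubgroup.closure (S : Set W) := by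
    intro y hy
    obtain ⟨β, hβ, rfl⟩ := mem_span_iff_ev.1 (hF (h.lat y hy))
    let c : W →₀ ℝ := β.mapRange Int.fract (by simp)
    have hc : c.support ⊆ S := Finsupp.support_mapRange.trans hβ
    have hcv : ∀ v, c v = Int.fract (β v) := fun v => Finsupp.mapRange_apply
    have hm : ev β - ev c ∈ AddSubgroup.closure (S : Set W) := by
      rw [← map_sub, mem_closure_iff_ev]
      refine ⟨β - c, support_sub_subset hβ hc, fun v => ?_, rfl⟩
      rw [Finsupp.sub_apply, hcv, Int.self_sub_fract]
      exact intCast_mem_ZZ _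
    refine ⟨ev c, ?_, hm⟩
    rw [Set.Finite.mem_toFinset]
    refine ⟨?_, h.tri.mem_of_subset hS (fun v => by rw [hcv]; exact Int.fract_nonneg _) hc, ?_⟩
    · have : ev β - ev c ∈ Λ :=
        (AddSubgroup.closure_le Λ).2 (fun v hv => (h.vert S hS v hv).1) hm
      have := sub_mem hy this
      rwa [sub_sub_cancel] at this
    · obtain ⟨e1, e2⟩ := h.l_ev hS hc
      rw [e1, e2, add_sub_cancel, tot_eq_sum c hc, ← nsmul_one, ← Finset.sum_const]
      exact Finset.sum_le_sum (fun v _ => by rw [hcv]; exact (Int.fract_lt_one _).le)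
  refine ⟨hfin.toFinset.card, fun y hy => ?_⟩
  choose f hf hfc using fun i => hfr (y i) (hy i)
  obtain ⟨i, -, j, -, hij, he⟩ := Finset.exists_ne_map_eq_of_card_lt_of_maps_to
    (s := Finset.univ) (t := hfin.toFinset) (f := f) (by simp) (fun i _ => hf i)
  refine ⟨i, j, hij, ?_⟩
  have := sub_mem (hfc i) (hfc j)
  rwa [he, sub_sub_sub_cancel_right] at this

theorem St.exists_PP (h : St U Λ C K l1 l2) : ∃ n, ∀ S ∈ K, Full U S → PP S Λ n := by
  classical
  have : ∀ S : Finset W, ∃ n, S ∈ K → Full U S → PP S Λ n := fun S => by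
    by_cases hS : S ∈ K ∧ Full U S
    · obtain ⟨n, hn⟩ := h.exists_PP_of_mem hS.1 hS.2
      exact ⟨n, fun _ _ => hn⟩
    · exact ⟨0, fun h1 h2 => absurd ⟨h1, h2⟩ hS⟩
  choose f hf using this
  refine ⟨h.finite.toFinset.sup f, fun S hS hF => (hf S hS hF).mono ?_⟩
  exact Finset.le_sup (h.finite.mem_toFinset.2 hS)

end Good

section Run
variable {W : Type*} [AddCommGroup W] [Module ℝ W] {U : Submodule ℝ W} {Λ : AddSubgroup W}
    {C : Set W} {K : Set (Finset W)} {l1 l2 : W →ₗ[ℝ] ℝ} {s q s' q' : ℕ}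

/-- The state reached from the data `U Λ C l1 l2` with the parameters `s` and `q`. -/
def StAt (o : LinearOrder W) (U : Submodule ℝ W) (Λ : AddSubgroup W) (C : Set W)
    (l1 l2 : W →ₗ[ℝ] ℝ) (s q : ℕ) (K : Set (Finset W)) : Prop :=
  @St W _ _ o U (latDiv Λ l2 q) {y | y ∈ C ∧ 0 ≤ (l1 - ((s : ℝ) / q) • l2) y} K
    (l1 - ((s : ℝ) / q) • l2) (((1 : ℝ) / q) • l2)

theorem one_div_smul_smul (hq : 0 < q) (hq' : 0 < q') :
    ((1 : ℝ) / q') • ((1 : ℝ) / q) • l2 = ((1 : ℝ) / (q * q' : ℕ)) • l2 := by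
  have h1 : (q : ℝ) ≠ 0 := by exact_mod_cast hq.ne'
  have h2 : (q' : ℝ) ≠ 0 := by exact_mod_cast hq'.ne'
  rw [smul_smul]
  congr 1
  push_cast
  field_simp

theorem sub_smul_sub_smul (hq : 0 < q) (hq' : 0 < q') :
    l1 - ((s : ℝ) / q) • l2 - ((s' : ℝ) / q') • ((1 : ℝ) / q) • l2 =
      l1 - (((s * q' + s' : ℕ) : ℝ) / (q * q' : ℕ)) • l2 := by
  have h1 : (q : ℝ) ≠ 0 := by exact_mod_cast hq.ne'
  have h2 : (q' : ℝ) ≠ 0 := by exact_mod_cast hq'.ne'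
  rw [smul_smul, sub_sub, ← add_smul]
  congr 2
  push_cast
  field_simp

theorem latDiv_latDiv (hq : 0 < q) (hq' : 0 < q') :
    latDiv (latDiv Λ l2 q) (((1 : ℝ) / q) • l2) q' = latDiv Λ l2 (q * q') := by
  have h2 : (q' : ℝ) ≠ 0 := by exact_mod_cast hq'.ne'
  ext y
  rw [mem_latDiv, mem_latDiv, mem_latDiv, one_div_smul_smul hq hq']
  refine ⟨fun h => ⟨h.1.1, h.2⟩, fun h => ⟨⟨h.1, ?_⟩, h.2⟩⟩
  have : (((1 : ℝ) / q) • l2) y = q' * ((((1 : ℝ) / (q * q' : ℕ)) • l2) y) := by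
    rw [← one_div_smul_smul hq hq', LinearMap.smul_apply (1 / (q' : ℝ)), smul_eq_mul]
    field_simp
  rw [this]
  exact mul_mem (natCast_mem_ZZ _) h.2

theorem sep_sep_cone (hC : ∀ y ∈ C, 0 ≤ l2 y) (hq : 0 < q) (hq' : 0 < q') :
    {y | y ∈ {y | y ∈ C ∧ 0 ≤ (l1 - ((s : ℝ) / q) • l2) y} ∧
      0 ≤ (l1 - ((s : ℝ) / q) • l2 - ((s' : ℝ) / q') • ((1 : ℝ) / q) • l2) y} =
    {y | y ∈ C ∧ 0 ≤ (l1 - (((s * q' + s' : ℕ) : ℝ) / (q * q' : ℕ)) • l2) y} := by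
  rw [sub_smul_sub_smul hq hq']
  ext y
  simp only [Set.mem_ofPred_eq]
  refine ⟨fun h => ⟨h.1.1, h.2⟩, fun h => ⟨⟨h.1, ?_⟩, h.2⟩⟩
  have h1 := h.2
  rw [← sub_smul_sub_smul hq hq', LinearMap.sub_apply _ (_ • _), LinearMap.smul_apply,
    LinearMap.smul_apply, smul_eq_mul, smul_eq_mul] at h1
  have h2 : 0 ≤ (s' : ℝ) / q' * (1 / q * l2 y) :=
    mul_nonneg (by positivity) (mul_nonneg (by positivity) (hC y h.1))
  linarith

theorem StAt.stage {o : LinearOrder W} (h : StAt o U Λ C l1 l2 s q K) (hC : ∀ y ∈ C, 0 ≤ l2 y)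
    (hq : 0 < q) (hq' : 0 < q') {z : W} (hz : z ∈ latDiv Λ l2 q)
    (hz1 : (l1 - ((s : ℝ) / q) • l2) z = 0) (hz2 : (((1 : ℝ) / q) • l2) z = 0)
    (hcard : ∀ c, Zc K z c → c.support.card ≤ s' ∧ c.support.card ≤ q') :
    ∃ (o' : LinearOrder W) (K' : Set (Finset W)),
      StAt o' U Λ C l1 l2 (s * q' + s') (q * q') K' ∧
      ∀ S ∈ K', Full U S → ∃ Δ ∈ K, Full U Δ ∧
        ((∃ c, Zc K z c ∧ c.support ⊆ Δ) → ∀ n, PP Δ (latDiv Λ l2 q) (n + 1) →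
          PP S (latDiv Λ l2 (q * q')) n) ∧
        ((¬ ∃ c, Zc K z c ∧ c.support ⊆ Δ) →
          (∀ n, PP Δ (latDiv Λ l2 q) n → PP S (latDiv Λ l2 (q * q')) n) ∧
          ∀ z', @Good W _ _ o (latDiv Λ l2 q) (l1 - ((s : ℝ) / q) • l2) (((1 : ℝ) / q) • l2) z' Δ →
            @Good W _ _ o' (latDiv Λ l2 (q * q'))
              (l1 - (((s * q' + s' : ℕ) : ℝ) / (q * q' : ℕ)) • l2)
              (((1 : ℝ) / (q * q' : ℕ)) • l2) z' S) := by
  have := St.stage h hz hz1 hz2 hq' hcard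
  rwa [sep_sep_cone hC hq hq', sub_smul_sub_smul hq hq', one_div_smul_smul hq hq',
    latDiv_latDiv hq hq'] at this

theorem StAt.run_list (hC : ∀ y ∈ C, 0 ≤ l2 y) {M n : ℕ} (hM : 0 < M) (zs : List W) :
    ∀ (o : LinearOrder W) (s q : ℕ) (K : Set (Finset W)), 0 < q → q ≡ 1 [MOD M] →
      StAt o U Λ C l1 l2 s q K → (∀ S ∈ K, Full U S → PP S (latDiv Λ l2 q) (n + 1)) →
      (∀ S ∈ K, Full U S → PP S (latDiv Λ l2 q) n ∨ ∃ z ∈ zs, @Good W _ _ o (latDiv Λ l2 q)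
        (l1 - ((s : ℝ) / q) • l2) (((1 : ℝ) / q) • l2) z S) →
      ∃ (o' : LinearOrder W) (s' q' : ℕ) (K' : Set (Finset W)), 0 < q' ∧ q' ≡ 1 [MOD M] ∧
        StAt o' U Λ C l1 l2 s' q' K' ∧ ∀ S ∈ K', Full U S → PP S (latDiv Λ l2 q') n := by
  induction zs with
  | nil =>
    intro o s q K hq hqM h _ hG
    refine ⟨o, s, q, K, hq, hqM, h, fun S hS hF => ?_⟩
    simpa using hG S hS hF
  | cons z zs ih =>
    intro o s q K hq hqM h hP hG
    by_cases hz : z ∈ latDiv Λ l2 q ∧ (l1 - ((s : ℝ) / q) • l2) z = 0 ∧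
      (((1 : ℝ) / q) • l2) z = 0
    · obtain ⟨hz0, hz1, hz2⟩ := hz
      set B := (St.finite h).toFinset.sup Finset.card with hB
      have hBc : ∀ c : W →₀ ℝ, Zc K z c → c.support.card ≤ B ∧ c.support.card ≤ 1 + M * B := by
        intro c hc
        have h1 : c.support.card ≤ B :=
          Finset.le_sup (f := Finset.card) ((St.finite h).mem_toFinset.2 hc.mem)
        exact ⟨h1, by nlinarith⟩
      obtain ⟨o', K', h', hK'⟩ := h.stage hC hq (q' := 1 + M * B) (by omega) hz0 hz1 hz2 hBc
      refine ih o' _ _ K' (by positivity) ?_ h' (fun S hS hF => ?_) (fun S hS hF => ?_)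
      · have : 1 + M * B ≡ 1 [MOD M] := by
          simp [Nat.ModEq]
        simpa using hqM.mul this
      · obtain ⟨Δ, hΔ, hΔF, h1, h2⟩ := hK' S hS hF
        by_cases hc : ∃ c, Zc K z c ∧ c.support ⊆ Δ
        · exact (h1 hc n (hP Δ hΔ hΔF)).mono (by omega)
        · exact (h2 hc).1 _ (hP Δ hΔ hΔF)
      · obtain ⟨Δ, hΔ, hΔF, h1, h2⟩ := hK' S hS hF
        by_cases hc : ∃ c, Zc K z c ∧ c.support ⊆ Δ
        · exact Or.inl (h1 hc n (hP Δ hΔ hΔF))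
        · rcases hG Δ hΔ hΔF with hp | ⟨z', hz', hg⟩
          · exact Or.inl ((h2 hc).1 _ hp)
          · rcases List.mem_cons.1 hz' with rfl | hz'
            · exact absurd (@Good.exists_zc W _ _ o _ _ _ _ _ _ _ _ h hΔ hg) hc
            · exact Or.inr ⟨z', hz', (h2 hc).2 z' hg⟩
    · refine ih o s q K hq hqM h hP (fun S hS hF => ?_)
      rcases hG S hS hF with hp | ⟨z', hz', hg⟩
      · exact Or.inl hp
      · rcases List.mem_cons.1 hz' with rfl | hz'
        · exact absurd ⟨hg.1, hg.2.1, hg.2.2.1⟩ hz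
        · exact Or.inr ⟨z', hz', hg⟩

theorem StAt.run_aux (hC : ∀ y ∈ C, 0 ≤ l2 y) {M : ℕ} (hM : 0 < M) (n : ℕ) :
    ∀ (o : LinearOrder W) (s q : ℕ) (K : Set (Finset W)), 0 < q → q ≡ 1 [MOD M] →
      StAt o U Λ C l1 l2 s q K → (∀ S ∈ K, Full U S → PP S (latDiv Λ l2 q) (n + 1)) →
      ∃ (o' : LinearOrder W) (s' q' : ℕ) (K' : Set (Finset W)), 0 < q' ∧ q' ≡ 1 [MOD M] ∧
        StAt o' U Λ C l1 l2 s' q' K' ∧ ∀ S ∈ K', Full U S → PP S (latDiv Λ l2 q') 1 := by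
  classical
  induction n with
  | zero => exact fun o s q K hq hqM h hP => ⟨o, s, q, K, hq, hqM, h, hP⟩
  | succ n ih =>
    intro o s q K hq hqM h hP
    have hz : ∀ S : Finset W, ∃ z, S ∈ K → Full U S → PP S (latDiv Λ l2 q) (n + 1) ∨
        @Good W _ _ o (latDiv Λ l2 q) (l1 - ((s : ℝ) / q) • l2) (((1 : ℝ) / q) • l2) z S := by
      intro S
      by_cases hS : S ∈ K ∧ Full U S ∧
        ∃ y ∈ latDiv Λ l2 q, y ∉ AddSubgroup.closure (S : Set W)
      · obtain ⟨hS, hF, y, hy, hyS⟩ := hS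
        obtain ⟨z, hz⟩ := @St.exists_good W _ _ o _ _ _ _ _ _ _ h hS hF y hy hyS
        exact ⟨z, fun _ _ => Or.inr hz⟩
      · push Not at hS
        exact ⟨0, fun h1 h2 => Or.inl ((PP_of_le (hS h1 h2)).mono (by omega))⟩
    choose f hf using hz
    obtain ⟨o', s', q', K', hq', hqM', h', hP'⟩ := run_list hC (n := n + 1) hM
      ((St.finite h).toFinset.toList.map f) o s q K hq hqM h hP (fun S hS hF => by
        rcases hf S hS hF with h1 | h1
        · exact Or.inl h1
        · exact Or.inr ⟨f S, List.mem_map.2 ⟨S, by simpa using hS, rfl⟩, h1⟩)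
    exact ih o' s' q' K' hq' hqM' h' hP'

/-- All parameters that are eventually reached carry a triangulation into simplices generating
the lattice. -/
theorem St.run [o : LinearOrder W] (h : St U Λ C K l1 l2) {M : ℕ} (hM : 0 < M) :
    ∃ s q : ℕ, 0 < q ∧ q ≡ 1 [MOD M] ∧ ∀ a b : ℕ, 0 < b →
      ∃ (o' : LinearOrder W) (K' : Set (Finset W)),
        StAt o' U Λ C l1 l2 (s * b + a) (q * b) K' ∧
        ∀ S ∈ K', Full U S → ∀ y ∈ latDiv Λ l2 (q * b), y ∈ AddSubgroup.closure (S : Set W) := by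
  have hC : ∀ y ∈ C, 0 ≤ l2 y := fun y hy => (h.l_nonneg hy).2
  have hlat : latDiv Λ l2 1 = Λ := by
    ext y
    rw [mem_latDiv]
    simp only [Nat.cast_one, div_one, one_smul]
    exact ⟨fun hy => hy.1, fun hy => ⟨hy, (h.int y hy).2⟩⟩
  have h1 : StAt o U Λ C l1 l2 0 1 K := by
    have hCs : {y | y ∈ C ∧ 0 ≤ l1 y} = C := by
      ext y
      exact ⟨fun hy => hy.1, fun hy => ⟨hy, (h.l_nonneg hy).1⟩⟩
    rw [StAt, hlat]
    simpa [hCs] using h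
  obtain ⟨n, hn⟩ := h.exists_PP
  obtain ⟨o', s, q, K', hq, hqM, h', hP⟩ := StAt.run_aux hC hM n o 0 1 K one_pos rfl h1
    (fun S hS hF => by rw [hlat]; exact (hn S hS hF).mono (by omega))
  refine ⟨s, q, hq, hqM, fun a b hb => ?_⟩
  have hno : ∀ c, ¬ Zc K' 0 c := fun c hc =>
    hc.ne (h'.tri.indep hc.mem subset_rfl hc.ev)
  obtain ⟨o'', K'', h'', hK''⟩ := h'.stage hC hq (s' := a) hb (z := 0) (zero_mem _)
    (map_zero _) (map_zero _) (fun c hc => absurd hc (hno c))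
  refine ⟨o'', K'', h'', fun S hS hF y hy => ?_⟩
  obtain ⟨Δ, hΔ, hΔF, -, h2⟩ := hK'' S hS hF
  exact ((h2 (fun ⟨c, hc, _⟩ => hno c hc)).1 1 (hP Δ hΔ hΔF)).one hy

end Run

section Transport
variable {W W' : Type*} [AddCommGroup W] [Module ℝ W] [AddCommGroup W'] [Module ℝ W']
    {C : Set W} {K : Set (Finset W)}

theorem Tri.face (h : Tri C K) (l : W →ₗ[ℝ] ℝ) (hl : ∀ y ∈ C, 0 ≤ l y) :
    Tri {y | y ∈ C ∧ l y = 0} {S | S ∈ K ∧ ∀ v ∈ S, l v = 0} where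
  down := fun S hS S' hS' => ⟨h.down S hS.1 S' hS', fun v hv => hS.2 v (hS' hv)⟩
  cover := by
    rintro y ⟨hy, hly⟩
    obtain ⟨w, hw, hwK, rfl⟩ := h.cover y hy
    have hv : ∀ v ∈ w.support, 0 ≤ l v := fun v hv => by
      have := hl _ (h.mem_of_subset hwK (β := Finsupp.single v 1)
        (Finsupp.single_nonneg.2 zero_le_one)
        (Finsupp.support_single_subset.trans (Finset.singleton_subset_iff.2 hv)))
      rwa [ev_single, one_smul] at this
    rw [map_ev l w subset_rfl,
      Finset.sum_eq_zero_iff_of_nonneg (fun v hv' => mul_nonneg (hw v) (hv v hv'))] at hly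
    exact ⟨w, hw, ⟨hwK, fun v hv' =>
      (mul_eq_zero.1 (hly v hv')).resolve_left (Finsupp.mem_support_iff.1 hv')⟩, rfl⟩
  mem := by
    intro w hw hwK
    refine ⟨h.mem w hw hwK.1, ?_⟩
    rw [map_ev l w subset_rfl]
    exact Finset.sum_eq_zero (fun v hv => by rw [hwK.2 v hv, mul_zero])
  uniq := fun w w' hw hw' hK hK' he => h.uniq w w' hw hw' hK.1 hK'.1 he

theorem ev_equivMapDomain (e : W ≃ₗ[ℝ] W') (β : W →₀ ℝ) :
    ev (β.equivMapDomain e.toEquiv) = e (ev β) := by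
  induction β using Finsupp.induction_linear with
  | zero => simp
  | add a b ha hb =>
    rw [Finsupp.equivMapDomain_eq_mapDomain, Finsupp.mapDomain_add, map_add, map_add, map_add,
      ← ha, ← hb, Finsupp.equivMapDomain_eq_mapDomain, Finsupp.equivMapDomain_eq_mapDomain]
  | single v c => simp

theorem equivMapDomain_nonneg (e : W ≃ₗ[ℝ] W') {β : W →₀ ℝ} (h : 0 ≤ β) :
    0 ≤ β.equivMapDomain e.toEquiv := fun _ => h _

theorem Tri.comap {C : Set W'} {K : Set (Finset W')} (h : Tri C K) (e : W ≃ₗ[ℝ] W') :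
    Tri (e ⁻¹' C) {S | S.map e.toEquiv.toEmbedding ∈ K} where
  down := fun S hS S' hS' => h.down _ hS _ (Finset.map_subset_map.2 hS')
  cover := by
    intro y hy
    obtain ⟨w, hw, hwK, hwe⟩ := h.cover _ hy
    refine ⟨w.equivMapDomain e.symm.toEquiv, equivMapDomain_nonneg e.symm hw, ?_, ?_⟩
    · have : (w.equivMapDomain e.symm.toEquiv).support.map e.toEquiv.toEmbedding = w.support := by
        ext v
        simp [Finset.mem_map_equiv]
      rw [Set.mem_ofPred_eq, this]
      exact hwK
    · rw [ev_equivMapDomain, hwe, LinearEquiv.symm_apply_apply]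
  mem := by
    intro w hw hwK
    rw [Set.mem_preimage, ← ev_equivMapDomain]
    exact h.mem _ (equivMapDomain_nonneg e hw) hwK
  uniq := by
    intro w w' hw hw' hK hK' he
    have := h.uniq _ _ (equivMapDomain_nonneg e hw) (equivMapDomain_nonneg e hw') hK hK'
      (by rw [ev_equivMapDomain, ev_equivMapDomain, he])
    ext v
    have h1 := DFunLike.congr_fun this (e v)
    simpa using h1

theorem StAt.int_of_full {U : Submodule ℝ W} {Λ : AddSubgroup W} {l1 l2 : W →ₗ[ℝ] ℝ} {s q : ℕ}
    {o : LinearOrder W} (h : StAt o U Λ C l1 l2 s q K)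
    (hU : U ≤ Submodule.span ℝ {y | y ∈ C ∧ 0 ≤ (l1 - ((s : ℝ) / q) • l2) y})
    (hcl : ∀ S ∈ K, Full U S → ∀ y ∈ latDiv Λ l2 q, y ∈ AddSubgroup.closure (S : Set W))
    {S : Finset W} (hS : S ∈ K) {β : W →₀ ℝ} (hβ : β.support ⊆ S) (hm : ev β ∈ latDiv Λ l2 q)
    (v : W) : β v ∈ ZZ := by
  classical
  have ht : Tri {y | y ∈ C ∧ 0 ≤ (l1 - ((s : ℝ) / q) • l2) y} K := h.tri
  let w : W →₀ ℝ := Finsupp.indicator S (fun _ _ => 1)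
  have hws : w.support = S := by
    ext v
    simp [w, Finsupp.indicator_apply]
  have hw : 0 ≤ w := fun v => by
    simp only [w, Finsupp.indicator_apply]
    split_ifs <;> simp
  obtain ⟨S', hS', hF, γ, hγ, hγS, hγe⟩ := ht.pure (St.finite h) h.cone hU
    (ht.mem w hw (by rwa [hws]))
  have := ht.uniq γ w hγ hw (ht.down _ hS' _ hγS) (by rwa [hws]) hγe
  have hSS : S ⊆ S' := by rwa [← hws, ← this]
  obtain ⟨a, ha, haz, hae⟩ := mem_closure_iff_ev.1 (hcl S' hS' hF _ hm)
  rw [← ht.inj hS' ha (hβ.trans hSS) hae]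
  exact haz v

end Transport

section Cayley
variable {d : ℕ}

/-- `p` lies in the `t`-th dilate of the convex hull of `V`. -/
def InP (V : Finset (Fin d → ℝ)) (t : ℝ) (p : Fin d → ℝ) : Prop :=
  ∃ g : (Fin d → ℝ) →₀ ℝ, 0 ≤ g ∧ g.support ⊆ V ∧ tot g = t ∧ ev g = p

variable {V : Finset (Fin d → ℝ)}

theorem InP.nonneg {t : ℝ} {p : Fin d → ℝ} (h : InP V t p) : 0 ≤ t := by
  obtain ⟨g, hg, -, rfl, -⟩ := h
  exact ms_nonneg _ hg

theorem InP.zero : InP V 0 (0 : Fin d → ℝ) := ⟨0, le_rfl, by simp, map_zero _, map_zero _⟩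

theorem InP.eq_zero {p : Fin d → ℝ} (h : InP V 0 p) : p = 0 := by
  obtain ⟨g, hg, -, h0, rfl⟩ := h
  rw [eq_zero_of_tot_eq_zero hg h0, map_zero]

theorem InP.add {t t' : ℝ} {p p' : Fin d → ℝ} (h : InP V t p) (h' : InP V t' p') :
    InP V (t + t') (p + p') := by
  obtain ⟨g, hg, hgV, rfl, rfl⟩ := h
  obtain ⟨g', hg', hgV', rfl, rfl⟩ := h'
  exact ⟨g + g', add_nonneg hg hg', support_add_subset hgV hgV', map_add _ _ _, map_add _ _ _⟩

theorem InP.smul {t c : ℝ} (hc : 0 ≤ c) {p : Fin d → ℝ} (h : InP V t p) :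
    InP V (c * t) (c • p) := by
  obtain ⟨g, hg, hgV, rfl, rfl⟩ := h
  exact ⟨c • g, smul_nonneg hc hg, support_smul_subset _ hgV, by rw [map_smul, smul_eq_mul],
    map_smul _ _ _⟩

theorem InP.of_mem {v : Fin d → ℝ} (hv : v ∈ V) : InP V 1 v :=
  ⟨Finsupp.single v 1, Finsupp.single_nonneg.2 zero_le_one,
    Finsupp.support_single_subset.trans (Finset.singleton_subset_iff.2 hv),
    ms_single _ _ _ trivial, by rw [ev_single, one_smul]⟩

theorem InP.split {t t' : ℝ} (ht : 0 ≤ t) (ht' : 0 ≤ t') {p : Fin d → ℝ} (h : InP V (t + t') p) :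
    ∃ p' p'', InP V t p' ∧ InP V t' p'' ∧ p' + p'' = p := by
  rcases (add_nonneg ht ht').eq_or_lt with h0 | h0
  · have e1 : t = 0 := by linarith
    have e2 : t' = 0 := by linarith
    subst e1 e2
    rw [add_zero] at h
    exact ⟨0, 0, InP.zero, InP.zero, by rw [h.eq_zero, add_zero]⟩
  · have h1 := h.smul (c := t / (t + t')) (by positivity)
    have h2 := h.smul (c := t' / (t + t')) (by positivity)
    rw [div_mul_cancel₀ _ h0.ne'] at h1 h2
    refine ⟨_, _, h1, h2, ?_⟩
    rw [← add_smul, ← add_div, div_self h0.ne', one_smul]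

theorem InP.abs_le {t : ℝ} {p : Fin d → ℝ} (h : InP V t p) {B : ℝ} (hB : ∀ v ∈ V, ∀ i, |v i| ≤ B)
    (i : Fin d) : |p i| ≤ t * B := by
  obtain ⟨g, hg, hgV, rfl, rfl⟩ := h
  have := map_ev (LinearMap.proj i : (Fin d → ℝ) →ₗ[ℝ] ℝ) g hgV
  rw [LinearMap.proj_apply] at this
  rw [this, tot_eq_sum g hgV, Finset.sum_mul]
  refine (Finset.abs_sum_le_sum_abs _ _).trans (Finset.sum_le_sum (fun v hv => ?_))
  rw [abs_mul, abs_of_nonneg (hg v)]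
  exact mul_le_mul_of_nonneg_left (hB v hv i) (hg v)

/-- The ambient space of the cones over Cayley sums. -/
abbrev CS (d : ℕ) : Type := (Fin d → ℝ) × ℝ × ℝ

/-- The integer points. -/
def latCS (d : ℕ) : AddSubgroup (CS d) where
  carrier := {w | (∀ i, w.1 i ∈ ZZ) ∧ w.2.1 ∈ ZZ ∧ w.2.2 ∈ ZZ}
  zero_mem' := ⟨fun _ => zero_mem _, zero_mem _, zero_mem _⟩
  add_mem' := fun ha hb => ⟨fun i => add_mem (ha.1 i) (hb.1 i), add_mem ha.2.1 hb.2.1,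
    add_mem ha.2.2 hb.2.2⟩
  neg_mem' := fun ha => ⟨fun i => neg_mem (ha.1 i), neg_mem ha.2.1, neg_mem ha.2.2⟩

/-- The first height function. -/
def ht1 (d : ℕ) : CS d →ₗ[ℝ] ℝ := LinearMap.fst ℝ ℝ ℝ ∘ₗ LinearMap.snd ℝ (Fin d → ℝ) (ℝ × ℝ)

/-- The second height function. -/
def ht2 (d : ℕ) : CS d →ₗ[ℝ] ℝ := LinearMap.snd ℝ ℝ ℝ ∘ₗ LinearMap.snd ℝ (Fin d → ℝ) (ℝ × ℝ)

theorem ht1_apply (w : CS d) : ht1 d w = w.2.1 := rfl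

theorem ht2_apply (w : CS d) : ht2 d w = w.2.2 := rfl

/-- The cone over the `c`-th dilate. -/
def coneOne (V : Finset (Fin d → ℝ)) (c : ℕ) : Set (CS d) :=
  {w | 0 ≤ w.2.1 ∧ w.2.2 = 0 ∧ InP V (c * w.2.1) w.1}

/-- The cone over the Cayley sum of the `m`-th dilate and the polytope. -/
def coneTwo (V : Finset (Fin d → ℝ)) (m : ℕ) : Set (CS d) :=
  {w | 0 ≤ w.2.1 ∧ 0 ≤ w.2.2 ∧ InP V (m * w.2.1 + w.2.2) w.1}

theorem coneOne_subset (m : ℕ) : coneOne V m ⊆ coneTwo V m := by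
  rintro w ⟨h1, h2, h3⟩
  exact ⟨h1, h2.ge, by rwa [h2, add_zero]⟩

theorem isCone_coneOne (m : ℕ) : IsCone (coneOne V m) where
  zero := ⟨le_rfl, rfl, by simpa using InP.zero⟩
  add := by
    rintro x ⟨h1, h2, h3⟩ y ⟨g1, g2, g3⟩
    refine ⟨add_nonneg h1 g1, ?_, ?_⟩
    · rw [Prod.snd_add, Prod.snd_add, h2, g2, add_zero]
    · rw [Prod.snd_add, Prod.fst_add, mul_add]
      exact h3.add g3
  smul := by
    rintro x ⟨h1, h2, h3⟩ t ht
    refine ⟨mul_nonneg ht h1, ?_, ?_⟩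
    · simp [h2]
    · have := h3.smul ht
      rwa [mul_left_comm] at this

theorem isCone_coneTwo (m : ℕ) : IsCone (coneTwo V m) where
  zero := ⟨le_rfl, le_rfl, by simpa using InP.zero⟩
  add := by
    rintro x ⟨h1, h2, h3⟩ y ⟨g1, g2, g3⟩
    refine ⟨add_nonneg h1 g1, add_nonneg h2 g2, ?_⟩
    have := h3.add g3
    have he : (m : ℝ) * (x + y).2.1 + (x + y).2.2
        = m * x.2.1 + x.2.2 + (m * y.2.1 + y.2.2) := by
      simp only [Prod.snd_add, Prod.fst_add]
      ring
    rwa [he]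
  smul := by
    rintro x ⟨h1, h2, h3⟩ t ht
    refine ⟨mul_nonneg ht h1, mul_nonneg ht h2, ?_⟩
    have := h3.smul ht
    have he : (m : ℝ) * (t • x).2.1 + (t • x).2.2 = t * (m * x.2.1 + x.2.2) := by
      simp only [Prod.smul_snd, Prod.smul_fst, smul_eq_mul]
      ring
    rwa [he]

/-- The cone over the `c`-th dilate has a unimodular triangulation. -/
def UT (V : Finset (Fin d → ℝ)) (c : ℕ) : Prop :=
  ∃ K : Set (Finset (CS d)), K.Finite ∧ Tri (coneOne V c) K ∧
    (∀ S ∈ K, ∀ v ∈ S, v ∈ latCS d ∧ v.2.1 = 1) ∧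
    ∀ S ∈ K, ∀ β : CS d →₀ ℝ, β.support ⊆ S → ev β ∈ latCS d → ∀ v, β v ∈ ZZ

theorem Tri.vertex_mem {W : Type*} [AddCommGroup W] [Module ℝ W] {C : Set W}
    {K : Set (Finset W)} (h : Tri C K) {S : Finset W} (hS : S ∈ K) {v : W} (hv : v ∈ S) :
    v ∈ C := by
  have := h.mem_of_subset hS (β := Finsupp.single v 1)
    (Finsupp.single_nonneg.2 zero_le_one)
    (Finsupp.support_single_subset.trans (Finset.singleton_subset_iff.2 hv))
  rwa [ev_single, one_smul] at this

theorem UT_zero (V : Finset (Fin d → ℝ)) : UT V 0 := by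
  classical
  let e : CS d := (0, 1, 0)
  have hK : ∀ w : CS d →₀ ℝ, w.support ∈ {S : Finset (CS d) | S ⊆ {e}} → ev w = w e • e ∧
      w = Finsupp.single e (w e) := by
    intro w hw
    have : w = Finsupp.single e (w e) := Finsupp.support_subset_singleton.1 hw
    refine ⟨?_, this⟩
    conv_lhs => rw [this, ev_single]
  have hc : ∀ c : ℝ, c • e = (0, c, 0) := fun c => by simp [e]
  refine ⟨{S | S ⊆ {e}}, (Finset.finite_toSet ({e} : Finset (CS d)).powerset).subset
    (fun S hS => Finset.mem_powerset.2 hS), ⟨fun S hS S' hS' => hS'.trans hS, ?_, ?_, ?_⟩, ?_, ?_⟩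
  · rintro ⟨p, a, b⟩ ⟨h1, h2, h3⟩
    simp only [Nat.cast_zero, zero_mul] at h1 h2 h3
    refine ⟨Finsupp.single e a, Finsupp.single_nonneg.2 h1, Finsupp.support_single_subset, ?_⟩
    rw [ev_single, hc, h3.eq_zero, h2]
  · intro w hw hwK
    rw [(hK w hwK).1, hc]
    exact ⟨hw e, rfl, by simpa using InP.zero⟩
  · intro w w' _ _ hwK hwK' he
    rw [(hK w hwK).1, (hK w' hwK').1, hc, hc] at he
    have h1 : w e = w' e := (Prod.ext_iff.1 (Prod.ext_iff.1 he).2).1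
    rw [(hK w hwK).2, (hK w' hwK').2, h1]
  · intro S hS v hv
    rw [Finset.mem_singleton.1 (hS hv)]
    exact ⟨⟨fun _ => zero_mem _, one_mem _, zero_mem _⟩, rfl⟩
  · intro S hS β hβ hm v
    obtain ⟨h1, h2⟩ := hK β (hβ.trans hS)
    rw [h1, hc] at hm
    rw [h2, Finsupp.single_apply]
    split_ifs
    · exact hm.2.1
    · exact zero_mem _

end Cayley

section Dilates
variable {d : ℕ} {V : Finset (Fin d → ℝ)}

/-- The embedding of `ℝ ^ d` at the height `c`. -/
def emb (d : ℕ) (c : ℝ × ℝ) : (Fin d → ℝ) ↪ CS d :=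
  ⟨fun p => (p, c), fun _ _ h => (Prod.ext_iff.1 h).1⟩

theorem emb_apply (c : ℝ × ℝ) (p : Fin d → ℝ) : emb d c p = (p, c) := rfl

theorem ev_mapDomain_emb (c : ℝ × ℝ) (g : (Fin d → ℝ) →₀ ℝ) :
    ev (g.mapDomain (emb d c)) = (ev g, tot g • c) := by
  induction g using Finsupp.induction_linear with
  | zero => rw [Finsupp.mapDomain_zero, map_zero, map_zero, map_zero, zero_smul]; rfl
  | add a b ha hb =>
    rw [Finsupp.mapDomain_add, map_add, map_add, map_add, ha, hb, add_smul, Prod.mk_add_mk]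
  | single v x =>
    rw [Finsupp.mapDomain_single, ev_single, ev_single, emb_apply, Prod.smul_mk,
      show tot (Finsupp.single v x) = x from ms_single _ _ _ trivial]

theorem IsCone.ev_mem {W : Type*} [AddCommGroup W] [Module ℝ W] {C : Set W} (hC : IsCone C)
    {g : W →₀ ℝ} (hg : 0 ≤ g) (h : ∀ v ∈ g.support, v ∈ C) : ev g ∈ C := by
  rw [ev, Finsupp.linearCombination_apply, Finsupp.sum]
  exact Finset.sum_induction _ (· ∈ C) (fun a b ha hb => hC.add a ha b hb) hC.zero
    (fun v hv => hC.smul v (h v hv) _ (hg v))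

theorem coneTwo_eq (m : ℕ) : coneTwo V m = {y | ∃ g : CS d →₀ ℝ, 0 ≤ g ∧
    g.support ⊆ V.map (emb d (0, 1)) ∧ y - ev g ∈ coneOne V m} := by
  classical
  ext ⟨p, a, b⟩
  constructor
  · rintro ⟨h1, h2, h3⟩
    simp only at h1 h2 h3
    obtain ⟨p', _, h4, ⟨g, hg, hgV, rfl, rfl⟩, rfl⟩ := h3.split (by positivity) h2
    refine ⟨g.mapDomain (emb d (0, 1)), Finsupp.mapDomain_nonneg hg, ?_, ?_⟩
    · rw [Finset.map_eq_image]
      exact Finsupp.mapDomain_support.trans (Finset.image_subset_image hgV)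
    · rw [ev_mapDomain_emb]
      refine ⟨by simpa using h1, by simp, ?_⟩
      simpa using h4
  · rintro ⟨g, hg, hgV, h⟩
    have h1 : ev g ∈ coneTwo V m := (isCone_coneTwo m).ev_mem hg (fun v hv => by
      obtain ⟨u, hu, rfl⟩ := Finset.mem_map.1 (hgV hv)
      refine ⟨le_rfl, zero_le_one, ?_⟩
      have := InP.of_mem hu
      simpa [emb_apply] using this)
    have := (isCone_coneTwo m).add _ (coneOne_subset m h) _ h1
    rwa [sub_add_cancel] at this

theorem finite_latCS_bounded (N : ℕ) :
    {w : CS d | w ∈ latCS d ∧ (∀ i, |w.1 i| ≤ N) ∧ |w.2.1| ≤ N ∧ |w.2.2| ≤ N}.Finite := by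
  classical
  let F : (Fin d → ℤ) × ℤ × ℤ → CS d := fun z => (fun i => (z.1 i : ℝ), (z.2.1 : ℝ), (z.2.2 : ℝ))
  refine ((Set.finite_Icc ((fun _ => -(N : ℤ)), -(N : ℤ), -(N : ℤ))
    ((fun _ => (N : ℤ)), (N : ℤ), (N : ℤ))).image F).subset ?_
  rintro ⟨p, a, b⟩ ⟨⟨h1, ⟨a, rfl⟩, ⟨b, rfl⟩⟩, h4, h5, h6⟩
  choose z hz using h1
  simp only [eq_intCast] at h4 h5 h6 hz
  have key : ∀ x : ℤ, |(x : ℝ)| ≤ N → -(N : ℤ) ≤ x ∧ x ≤ N := fun x hx =>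
    abs_le.1 (by exact_mod_cast hx)
  have hp : ∀ i, -(N : ℤ) ≤ z i ∧ z i ≤ N := fun i => key _ (by rw [hz i]; exact h4 i)
  exact ⟨(z, a, b), ⟨⟨fun i => (hp i).1, (key _ h5).1, (key _ h6).1⟩,
    ⟨fun i => (hp i).2, (key _ h5).2, (key _ h6).2⟩⟩, by
      simp only [F, eq_intCast]
      rw [funext hz]⟩

theorem finite_coneTwo (m : ℕ) (r : ℝ) :
    {y : CS d | y ∈ latCS d ∧ y ∈ coneTwo V m ∧ y.2.1 + y.2.2 ≤ r}.Finite := by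
  obtain ⟨B, hB⟩ : ∃ B : ℝ, ∀ v ∈ V, ∀ i, |v i| ≤ B := by
    refine ⟨∑ v ∈ V, ∑ i, |v i|, fun v hv i => ?_⟩
    exact (Finset.single_le_sum (f := fun i => |v i|) (fun i _ => abs_nonneg _)
      (Finset.mem_univ i)).trans (Finset.single_le_sum (f := fun v => ∑ i, |v i|)
      (fun v _ => Finset.sum_nonneg (fun i _ => abs_nonneg _)) hv)
  obtain ⟨N, hN⟩ := exists_nat_ge (max r ((m * r + r) * max B 0))
  refine (finite_latCS_bounded N).subset ?_
  rintro ⟨p, a, b⟩ ⟨h1, ⟨h2, h3, h4⟩, h5⟩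
  simp only at h2 h3 h4 h5
  have hr := (le_max_left _ _).trans hN
  refine ⟨h1, fun i => ?_, ?_, ?_⟩
  · refine (h4.abs_le (B := max B 0) (fun v hv i => (hB v hv i).trans (le_max_left _ _)) i).trans
      (le_trans ?_ ((le_max_right _ _).trans hN))
    refine mul_le_mul_of_nonneg_right ?_ (le_max_right _ _)
    have : (m : ℝ) * a ≤ m * r := mul_le_mul_of_nonneg_left (by linarith) (by positivity)
    linarith
  · rw [abs_of_nonneg h2]
    linarith
  · rw [abs_of_nonneg h3]
    linarith

/-- The linear span of the cone over the Cayley sum. -/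
abbrev spanTwo (V : Finset (Fin d → ℝ)) (m : ℕ) : Submodule ℝ (CS d) :=
  Submodule.span ℝ (coneTwo V m)

/-- The lattice of the cone over the Cayley sum. -/
abbrev latTwo (V : Finset (Fin d → ℝ)) (m : ℕ) : AddSubgroup (CS d) :=
  latCS d ⊓ (spanTwo V m).toAddSubgroup

theorem UT.exists_St (hV : ∀ v ∈ V, ∀ i, v i ∈ ZZ) {m : ℕ} (h : UT V m) :
    ∃ (_ : LinearOrder (CS d)) (K : Set (Finset (CS d))),
      St (spanTwo V m) (latTwo V m) (coneTwo V m) K (ht1 d) (ht2 d) := by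
  classical
  obtain ⟨K, hKf, hK, hKv, hKi⟩ := h
  obtain ⟨K', -, hK', hKV, hKu⟩ := hK.add_vertices hKf (isCone_coneOne m) (ht2 d)
    (fun y hy => hy.2.1.ge) (V.map (emb d (0, 1))) (by
      intro v hv
      obtain ⟨u, -, rfl⟩ := Finset.mem_map.1 hv
      exact zero_lt_one)
  rw [← coneTwo_eq] at hK'
  let o0 : LinearOrder (CS d) := IsWellOrder.linearOrder WellOrderingRel
  obtain ⟨o, ho, -, -⟩ := exists_order (o := o0) (ht2 d) (ht2 d)
  refine ⟨o, K', ⟨hK', isCone_coneTwo m, ?_, fun y hy => hy.2, fun y hy => hy.1.2, ?_, ?_, ho⟩⟩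
  · intro S hS v hv
    have hvC := hK'.vertex_mem hS hv
    rcases hKV S hS v hv with hv1 | ⟨S1, hS1, hv1⟩
    · obtain ⟨u, hu, rfl⟩ := Finset.mem_map.1 hv1
      exact ⟨⟨⟨hV u hu, zero_mem _, one_mem _⟩, Submodule.subset_span hvC⟩, Or.inr ⟨rfl, rfl⟩⟩
    · have h1 := hKv S1 hS1 v hv1
      exact ⟨⟨h1.1, Submodule.subset_span hvC⟩, Or.inl ⟨h1.2, (hK.vertex_mem hS1 hv1).2.1⟩⟩
  · intro S hS hS0 β hβ hm
    refine hKi S (hKu S hS (fun u hu huV => ?_)) β hβ hm.1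
    obtain ⟨u, -, rfl⟩ := Finset.mem_map.1 huV
    exact one_ne_zero (hS0 _ hu)
  · intro r
    exact (finite_coneTwo (V := V) m r).subset (fun y hy => ⟨hy.1.1, hy.2⟩)

/-- The change of coordinates identifying the face of a cone with a cone over a dilate. -/
noncomputable def shear (d : ℕ) (s : ℝ) {q : ℝ} (hq : q ≠ 0) : CS d ≃ₗ[ℝ] CS d where
  toFun w := (w.1, s * w.2.1 + w.2.2, q * w.2.1)
  invFun w := (w.1, w.2.2 / q, w.2.1 - s * (w.2.2 / q))
  map_add' x y := by
    ext <;> simp <;> ring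
  map_smul' t x := by
    ext <;> simp <;> ring
  left_inv x := by
    ext <;> simp [hq]
  right_inv x := by
    ext <;> simp [mul_div_cancel₀, hq]

theorem shear_apply (s : ℝ) {q : ℝ} (hq : q ≠ 0) (w : CS d) :
    shear d s hq w = (w.1, s * w.2.1 + w.2.2, q * w.2.1) := rfl

theorem spanTwo_le (hne : V.Nonempty) (m s q : ℕ) : spanTwo V m ≤
    Submodule.span ℝ {y | y ∈ coneTwo V m ∧ 0 ≤ (ht1 d - ((s : ℝ) / q) • ht2 d) y} := by
  obtain ⟨v, hv⟩ := hne
  let e : CS d := ((m : ℝ) • v, 1, 0)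
  have he : e ∈ coneTwo V m := by
    refine ⟨zero_le_one, le_rfl, ?_⟩
    have := (InP.of_mem hv).smul (Nat.cast_nonneg (α := ℝ) m)
    simpa [e] using this
  have hl : (ht1 d - ((s : ℝ) / q) • ht2 d) e = 1 := by
    simp [ht1_apply, ht2_apply, e]
  rw [Submodule.span_le]
  intro y hy
  have hk : 0 ≤ (s : ℝ) / q * y.2.2 := mul_nonneg (by positivity) hy.2.1
  have h1 : y + ((s : ℝ) / q * y.2.2) • e ∈
      {y | y ∈ coneTwo V m ∧ 0 ≤ (ht1 d - ((s : ℝ) / q) • ht2 d) y} := by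
    refine ⟨(isCone_coneTwo m).add _ hy _ ((isCone_coneTwo m).smul _ he _ hk), ?_⟩
    rw [map_add, map_smul, hl]
    simp only [LinearMap.sub_apply, LinearMap.smul_apply, ht1_apply, ht2_apply, smul_eq_mul]
    linarith [hy.1]
  have h2 := Submodule.sub_mem _ (Submodule.subset_span h1)
    (Submodule.smul_mem _ ((s : ℝ) / q * y.2.2) (Submodule.subset_span
      (show e ∈ {y | y ∈ coneTwo V m ∧ 0 ≤ (ht1 d - ((s : ℝ) / q) • ht2 d) y} from
        ⟨he, by rw [hl]; exact zero_le_one⟩)))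
  rwa [add_sub_cancel_right] at h2

theorem StAt.UT {m s q : ℕ} (hne : V.Nonempty) (hq : 0 < q) {o : LinearOrder (CS d)}
    {K : Set (Finset (CS d))}
    (h : StAt o (spanTwo V m) (latTwo V m) (coneTwo V m) (ht1 d) (ht2 d) s q K)
    (hcl : ∀ S ∈ K, Full (spanTwo V m) S → ∀ y ∈ latDiv (latTwo V m) (ht2 d) q,
      y ∈ AddSubgroup.closure (S : Set (CS d))) : UT V (m * s + q) := by
  have hq0 : (q : ℝ) ≠ 0 := by exact_mod_cast hq.ne'
  have hqp : (0 : ℝ) < q := by exact_mod_cast hq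
  have ht : Tri {y | y ∈ coneTwo V m ∧ 0 ≤ (ht1 d - ((s : ℝ) / q) • ht2 d) y} K := h.tri
  let g := shear d s hq0
  have hl1 : ∀ y, (ht1 d - ((s : ℝ) / q) • ht2 d) (g y) = y.2.2 := by
    intro y
    simp only [LinearMap.sub_apply, LinearMap.smul_apply, ht1_apply, ht2_apply, smul_eq_mul, g,
      shear_apply]
    field_simp
    ring
  have hl2 : ∀ y, (((1 : ℝ) / q) • ht2 d) (g y) = y.2.1 := by
    intro y
    simp only [LinearMap.smul_apply, ht2_apply, smul_eq_mul, g, shear_apply]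
    field_simp
  have ht' := (ht.face (ht1 d - ((s : ℝ) / q) • ht2 d) (fun y hy => hy.2)).comap g
  have hC : g ⁻¹' {y | y ∈ {y | y ∈ coneTwo V m ∧ 0 ≤ (ht1 d - ((s : ℝ) / q) • ht2 d) y} ∧
      (ht1 d - ((s : ℝ) / q) • ht2 d) y = 0} = coneOne V (m * s + q) := by
    ext y
    simp only [Set.mem_preimage, Set.mem_ofPred_eq, hl1]
    have e1 : ∀ t : ℝ, (m : ℝ) * (s * t + 0) + q * t = ((m * s + q : ℕ) : ℝ) * t := by
      intro t
      push_cast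
      ring
    constructor
    · rintro ⟨⟨⟨h1, h2, h3⟩, h4⟩, h5⟩
      simp only [g, shear_apply] at h1 h2 h3
      rw [h5, e1] at h3
      exact ⟨nonneg_of_mul_nonneg_right h2 hqp, h5, h3⟩
    · rintro ⟨h1, h2, h3⟩
      refine ⟨⟨⟨?_, ?_, ?_⟩, h2.ge⟩, h2⟩
      · simp only [g, shear_apply, h2]
        positivity
      · simp only [g, shear_apply]
        positivity
      · simp only [g, shear_apply]
        rwa [h2, e1]
  rw [hC] at ht'
  refine ⟨_, ((St.finite h).subset (Set.sep_subset _ _)).preimage (Finset.map_injective _).injOn,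
    ht', ?_, ?_⟩
  · rintro S ⟨hS, hS0⟩ v hv
    have hgv : g v ∈ S.map g.toEquiv.toEmbedding := Finset.mem_map_of_mem _ hv
    have h0 := hS0 _ hgv
    obtain ⟨h1, h2⟩ := h.vert _ hS _ hgv
    have h3 : v.2.1 = 1 := by
      rw [← hl2]
      rcases h2 with h2 | h2
      · rw [h0] at h2
        exact absurd h2.1 zero_ne_one
      · exact h2.2
    rw [hl1] at h0
    exact ⟨⟨h1.1.1.1, by rw [h3]; exact one_mem _, by rw [h0]; exact zero_mem _⟩, h3⟩
  · rintro S ⟨hS, -⟩ β hβ hm v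
    have hb : (β.equivMapDomain g.toEquiv).support ⊆ S.map g.toEquiv.toEmbedding :=
      Finset.map_subset_map.2 hβ
    have hmem : ev (β.equivMapDomain g.toEquiv) ∈ latDiv (latTwo V m) (ht2 d) q := by
      refine mem_latDiv.2 ⟨⟨?_, ?_⟩, ?_⟩
      · rw [ev_equivMapDomain]
        exact ⟨hm.1, add_mem (mul_mem (natCast_mem_ZZ s) hm.2.1) hm.2.2,
          mul_mem (natCast_mem_ZZ q) hm.2.1⟩
      · have h1 := mem_span_iff_ev.2 ⟨_, hb, rfl⟩
        exact Submodule.span_le.2 (fun u hu => h.lat u (h.vert _ hS u hu).1) h1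
      · rw [ev_equivMapDomain, hl2]
        exact hm.2.1
    have := StAt.int_of_full h (spanTwo_le hne m s q) hcl hS hb hmem (g v)
    simpa using this

theorem UT.run (hV : ∀ v ∈ V, ∀ i, v i ∈ ZZ) (hne : V.Nonempty) {m : ℕ} (h : UT V m) {M : ℕ}
    (hM : 0 < M) : ∃ s q : ℕ, 0 < q ∧ q ≡ 1 [MOD M] ∧
      ∀ a b : ℕ, 0 < b → UT V (m * (s * b + a) + q * b) := by
  obtain ⟨o, K, hK⟩ := h.exists_St hV
  obtain ⟨s, q, hq, hqM, hs⟩ := hK.run hM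
  refine ⟨s, q, hq, hqM, fun a b hb => ?_⟩
  obtain ⟨o', K', h1, h2⟩ := hs a b hb
  exact h1.UT hne (Nat.mul_pos hq hb) h2

theorem UT.eventually (hV : ∀ v ∈ V, ∀ i, v i ∈ ZZ) (hne : V.Nonempty) :
    ∃ c : ℕ, 0 < c ∧ ∀ c' : ℕ, c ≤ c' → UT V c' := by
  obtain ⟨s, m, hm, -, h⟩ := (UT_zero V).run hV hne one_pos
  have hUT : UT V m := by simpa using h 0 1 one_pos
  obtain ⟨s, q, hq, hqm, h⟩ := hUT.run hV hne hm
  refine ⟨m * (m * s + q) + 1, Nat.succ_pos _, fun c hc => ?_⟩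
  obtain ⟨b, hb0, hbm, hbc⟩ : ∃ b, 0 < b ∧ b ≤ m ∧ b ≡ c [MOD m] := by
    rcases (c % m).eq_zero_or_pos with h0 | h0
    · exact ⟨m, hm, le_rfl, by simp [Nat.ModEq, h0]⟩
    · exact ⟨c % m, h0, (Nat.mod_lt _ hm).le, Nat.mod_modEq _ _⟩
  have hle : b * (m * s + q) ≤ c := (Nat.mul_le_mul_right _ hbm).trans (by omega)
  have hmod : b * (m * s + q) ≡ c [MOD m] := by
    have h1 : m * s + q ≡ 1 [MOD m] := by
      simpa [Nat.ModEq] using hqm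
    have hbc' : b * 1 ≡ c [MOD m] := by rwa [mul_one]
    have := (Nat.ModEq.mul_left b h1).trans hbc'
    exact this
  obtain ⟨a, ha⟩ := (Nat.modEq_iff_dvd' hle).1 hmod
  have hc' : c = m * (s * b + a) + q * b := by
    have : c = b * (m * s + q) + m * a := by omega
    rw [this]
    ring
  rw [hc']
  exact h a b hb0

end Dilates

section Complexes
variable {d : ℕ} {S S' : Finset (Fin d → ℝ)}

theorem mem_convexHull_iff_InP {x : Fin d → ℝ} :
    x ∈ convexHull ℝ (S : Set (Fin d → ℝ)) ↔ InP S 1 x := by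
  constructor
  · intro hx
    refine convexHull_min (t := {x | InP S 1 x}) (fun v hv => InP.of_mem hv) ?_ hx
    intro x hx y hy a b ha hb hab
    have := (InP.smul ha hx).add (InP.smul hb hy)
    rwa [mul_one, mul_one, hab] at this
  · rintro ⟨g, hg, hgS, h1, rfl⟩
    rw [tot_eq_sum g subset_rfl] at h1
    rw [ev, Finsupp.linearCombination_apply, Finsupp.sum]
    exact (convex_convexHull ℝ _).sum_mem (fun v _ => hg v) h1
      (fun v hv => subset_convexHull ℝ _ (hgS hv))

/-- Affine independence, in terms of finitely supported functions. -/
def AffIndep (S : Finset (Fin d → ℝ)) : Prop :=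
  ∀ β : (Fin d → ℝ) →₀ ℝ, β.support ⊆ S → tot β = 0 → ev β = 0 → β = 0

theorem tot_single {ι : Type*} (v : ι) (c : ℝ) : tot (Finsupp.single v c) = c :=
  ms_single _ _ _ trivial

theorem AffIndep.affineIndependent (h : AffIndep S) :
    AffineIndependent ℝ (Subtype.val : ↥(S : Set (Fin d → ℝ)) → (Fin d → ℝ)) := by
  classical
  rw [affineIndependent_iff]
  intro s w hw hws e he
  have := h (∑ e ∈ s, Finsupp.single (e : Fin d → ℝ) (w e)) ?_ ?_ ?_
  · have h1 := DFunLike.congr_fun this (e : Fin d → ℝ)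
    rw [Finsupp.finsetSum_apply] at h1
    simp only [Finsupp.single_apply, Subtype.val_inj] at h1
    rwa [Finset.sum_ite_eq_of_mem' _ _ _ he] at h1
  · refine Finset.sum_induction _ (fun β : (Fin d → ℝ) →₀ ℝ => β.support ⊆ S)
      (fun a b => support_add_subset) (by simp) (fun v _ => ?_)
    exact Finsupp.support_single_subset.trans (Finset.singleton_subset_iff.2 v.2)
  · rw [map_sum, ← hw]
    exact Finset.sum_congr rfl (fun v _ => tot_single _ _)
  · rw [map_sum, ← hws]
    exact Finset.sum_congr rfl (fun v _ => ev_single _ _)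

theorem AffIndep.exists_functional (h : AffIndep S) (p : (Fin d → ℝ) → Prop) :
    ∃ (φ : (Fin d → ℝ) →ₗ[ℝ] ℝ) (k : ℝ), ∀ w : (Fin d → ℝ) →₀ ℝ, w.support ⊆ S → tot w = 1 →
      φ (ev w) = ms p w - k := by
  let Φ : Finsupp.supported ℝ ℝ (S : Set (Fin d → ℝ)) →ₗ[ℝ] (Fin d → ℝ) × ℝ :=
    (ev.prod tot) ∘ₗ Submodule.subtype _
  have hΦ : LinearMap.ker Φ = ⊥ := by
    rw [LinearMap.ker_eq_bot']
    rintro ⟨β, hβ⟩ h0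
    have h1 := Prod.ext_iff.1 h0
    exact Subtype.ext (h β (by exact_mod_cast (Finsupp.mem_supported _ _).1 hβ) h1.2 h1.1)
  obtain ⟨G, hG⟩ := LinearMap.exists_leftInverse_of_injective (K := ℝ)
    (V := Finsupp.supported ℝ ℝ (S : Set (Fin d → ℝ))) (V' := (Fin d → ℝ) × ℝ) Φ hΦ
  let ψ : (Fin d → ℝ) × ℝ →ₗ[ℝ] ℝ := ms p ∘ₗ Submodule.subtype _ ∘ₗ G
  refine ⟨ψ ∘ₗ LinearMap.inl ℝ _ _, ψ (0, 1), fun w hw hw1 => ?_⟩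
  have h1 : ψ (ev w, 1) = ms p w := by
    have h2 := LinearMap.congr_fun hG ⟨w, (Finsupp.mem_supported _ _).2 (by exact_mod_cast hw)⟩
    have h3 : Φ ⟨w, (Finsupp.mem_supported _ _).2 (by exact_mod_cast hw)⟩ = (ev w, 1) :=
      Prod.ext rfl hw1
    rw [LinearMap.comp_apply, h3] at h2
    simp only [ψ, LinearMap.comp_apply, h2]
    rfl
  rw [← h1, ← map_sub, LinearMap.comp_apply, LinearMap.inl_apply, Prod.mk_sub_mk, sub_zero,
    sub_self]

theorem AffIndep.isFaceOf (h : AffIndep S) (hS' : S' ⊆ S) (hne : S'.Nonempty) :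
    IsFaceOf (convexHull ℝ (S' : Set (Fin d → ℝ))) (convexHull ℝ (S : Set (Fin d → ℝ))) := by
  classical
  obtain ⟨v, hv⟩ := hne
  refine ⟨⟨v, subset_convexHull ℝ _ hv⟩, ?_⟩
  obtain ⟨φ, k, hφ⟩ := h.exists_functional (· ∈ S')
  have hle : ∀ w : (Fin d → ℝ) →₀ ℝ, 0 ≤ w → tot w = 1 → ms (· ∈ S') w ≤ 1 := fun w hw h1 =>
    h1 ▸ ms_mono hw (fun _ _ => trivial)
  refine ⟨φ, Set.ext fun x => ⟨fun hx => ⟨convexHull_mono (by exact_mod_cast hS') hx, ?_⟩, ?_⟩⟩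
  · intro y hy
    obtain ⟨w, hw, hwS, hw1, rfl⟩ := mem_convexHull_iff_InP.1 hx
    obtain ⟨w', hw', hwS', hw1', rfl⟩ := mem_convexHull_iff_InP.1 hy
    rw [hφ w (hwS.trans hS') hw1, hφ w' hwS' hw1',
      ms_eq_tot (p := (· ∈ S')) (a := w) (fun u hu => hwS hu), hw1]
    linarith [hle w' hw' hw1']
  · rintro ⟨hx, hmax⟩
    obtain ⟨w, hw, hwS, hw1, rfl⟩ := mem_convexHull_iff_InP.1 hx
    have h1 := hmax v (subset_convexHull ℝ _ (hS' hv))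
    rw [hφ w hwS hw1, ← one_smul ℝ v, ← ev_single, hφ (Finsupp.single v 1)
      (Finsupp.support_single_subset.trans (Finset.singleton_subset_iff.2 (hS' hv)))
      (tot_single _ _), ms_single _ _ _ hv] at h1
    refine mem_convexHull_iff_InP.2 ⟨w, hw, fun u hu => ?_, hw1, rfl⟩
    by_contra hu'
    have h2 : ms (· ∈ S') w + ms (fun u => ¬ u ∈ S') w = tot w :=
      (ms_split (fun _ _ => ⟨fun _ => em _, fun _ => trivial⟩) (fun _ _ h1 h2 => h2 h1)).symm
    have h3 : w u ≤ ms (fun u => ¬ u ∈ S') w := apply_le_ms hw hu'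
    exact Finsupp.mem_support_iff.1 hu (le_antisymm (by linarith) (hw u))

theorem exists_subset_of_isFaceOf {F : Set (Fin d → ℝ)}
    (h : IsFaceOf F (convexHull ℝ (S : Set (Fin d → ℝ)))) :
    ∃ S' ⊆ S, S'.Nonempty ∧ F = convexHull ℝ (S' : Set (Fin d → ℝ)) := by
  classical
  obtain ⟨⟨x0, hx0⟩, φ, rfl⟩ := h
  have hne : S.Nonempty := by
    have := convexHull_nonempty_iff.1 ⟨x0, hx0.1⟩
    exact_mod_cast this
  obtain ⟨v0, hv0, hmax⟩ := S.exists_max_image φ hne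
  have hle : ∀ y ∈ convexHull ℝ (S : Set (Fin d → ℝ)), φ y ≤ φ v0 := fun y hy =>
    convexHull_min (t := {y | φ y ≤ φ v0}) hmax (convex_halfSpace_le φ.isLinear _) hy
  refine ⟨S.filter (fun v => φ v = φ v0), Finset.filter_subset _ _,
    ⟨v0, Finset.mem_filter.2 ⟨hv0, rfl⟩⟩, Set.ext fun x => ⟨?_, fun hx => ?_⟩⟩
  · rintro ⟨hx, hxm⟩
    obtain ⟨w, hw, hwS, hw1, rfl⟩ := mem_convexHull_iff_InP.1 hx
    have h1 := hxm v0 (subset_convexHull ℝ _ hv0)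
    have h2 : ∑ u ∈ S, w u * (φ v0 - φ u) ≤ 0 := by
      simp only [mul_sub, Finset.sum_sub_distrib]
      rw [← Finset.sum_mul, ← tot_eq_sum w hwS, hw1, ← map_ev φ w hwS]
      linarith
    have h3 : ∀ u ∈ S, 0 ≤ w u * (φ v0 - φ u) := fun u hu =>
      mul_nonneg (hw u) (sub_nonneg.2 (hmax u hu))
    have h4 := (Finset.sum_eq_zero_iff_of_nonneg h3).1
      (le_antisymm h2 (Finset.sum_nonneg h3))
    refine mem_convexHull_iff_InP.2 ⟨w, hw, fun u hu => Finset.mem_filter.2 ⟨hwS hu, ?_⟩, hw1, rfl⟩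
    linarith [(mul_eq_zero.1 (h4 u (hwS hu))).resolve_left (Finsupp.mem_support_iff.1 hu)]
  · refine ⟨convexHull_mono (by exact_mod_cast Finset.filter_subset _ _) hx, fun y hy => ?_⟩
    have : φ v0 ≤ φ x := convexHull_min (t := {y | φ v0 ≤ φ y})
      (fun u hu => (Finset.mem_filter.1 hu).2.ge) (convex_halfSpace_ge φ.isLinear _) hx
    exact (hle y hy).trans this

theorem AffIndep.extremePoints (h : AffIndep S) :
    (convexHull ℝ (S : Set (Fin d → ℝ))).extremePoints ℝ = S := by
  refine Set.Subset.antisymm extremePoints_convexHull_subset (fun v hv => ?_)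
  obtain ⟨-, φ, hφ⟩ := h.isFaceOf (S' := {v}) (Finset.singleton_subset_iff.2 hv)
    (Finset.singleton_nonempty v)
  rw [Finset.coe_singleton, convexHull_singleton] at hφ
  have hv' : v ∈ ({v} : Set (Fin d → ℝ)) := rfl
  rw [hφ] at hv'
  refine mem_extremePoints.2 ⟨hv'.1, fun x hx y hy hxy => ?_⟩
  obtain ⟨a, b, ha, hb, hab, rfl⟩ := hxy
  have h1 := hv'.2 x hx
  have h2 := hv'.2 y hy
  rw [map_add, map_smul, map_smul, smul_eq_mul, smul_eq_mul] at h1 h2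
  have hb' : b = 1 - a := by linarith
  subst hb'
  have hxy : φ x = φ y := by
    apply le_antisymm
    · nlinarith
    · nlinarith
  have hm : ∀ z ∈ convexHull ℝ (S : Set (Fin d → ℝ)), φ z = φ x →
      z ∈ ({a • x + (1 - a) • y} : Set (Fin d → ℝ)) := by
    intro z hz hzx
    rw [hφ]
    refine ⟨hz, fun u hu => (hv'.2 u hu).trans ?_⟩
    rw [map_add, map_smul, map_smul, smul_eq_mul, smul_eq_mul, hzx, ← hxy]
    linarith
  exact ⟨hm x hx rfl, hm y hy hxy.symm⟩

theorem AffIndep.polyIndex (h : AffIndep S) (hne : S.Nonempty)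
    (hint : ∀ β : (Fin d → ℝ) →₀ ℝ, β.support ⊆ S → tot β = 0 → (∀ i, ev β i ∈ ZZ) →
      ∀ v, β v ∈ ZZ) : polyIndex (convexHull ℝ (S : Set (Fin d → ℝ))) = 1 := by
  refine AddSubgroup.relIndex_eq_one.2 ?_
  rintro y ⟨hy, hyz⟩
  have hspan : ∃ β : (Fin d → ℝ) →₀ ℝ, β.support ⊆ S ∧ tot β = 0 ∧ ev β = y := by
    replace hy : y ∈ Submodule.span ℝ (vertexDiffs (convexHull ℝ (S : Set (Fin d → ℝ)))) := hy
    clear hyz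
    induction hy using Submodule.span_induction with
    | mem y hy =>
      obtain ⟨u, hu, v, hv, rfl⟩ := hy
      rw [h.extremePoints] at hu hv
      refine ⟨Finsupp.single u 1 - Finsupp.single v 1, support_sub_subset
        (Finsupp.support_single_subset.trans (Finset.singleton_subset_iff.2 hu))
        (Finsupp.support_single_subset.trans (Finset.singleton_subset_iff.2 hv)), ?_, ?_⟩
      · rw [map_sub, tot_single, tot_single, sub_self]
      · rw [map_sub, ev_single, ev_single, one_smul, one_smul]
    | zero => exact ⟨0, by simp, map_zero _, map_zero _⟩
    | add _ _ _ _ h h' =>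
      obtain ⟨β, h1, h2, rfl⟩ := h
      obtain ⟨β', h1', h2', rfl⟩ := h'
      exact ⟨β + β', support_add_subset h1 h1', by rw [map_add, h2, h2', add_zero], map_add _ _ _⟩
    | smul c _ _ h =>
      obtain ⟨β, h1, h2, rfl⟩ := h
      exact ⟨c • β, support_smul_subset c h1, by rw [map_smul, h2, smul_zero], map_smul _ _ _⟩
  obtain ⟨β, hβ, h0, rfl⟩ := hspan
  obtain ⟨v0, hv0⟩ := hne
  have hz := hint β hβ h0 (fun i => by
    obtain ⟨z, hz⟩ := hyz i
    exact mem_ZZ.2 ⟨z, hz.symm⟩)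
  have he : ev β = ∑ v ∈ β.support, β v • (v - v0) := by
    simp only [smul_sub, Finset.sum_sub_distrib]
    rw [← Finset.sum_smul, ← tot_eq_sum β subset_rfl, h0, zero_smul, sub_zero, ev,
      Finsupp.linearCombination_apply, Finsupp.sum]
    rfl
  rw [he]
  refine sum_mem (fun v hv => ?_)
  obtain ⟨n, hn⟩ := hz v
  rw [← hn, show (Int.castRingHom ℝ) n = (n : ℝ) from rfl, Int.cast_smul_eq_zsmul]
  refine zsmul_mem (AddSubgroup.subset_closure
    (show v - v0 ∈ vertexDiffs _ from ⟨v, ?_, v0, ?_, rfl⟩)) n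
  · rw [h.extremePoints]
    exact hβ hv
  · rw [h.extremePoints]
    exact hv0

/-- `K` is the set of vertex sets of a unimodular triangulation of `Q`. -/
structure UniComplex (Q : Set (Fin d → ℝ)) (K : Set (Finset (Fin d → ℝ))) : Prop where
  finite : K.Finite
  down : ∀ S ∈ K, ∀ S' ⊆ S, S' ∈ K
  cover : ∀ x ∈ Q, ∃ w : (Fin d → ℝ) →₀ ℝ, 0 ≤ w ∧ w.support ∈ K ∧ tot w = 1 ∧ ev w = x
  mem : ∀ w : (Fin d → ℝ) →₀ ℝ, 0 ≤ w → w.support ∈ K → tot w = 1 → ev w ∈ Q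
  uniq : ∀ w w' : (Fin d → ℝ) →₀ ℝ, 0 ≤ w → 0 ≤ w' → w.support ∈ K → w'.support ∈ K →
    tot w = tot w' → ev w = ev w' → w = w'
  lat : ∀ S ∈ K, ∀ v ∈ S, ∀ i, v i ∈ ZZ
  int : ∀ S ∈ K, ∀ β : (Fin d → ℝ) →₀ ℝ, β.support ⊆ S → tot β = 0 → (∀ i, ev β i ∈ ZZ) →
    ∀ v, β v ∈ ZZ

variable {Q : Set (Fin d → ℝ)} {K : Set (Finset (Fin d → ℝ))}

theorem UniComplex.affIndep (h : UniComplex Q K) (hS : S ∈ K) : AffIndep S := by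
  intro β hβ ht he
  obtain ⟨p, n, hp, hn, rfl, hps, hns⟩ := exists_pos_neg β
  rw [map_sub, sub_eq_zero] at ht he
  rw [h.uniq p n hp hn (h.down S hS _ (hps.trans hβ)) (h.down S hS _ (hns.trans hβ)) ht he,
    sub_self]

theorem UniComplex.convexHull_inter [DecidableEq (Fin d → ℝ)] (h : UniComplex Q K) (hS : S ∈ K)
    (hS' : S' ∈ K) : convexHull ℝ (S : Set (Fin d → ℝ)) ∩ convexHull ℝ (S' : Set (Fin d → ℝ)) =
      convexHull ℝ ((S ∩ S' : Finset (Fin d → ℝ)) : Set (Fin d → ℝ)) := by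
  ext x
  constructor
  · rintro ⟨hx, hx'⟩
    obtain ⟨w, hw, hwS, hw1, rfl⟩ := mem_convexHull_iff_InP.1 hx
    obtain ⟨w', hw', hwS', hw1', he⟩ := mem_convexHull_iff_InP.1 hx'
    have := h.uniq w w' hw hw' (h.down S hS _ hwS) (h.down S' hS' _ hwS') (hw1.trans hw1'.symm)
      he.symm
    subst this
    exact mem_convexHull_iff_InP.2 ⟨w, hw, Finset.subset_inter hwS hwS', hw1, rfl⟩
  · intro hx
    exact ⟨convexHull_mono (by exact_mod_cast Finset.inter_subset_left) hx,
      convexHull_mono (by exact_mod_cast Finset.inter_subset_right) hx⟩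

theorem UniComplex.isUnimodularTriangulation (h : UniComplex Q K) :
    IsUnimodularTriangulation
      ((fun S : Finset (Fin d → ℝ) => convexHull ℝ (S : Set (Fin d → ℝ))) ''
        {S | S ∈ K ∧ S.Nonempty}) Q := by
  classical
  refine ⟨⟨(h.finite.subset (Set.sep_subset _ _)).image _, ?_, ?_, ?_, ?_⟩, ?_⟩
  · rintro _ ⟨S, ⟨hS, hne⟩, rfl⟩
    exact ⟨S, hne, (h.affIndep hS).affineIndependent, rfl⟩
  · ext x
    constructor
    · rintro ⟨_, ⟨S, ⟨hS, -⟩, rfl⟩, hx⟩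
      obtain ⟨w, hw, hwS, hw1, rfl⟩ := mem_convexHull_iff_InP.1 hx
      exact h.mem w hw (h.down S hS _ hwS) hw1
    · intro hx
      obtain ⟨w, hw, hwK, hw1, rfl⟩ := h.cover x hx
      refine ⟨_, ⟨w.support, ⟨hwK, ?_⟩, rfl⟩,
        mem_convexHull_iff_InP.2 ⟨w, hw, subset_rfl, hw1, rfl⟩⟩
      rw [Finset.nonempty_iff_ne_empty]
      intro h0
      rw [Finsupp.support_eq_empty.1 h0, map_zero] at hw1
      exact zero_ne_one hw1
  · rintro _ ⟨S, ⟨hS, -⟩, rfl⟩ F hF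
    obtain ⟨S', hS', hne, rfl⟩ := exists_subset_of_isFaceOf hF
    exact ⟨S', ⟨h.down S hS S' hS', hne⟩, rfl⟩
  · rintro _ ⟨S, ⟨hS, -⟩, rfl⟩ _ ⟨S', ⟨hS', -⟩, rfl⟩
    simp only [h.convexHull_inter hS hS']
    rcases (S ∩ S').eq_empty_or_nonempty with h0 | h0
    · left
      rw [h0, Finset.coe_empty, convexHull_empty]
    · exact Or.inr ⟨(h.affIndep hS).isFaceOf Finset.inter_subset_left h0,
        (h.affIndep hS').isFaceOf Finset.inter_subset_right h0⟩
  · rintro _ ⟨S, ⟨hS, hne⟩, rfl⟩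
    refine ⟨⟨S, hne, fun v hv i => ?_, (h.affIndep hS).affineIndependent, rfl⟩,
      (h.affIndep hS).polyIndex hne (h.int S hS)⟩
    obtain ⟨z, hz⟩ := h.lat S hS v hv i
    exact ⟨z, hz.symm⟩

theorem UT.exists_uniComplex {V : Finset (Fin d → ℝ)} {c : ℕ} (hc : 0 < c) (h : UT V c) :
    ∃ K, UniComplex ((c : ℝ) • convexHull ℝ (V : Set (Fin d → ℝ))) K := by
  classical
  obtain ⟨K, hKf, hK, hKv, hKi⟩ := h
  have hc0 : (c : ℝ) ≠ 0 := by exact_mod_cast hc.ne'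
  let ι := emb d (1, 0)
  have hsupp : ∀ w : (Fin d → ℝ) →₀ ℝ, (w.mapDomain ι).support = w.support.map ι := fun w => by
    rw [Finset.map_eq_image]
    exact Finsupp.mapDomain_support_of_injective ι.injective w
  have hev : ∀ w : (Fin d → ℝ) →₀ ℝ, ev (w.mapDomain ι) = (ev w, tot w, 0) := fun w => by
    rw [ev_mapDomain_emb, Prod.smul_mk, smul_eq_mul, mul_one, smul_zero]
  refine ⟨{S | S.map ι ∈ K}, hKf.preimage (Finset.map_injective ι).injOn,
    fun S hS S' hS' => hK.down _ hS _ (Finset.map_subset_map.2 hS'), ?_, ?_, ?_, ?_, ?_⟩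
  · rintro _ ⟨x, hx, rfl⟩
    have h1 : (((c : ℝ) • x, 1, 0) : CS d) ∈ coneOne V c := by
      refine ⟨zero_le_one, rfl, ?_⟩
      exact InP.smul (Nat.cast_nonneg c) (mem_convexHull_iff_InP.1 hx)
    obtain ⟨w, hw, hwK, hwe⟩ := hK.cover _ h1
    have hr : (w.support : Set (CS d)) ⊆ Set.range ι := by
      intro v hv
      have h2 := (hKv _ hwK v hv).2
      have h3 := (hK.vertex_mem hwK hv).2.1
      exact ⟨v.1, Prod.ext rfl (Prod.ext h2.symm h3.symm)⟩
    have hm := Finsupp.mapDomain_comapDomain ι ι.injective w hr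
    set w' := Finsupp.comapDomain ι w ι.injective.injOn with hw'
    have h4 := hev w'
    rw [hm, hwe] at h4
    have h5 := Prod.ext_iff.1 h4
    refine ⟨w', fun v => hw _, ?_, (Prod.ext_iff.1 h5.2).1.symm, h5.1.symm⟩
    rw [Set.mem_ofPred_eq, ← hsupp, hm]
    exact hwK
  · intro w hw hwK hw1
    have h1 := hK.mem (w.mapDomain ι) (Finsupp.mapDomain_nonneg hw) (by rw [hsupp]; exact hwK)
    rw [hev] at h1
    have h2 := h1.2.2
    simp only [hw1] at h2
    have h3 := InP.smul (c := (c : ℝ)⁻¹) (by positivity) h2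
    rw [mul_one, inv_mul_cancel₀ hc0] at h3
    exact ⟨_, mem_convexHull_iff_InP.2 h3, smul_inv_smul₀ hc0 _⟩
  · intro w w' hw hw' hwK hwK' ht he
    refine Finsupp.mapDomain_injective ι.injective (hK.uniq _ _ (Finsupp.mapDomain_nonneg hw)
      (Finsupp.mapDomain_nonneg hw') (by rw [hsupp]; exact hwK) (by rw [hsupp]; exact hwK') ?_)
    rw [hev, hev, ht, he]
  · intro S hS v hv
    exact (hKv _ hS _ (Finset.mem_map_of_mem ι hv)).1.1
  · intro S hS β hβ h0 hz v
    have h1 := hKi _ hS (β.mapDomain ι) (by rw [hsupp]; exact Finset.map_subset_map.2 hβ)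
      (by rw [hev]; exact ⟨hz, by rw [h0]; exact zero_mem _, zero_mem _⟩) (ι v)
    rwa [Finsupp.mapDomain_apply ι.injective] at h1

end Complexes

end ConeTri

theorem statement0 (d : ℕ) (hd : 0 < d) (P : Set (Fin d → ℝ)) (hP : IsIntegralPolytope P) :
    ∃ c : ℕ, 0 < c ∧ ∀ c' : ℕ, c ≤ c' →
      ∃ T : Set (Set (Fin d → ℝ)), IsUnimodularTriangulation T ((c' : ℝ) • P) := by
  obtain ⟨V, hne, hV, rfl⟩ := hP
  obtain ⟨c, hc, h⟩ := ConeTri.UT.eventually (V := V) (fun v hv i => by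
    obtain ⟨z, hz⟩ := hV v hv i
    exact ConeTri.mem_ZZ.2 ⟨z, hz.symm⟩) hne
  refine ⟨c, hc, fun c' hc' => ?_⟩
  obtain ⟨K, hK⟩ := (h c' hc').exists_uniComplex (hc.trans_le hc')
  exact ⟨_, hK.isUnimodularTriangulation⟩
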